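/- Let r ≥ 2 be an integer. If a C^r action ρ of Z^d on [0,1] has a noncyclic image group and has no r-parabolic global fixed point in the open interval (0,1), then ρ embeds into a C^1 flow (f^t) whose restriction away from the possible r-parabolic fixed points at the endpoints of [0,1] is generated by a C^{r-1} vector field. -/

import Mathlib

open Set MeasureTheory Filter Topology

noncomputable section

/-- An orientation-preserving `Cʳ` diffeomorphism of the interval `[0,1]`, extended by the
identity outside of `[0,1]`. -/
structure CrDiffeo (r : ℕ) : Type where
  toFun : ℝ → ℝ
  map_zero : toFun 0 = 0
  map_one : toFun 1 = 1
  fixes_outside : ∀ x : ℝ, x ∉ Icc (0:ℝ) 1 → toFun x = x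
  bijOn : BijOn toFun (Icc (0:ℝ) 1) (Icc (0:ℝ) 1)
  contDiff : ContDiffOn ℝ r toFun (Icc (0:ℝ) 1)
  deriv_pos : ∀ x ∈ Icc (0:ℝ) 1, 0 < derivWithin toFun (Icc (0:ℝ) 1) x

/-- An action of `ℤᵈ` on `[0,1]` by orientation-preserving `Cʳ` diffeomorphisms. -/
structure ZdActionCr (d r : ℕ) where
  elt : (Fin d → ℤ) → CrDiffeo r
  elt_add : ∀ a b : Fin d → ℤ, ∀ x : ℝ,
    (elt (a + b)).toFun x = (elt a).toFun ((elt b).toFun x)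
  elt_zero : ∀ x : ℝ, (elt 0).toFun x = x

/-- `p` is an `r`-parabolic global fixed point of the action `ρ`: it is fixed by every element
of the image group, and every element of the image group is `Cʳ`-tangent to the identity at
`p` (all derivatives up to order `r` agree with those of the identity). -/
def IsRParabolicPt {d r : ℕ} (ρ : ZdActionCr d r) (p : ℝ) : Prop :=
  (∀ a : Fin d → ℤ, (ρ.elt a).toFun p = p) ∧
  (∀ a : Fin d → ℤ, ∀ k : ℕ, 1 ≤ k → k ≤ r →
    iteratedDerivWithin k (ρ.elt a).toFun (Icc (0:ℝ) 1) p = if k = 1 then 1 else 0)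

/-- `Φ`, together with its spatial derivative `Φ'`, is a `C¹` flow on `s ⊆ ℝ` (extended by the
identity outside of `s`). -/
def IsC1FlowOn (s : Set ℝ) (Φ Φ' : ℝ → ℝ → ℝ) : Prop :=
  (∀ x : ℝ, Φ 0 x = x) ∧
  (∀ t u : ℝ, ∀ x : ℝ, Φ (t + u) x = Φ t (Φ u x)) ∧
  (∀ t : ℝ, ∀ x ∉ s, Φ t x = x) ∧
  (∀ t : ℝ, BijOn (Φ t) s s) ∧
  (∀ t : ℝ, ∀ x ∈ s, HasDerivWithinAt (Φ t) (Φ' t x) s x) ∧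
  (∀ t : ℝ, ContinuousOn (Φ' t) s) ∧
  (∀ t : ℝ, ∀ x ∈ s, 0 < Φ' t x) ∧
  (∀ t₀ : ℝ, ∀ K : Set ℝ, IsCompact K → K ⊆ s → ∀ ε > (0:ℝ), ∃ δ > (0:ℝ), ∀ t : ℝ,
    |t - t₀| < δ → ∀ x ∈ K,
      |Φ t x - Φ t₀ x| + |Real.log (Φ' t x) - Real.log (Φ' t₀ x)| < ε)


namespace ZdActionCr

variable {d r : ℕ} (ρ : ZdActionCr d r)

def F (a : Fin d → ℤ) (x : ℝ) : ℝ := (ρ.elt a).toFun x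
def D (a : Fin d → ℤ) (x : ℝ) : ℝ := derivWithin (ρ.F a) (Icc (0:ℝ) 1) x
def l (a : Fin d → ℤ) (x : ℝ) : ℝ := Real.log (ρ.D a x)

lemma F_add (a b : Fin d → ℤ) (x : ℝ) : ρ.F (a + b) x = ρ.F a (ρ.F b x) := ρ.elt_add a b x
lemma F_zero (x : ℝ) : ρ.F 0 x = x := ρ.elt_zero x
lemma F_comm (a b : Fin d → ℤ) (x : ℝ) : ρ.F a (ρ.F b x) = ρ.F b (ρ.F a x) := by
  rw [← F_add, ← F_add, add_comm]
lemma F_neg_F (a : Fin d → ℤ) (x : ℝ) : ρ.F (-a) (ρ.F a x) = x := by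
  rw [← F_add]; simp [F_zero]
lemma F_F_neg (a : Fin d → ℤ) (x : ℝ) : ρ.F a (ρ.F (-a) x) = x := by
  rw [← F_add]; simp [F_zero]
lemma F_at_zero (a : Fin d → ℤ) : ρ.F a 0 = 0 := (ρ.elt a).map_zero
lemma F_at_one (a : Fin d → ℤ) : ρ.F a 1 = 1 := (ρ.elt a).map_one
lemma F_out (a : Fin d → ℤ) {x : ℝ} (hx : x ∉ Icc (0:ℝ) 1) : ρ.F a x = x :=
  (ρ.elt a).fixes_outside x hx
lemma F_mem (a : Fin d → ℤ) {x : ℝ} (hx : x ∈ Icc (0:ℝ) 1) : ρ.F a x ∈ Icc (0:ℝ) 1 :=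
  (ρ.elt a).bijOn.mapsTo hx
lemma F_contDiffOn (a : Fin d → ℤ) : ContDiffOn ℝ r (ρ.F a) (Icc (0:ℝ) 1) := (ρ.elt a).contDiff
lemma D_pos (a : Fin d → ℤ) {x : ℝ} (hx : x ∈ Icc (0:ℝ) 1) : 0 < ρ.D a x :=
  (ρ.elt a).deriv_pos x hx
lemma exp_l (a : Fin d → ℤ) {x : ℝ} (hx : x ∈ Icc (0:ℝ) 1) : Real.exp (ρ.l a x) = ρ.D a x :=
  Real.exp_log (ρ.D_pos a hx)

lemma F_strictMono (a : Fin d → ℤ) : StrictMono (ρ.F a) := by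
  have h1 : StrictMonoOn (ρ.F a) (Icc (0:ℝ) 1) := by
    apply strictMonoOn_of_deriv_pos (convex_Icc 0 1) (ρ.F_contDiffOn a).continuousOn
    intro x hx
    have := ρ.D_pos a (interior_subset hx)
    rwa [D, derivWithin_of_mem_nhds (mem_interior_iff_mem_nhds.1 hx)] at this
  intro x y hxy
  by_cases hx : x ∈ Icc (0:ℝ) 1 <;> by_cases hy : y ∈ Icc (0:ℝ) 1
  · exact h1 hx hy hxy
  · rw [ρ.F_out a hy]
    have := ρ.F_mem a hx
    simp only [mem_Icc, not_and, not_le] at hx hy this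
    have := hy (by linarith)
    linarith
  · rw [ρ.F_out a hx]
    have := ρ.F_mem a hy
    simp only [mem_Icc, not_and, not_le] at hx hy this
    by_contra hc
    have := hx (by linarith)
    linarith
  · rwa [ρ.F_out a hy, ρ.F_out a hx]

lemma F_lt_iff (a : Fin d → ℤ) {x y : ℝ} : ρ.F a x < ρ.F a y ↔ x < y := (ρ.F_strictMono a).lt_iff_lt
lemma F_le_iff (a : Fin d → ℤ) {x y : ℝ} : ρ.F a x ≤ ρ.F a y ↔ x ≤ y := (ρ.F_strictMono a).le_iff_le
lemma F_inj (a : Fin d → ℤ) {x y : ℝ} : ρ.F a x = ρ.F a y ↔ x = y := (ρ.F_strictMono a).injective.eq_iff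

lemma F_cont (a : Fin d → ℤ) : Continuous (ρ.F a) :=
  (ρ.F_strictMono a).monotone.continuous_of_surjective fun y => ⟨ρ.F (-a) y, ρ.F_F_neg a y⟩

lemma F_mem_Ioo (a : Fin d → ℤ) {x : ℝ} (hx : x ∈ Ioo (0:ℝ) 1) : ρ.F a x ∈ Ioo (0:ℝ) 1 := by
  have h0 := (ρ.F_lt_iff a).2 hx.1
  have h1 := (ρ.F_lt_iff a).2 hx.2
  rw [F_at_zero] at h0
  rw [F_at_one] at h1
  exact ⟨h0, h1⟩

lemma F_hasDeriv (hr : 2 ≤ r) (a : Fin d → ℤ) {x : ℝ} (hx : x ∈ Icc (0:ℝ) 1) :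
    HasDerivWithinAt (ρ.F a) (Real.exp (ρ.l a x)) (Icc (0:ℝ) 1) x := by
  rw [exp_l _ _ hx]
  exact ((ρ.F_contDiffOn a).differentiableOn (by norm_cast; omega) x hx).hasDerivWithinAt

lemma uII : UniqueDiffOn ℝ (Icc (0:ℝ) 1) := uniqueDiffOn_Icc zero_lt_one

lemma D_contDiffOn (hr : 2 ≤ r) (a : Fin d → ℤ) :
    ContDiffOn ℝ ((r - 1 : ℕ) : WithTop ℕ∞) (ρ.D a) (Icc (0:ℝ) 1) := by
  apply (ρ.F_contDiffOn a).derivWithin uII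
  norm_cast; omega

lemma l_contDiffOn (hr : 2 ≤ r) (a : Fin d → ℤ) :
    ContDiffOn ℝ ((r - 1 : ℕ) : WithTop ℕ∞) (ρ.l a) (Icc (0:ℝ) 1) :=
  (ρ.D_contDiffOn hr a).log fun _ hx => (ρ.D_pos a hx).ne'

lemma l_continuousOn (hr : 2 ≤ r) (a : Fin d → ℤ) : ContinuousOn (ρ.l a) (Icc (0:ℝ) 1) :=
  (ρ.l_contDiffOn hr a).continuousOn

lemma l_lip (hr : 2 ≤ r) (a : Fin d → ℤ) : ∃ M : ℝ, 0 ≤ M ∧ ∀ x ∈ Icc (0:ℝ) 1, ∀ y ∈ Icc (0:ℝ) 1,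
    |ρ.l a x - ρ.l a y| ≤ M * |x - y| := by
  have h1 : ContDiffOn ℝ 1 (ρ.l a) (Icc (0:ℝ) 1) := (ρ.l_contDiffOn hr a).of_le (by norm_cast; omega)
  have h2 : ContinuousOn (derivWithin (ρ.l a) (Icc (0:ℝ) 1)) (Icc (0:ℝ) 1) :=
    h1.continuousOn_derivWithin uII le_rfl
  obtain ⟨M, hM⟩ := isCompact_Icc.exists_bound_of_continuousOn h2
  refine ⟨M, (norm_nonneg _).trans (hM 0 (by simp)), fun x hx y hy => ?_⟩
  exact (convex_Icc (0:ℝ) 1).norm_image_sub_le_of_norm_derivWithin_le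
    (h1.differentiableOn one_ne_zero) hM hy hx

lemma l_bdd (hr : 2 ≤ r) (a : Fin d → ℤ) : ∃ M : ℝ, 0 ≤ M ∧ ∀ x ∈ Icc (0:ℝ) 1, |ρ.l a x| ≤ M := by
  obtain ⟨M, hM⟩ := isCompact_Icc.exists_bound_of_continuousOn (ρ.l_continuousOn hr a)
  exact ⟨M, (norm_nonneg _).trans (hM 0 (by simp)), hM⟩

lemma l_add (hr : 2 ≤ r) (a b : Fin d → ℤ) {x : ℝ} (hx : x ∈ Icc (0:ℝ) 1) :
    ρ.l (a + b) x = ρ.l a (ρ.F b x) + ρ.l b x := by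
  have h1 := (ρ.F_hasDeriv hr a (ρ.F_mem b hx)).comp x (ρ.F_hasDeriv hr b hx) (fun y hy => ρ.F_mem b hy)
  have h2 : ρ.F a ∘ ρ.F b = ρ.F (a + b) := by ext y; simp [F_add]
  rw [h2, ← Real.exp_add] at h1
  have h3 := (uII x hx).eq_deriv _ h1 (ρ.F_hasDeriv hr (a + b) hx)
  exact (Real.exp_injective h3).symm

lemma l_zero (hr : 2 ≤ r) {x : ℝ} (hx : x ∈ Icc (0:ℝ) 1) : ρ.l 0 x = 0 := by
  have := ρ.l_add hr 0 0 hx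
  rw [add_zero, F_zero] at this
  linarith

/-- commuted cocycle -/
lemma l_comm (hr : 2 ≤ r) (g b : Fin d → ℤ) {x : ℝ} (hx : x ∈ Icc (0:ℝ) 1) :
    ρ.l g x = ρ.l g (ρ.F b x) + ρ.l b x - ρ.l b (ρ.F g x) := by
  have h1 := ρ.l_add hr g b hx
  have h2 := ρ.l_add hr b g hx
  rw [add_comm] at h2
  linarith

lemma uIcc_sub {x y : ℝ} (hx : x ∈ Icc (0:ℝ) 1) (hy : y ∈ Icc (0:ℝ) 1) : uIcc x y ⊆ Icc (0:ℝ) 1 :=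
  ordConnected_Icc.uIcc_subset hx hy

lemma F_mvt (hr : 2 ≤ r) (a : Fin d → ℤ) {x y : ℝ} (hx : x ∈ Icc (0:ℝ) 1) (hy : y ∈ Icc (0:ℝ) 1) :
    ∃ z ∈ uIcc x y, ρ.F a y - ρ.F a x = Real.exp (ρ.l a z) * (y - x) := by
  wlog hxy : x < y generalizing x y
  · rcases eq_or_lt_of_le (not_lt.1 hxy) with h | h
    · subst h; exact ⟨y, by simp, by simp⟩
    · obtain ⟨z, hz, h⟩ := this hy hx h
      exact ⟨z, by rwa [uIcc_comm], by linarith⟩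
  obtain ⟨z, hz, h⟩ := exists_hasDerivAt_eq_slope (ρ.F a) (fun z => Real.exp (ρ.l a z)) hxy
    (ρ.F_cont a).continuousOn (fun z hz => by
      have hz' : z ∈ Ioo (0:ℝ) 1 := ⟨hx.1.trans_lt hz.1, hz.2.trans_le hy.2⟩
      exact (ρ.F_hasDeriv hr a (Ioo_subset_Icc_self hz')).hasDerivAt (Icc_mem_nhds hz'.1 hz'.2))
  refine ⟨z, Icc_subset_uIcc (Ioo_subset_Icc_self hz), ?_⟩
  rw [h]
  field_simp [sub_ne_zero.2 hxy.ne']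

lemma F_lip (hr : 2 ≤ r) (a : Fin d → ℤ) : ∃ C : ℝ, 0 ≤ C ∧ ∀ x ∈ Icc (0:ℝ) 1, ∀ y ∈ Icc (0:ℝ) 1,
    |ρ.F a y - ρ.F a x| ≤ C * |y - x| := by
  obtain ⟨M, hM, h⟩ := ρ.l_bdd hr a
  refine ⟨Real.exp M, (Real.exp_pos _).le, fun x hx y hy => ?_⟩
  obtain ⟨z, hz, e⟩ := ρ.F_mvt hr a hx hy
  rw [e, abs_mul, Real.abs_exp]
  gcongr
  exact (le_abs_self _).trans (h z (uIcc_sub hx hy hz))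

lemma F_nsmul_succ (n : ℕ) (a : Fin d → ℤ) (x : ℝ) : ρ.F ((n + 1) • a) x = ρ.F a (ρ.F (n • a) x) := by
  rw [succ_nsmul', F_add]

lemma F_nsmul_succ' (n : ℕ) (a : Fin d → ℤ) (x : ℝ) : ρ.F ((n + 1) • a) x = ρ.F (n • a) (ρ.F a x) := by
  rw [succ_nsmul, F_add]

end ZdActionCr

namespace ZdActionCr

variable {d r : ℕ} (ρ : ZdActionCr d r)

lemma F_nsmul_le {a : Fin d → ℤ} {x : ℝ} (h : x ≤ ρ.F a x) : Monotone fun n : ℕ => ρ.F (n • a) x :=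
  monotone_nat_of_le_succ fun n => by rw [F_nsmul_succ']; exact (ρ.F_strictMono _).monotone h

lemma F_nsmul_ge {a : Fin d → ℤ} {x : ℝ} (h : ρ.F a x ≤ x) : Antitone fun n : ℕ => ρ.F (n • a) x :=
  antitone_nat_of_succ_le fun n => by rw [F_nsmul_succ']; exact (ρ.F_strictMono _).monotone h

lemma orbit_lim (a : Fin d → ℤ) {x : ℝ} (hx : x ∈ Icc (0:ℝ) 1) : ∃ e ∈ Icc (0:ℝ) 1,
    Tendsto (fun n : ℕ => ρ.F (n • a) x) atTop (𝓝 e) ∧ ρ.F a e = e ∧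
    (x ≤ ρ.F a x → ∀ n : ℕ, ρ.F (n • a) x ≤ e) ∧ (ρ.F a x ≤ x → ∀ n : ℕ, e ≤ ρ.F (n • a) x) := by
  have hmem : ∀ n : ℕ, ρ.F (n • a) x ∈ Icc (0:ℝ) 1 := fun n => ρ.F_mem _ hx
  have key : ∃ e, Tendsto (fun n : ℕ => ρ.F (n • a) x) atTop (𝓝 e) := by
    rcases le_total x (ρ.F a x) with h | h
    · exact ⟨_, tendsto_atTop_ciSup (ρ.F_nsmul_le h) ⟨1, by rintro _ ⟨n, rfl⟩; exact (hmem n).2⟩⟩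
    · exact ⟨_, tendsto_atTop_ciInf (ρ.F_nsmul_ge h) ⟨0, by rintro _ ⟨n, rfl⟩; exact (hmem n).1⟩⟩
  obtain ⟨e, he⟩ := key
  refine ⟨e, isClosed_Icc.mem_of_tendsto he (Eventually.of_forall hmem), he, ?_, ?_, ?_⟩
  · have h1 := ((ρ.F_cont a).tendsto e).comp he
    have h2 := (tendsto_add_atTop_iff_nat 1).2 he
    refine tendsto_nhds_unique h1 (h2.congr fun n => ?_)
    rw [F_nsmul_succ]; rfl
  · exact fun h n => (ρ.F_nsmul_le h).ge_of_tendsto he n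
  · exact fun h n => (ρ.F_nsmul_ge h).le_of_tendsto he n

lemma F_uIcc (a : Fin d → ℤ) {y u v : ℝ} (hy : y ∈ uIcc u v) : ρ.F a y ∈ uIcc (ρ.F a u) (ρ.F a v) :=
  (ρ.F_strictMono a).monotone.image_uIcc_subset (mem_image_of_mem _ hy)

lemma dist_n (hr : 2 ≤ r) {a : Fin d → ℤ} {M : ℝ} (hM0 : 0 ≤ M)
    (hM : ∀ x ∈ Icc (0:ℝ) 1, ∀ y ∈ Icc (0:ℝ) 1, |ρ.l a x - ρ.l a y| ≤ M * |x - y|)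
    {g : Fin d → ℤ} {w y : ℝ} (hw : w ∈ Icc (0:ℝ) 1) (hy : y ∈ uIcc w (ρ.F a w))
    (hgy : ρ.F g y ∈ uIcc w (ρ.F a w)) (n : ℕ) :
    |ρ.l g y - ρ.l g (ρ.F (n • a) y)| ≤ M * |w - ρ.F (n • a) w| := by
  have hyI : y ∈ Icc (0:ℝ) 1 := uIcc_sub hw (ρ.F_mem a hw) hy
  induction n with
  | zero => simp [F_zero]
  | succ n ih =>
    have hx := ρ.F_mem (n • a) hyI
    have e1 := ρ.l_comm hr g a hx
    rw [← F_nsmul_succ] at e1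
    have e2 : |ρ.l g (ρ.F (n • a) y) - ρ.l g (ρ.F ((n + 1) • a) y)|
        ≤ M * |ρ.F (n • a) w - ρ.F ((n + 1) • a) w| := by
      have : ρ.l g (ρ.F (n • a) y) - ρ.l g (ρ.F ((n + 1) • a) y)
        = ρ.l a (ρ.F (n • a) y) - ρ.l a (ρ.F g (ρ.F (n • a) y)) := by linarith
      rw [this]
      refine (hM _ hx _ (ρ.F_mem g hx)).trans ?_
      refine mul_le_mul_of_nonneg_left ?_ hM0
      rw [F_comm, F_nsmul_succ', abs_sub_comm, abs_sub_comm (ρ.F (n • a) w)]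
      exact abs_sub_le_of_uIcc_subset_uIcc
        (uIcc_subset_uIcc (ρ.F_uIcc _ hy) (ρ.F_uIcc _ hgy))
    have e3 : |w - ρ.F (n • a) w| + |ρ.F (n • a) w - ρ.F ((n + 1) • a) w|
        = |w - ρ.F ((n + 1) • a) w| := by
      rcases le_total w (ρ.F a w) with h | h
      · have h1 := ρ.F_nsmul_le h (Nat.zero_le n)
        have h2 := ρ.F_nsmul_le h (Nat.le_succ n)
        simp only [zero_smul, F_zero] at h1 h2
        rw [abs_of_nonpos (by linarith), abs_of_nonpos (by linarith), abs_of_nonpos (by linarith)]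
        ring
      · have h1 := ρ.F_nsmul_ge h (Nat.zero_le n)
        have h2 := ρ.F_nsmul_ge h (Nat.le_succ n)
        simp only [zero_smul, F_zero] at h1 h2
        rw [abs_of_nonneg (by linarith), abs_of_nonneg (by linarith), abs_of_nonneg (by linarith)]
        ring
    rw [← e3, mul_add]
    exact (abs_sub_le _ _ _).trans (add_le_add ih e2)

lemma orbit_lim_uIcc {a : Fin d → ℤ} {w y e : ℝ} (hy : y ∈ uIcc w (ρ.F a w))
    (he : Tendsto (fun n : ℕ => ρ.F (n • a) w) atTop (𝓝 e)) :
    Tendsto (fun n : ℕ => ρ.F (n • a) y) atTop (𝓝 e) := by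
  have h2 := (tendsto_add_atTop_iff_nat 1).2 he
  have hl := he.min h2
  have hu := he.max h2
  rw [min_self] at hl
  rw [max_self] at hu
  refine tendsto_of_tendsto_of_tendsto_of_le_of_le hl hu (fun n => ?_) (fun n => ?_)
  · have := (ρ.F_uIcc (n • a) hy).1
    rw [← F_nsmul_succ'] at this
    exact this
  · have := (ρ.F_uIcc (n • a) hy).2
    rw [← F_nsmul_succ'] at this
    exact this

lemma dist_lim (hr : 2 ≤ r) {a : Fin d → ℤ} {M : ℝ} (hM0 : 0 ≤ M)
    (hM : ∀ x ∈ Icc (0:ℝ) 1, ∀ y ∈ Icc (0:ℝ) 1, |ρ.l a x - ρ.l a y| ≤ M * |x - y|)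
    {g : Fin d → ℤ} {w y e : ℝ} (hw : w ∈ Icc (0:ℝ) 1) (hy : y ∈ uIcc w (ρ.F a w))
    (hgy : ρ.F g y ∈ uIcc w (ρ.F a w))
    (he : Tendsto (fun n : ℕ => ρ.F (n • a) w) atTop (𝓝 e)) :
    |ρ.l g y - ρ.l g e| ≤ M * |w - e| := by
  have hyI : y ∈ Icc (0:ℝ) 1 := uIcc_sub hw (ρ.F_mem a hw) hy
  have hmem : ∀ n : ℕ, ρ.F (n • a) y ∈ Icc (0:ℝ) 1 := fun n => ρ.F_mem _ hyI
  have hey := ρ.orbit_lim_uIcc hy he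
  have heI := isClosed_Icc.mem_of_tendsto hey (Eventually.of_forall hmem)
  have h1 : Tendsto (fun n : ℕ => ρ.l g (ρ.F (n • a) y)) atTop (𝓝 (ρ.l g e)) :=
    ((ρ.l_continuousOn hr g) e heI).tendsto.comp
      (tendsto_nhdsWithin_iff.2 ⟨hey, Eventually.of_forall hmem⟩)
  exact le_of_tendsto_of_tendsto' (tendsto_const_nhds.sub h1).abs
    ((tendsto_const_nhds.sub he).abs.const_mul M) (fun n => ρ.dist_n hr hM0 hM hw hy hgy n)

lemma count (hr : 2 ≤ r) {g : Fin d → ℤ} {y K : ℝ} (hy : y ∈ Icc (0:ℝ) 1) (n : ℕ)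
    (h : ∀ i < n, ∀ z ∈ uIcc y (ρ.F g y), |ρ.l (i • g) z| ≤ K) :
    n * Real.exp (-K) * |ρ.F g y - y| ≤ 1 := by
  have key : ∀ m ≤ n, ∃ c ≥ m * Real.exp (-K), ρ.F (m • g) y - y = c * (ρ.F g y - y) := by
    intro m
    induction m with
    | zero => intro _; exact ⟨0, by simp, by simp [F_zero]⟩
    | succ m ih =>
      intro hm
      obtain ⟨c, hc, e⟩ := ih (by omega)
      obtain ⟨z, hz, e2⟩ := ρ.F_mvt hr (m • g) hy (ρ.F_mem g hy)
      refine ⟨c + Real.exp (ρ.l (m • g) z), ?_, ?_⟩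
      · push_cast
        have : Real.exp (-K) ≤ Real.exp (ρ.l (m • g) z) :=
          Real.exp_le_exp.2 (neg_le_of_abs_le (h m (by omega) z hz))
        linarith
      · rw [F_nsmul_succ']; linarith
  obtain ⟨c, hc, e⟩ := key n le_rfl
  have h1 := ρ.F_mem (n • g) hy
  have h2 : |ρ.F (n • g) y - y| ≤ 1 := by
    rw [abs_le]; constructor <;> linarith [h1.1, h1.2, hy.1, hy.2]
  rw [e, abs_mul] at h2
  refine le_trans ?_ h2
  gcongr
  exact hc.le.trans (le_abs_self c)

lemma l_le_of_seq (hr : 2 ≤ r) {g h : Fin d → ℤ} {e : ℝ} {x : ℕ → ℝ} (he : e ∈ Icc (0:ℝ) 1)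
    (hg : ρ.F g e = e) (hh : ρ.F h e = e) (hx : ∀ n, x n ∈ Icc (0:ℝ) 1) (hne : ∀ n, x n ≠ e)
    (hlim : Tendsto x atTop (𝓝 e)) (hle : ∀ n, |ρ.F g (x n) - e| ≤ |ρ.F h (x n) - e|) :
    ρ.l g e ≤ ρ.l h e := by
  have hl : Tendsto x atTop (𝓝[Icc (0:ℝ) 1 \ {e}] e) :=
    tendsto_nhdsWithin_iff.2 ⟨hlim, Eventually.of_forall fun n => ⟨hx n, hne n⟩⟩
  have h1 := ((hasDerivWithinAt_iff_tendsto_slope.1 (ρ.F_hasDeriv hr g he)).comp hl).abs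
  have h2 := ((hasDerivWithinAt_iff_tendsto_slope.1 (ρ.F_hasDeriv hr h he)).comp hl).abs
  rw [Real.abs_exp] at h1 h2
  apply Real.exp_le_exp.1
  refine le_of_tendsto_of_tendsto' h1 h2 fun n => ?_
  simp only [Function.comp, slope, vsub_eq_sub, smul_eq_mul, abs_mul, hg, hh]
  exact mul_le_mul_of_nonneg_left (hle n) (abs_nonneg _)

lemma kopell_up (hr : 2 ≤ r) {g a : Fin d → ℤ} {x : ℝ} (hx : x ∈ Icc (0:ℝ) 1) (hg : ρ.F g x = x)
    (ha : x < ρ.F a x) {y : ℝ} (hy : y ∈ Icc x (ρ.F a x)) : ρ.F g y = y := by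
  obtain ⟨M, hM0, hM⟩ := ρ.l_lip hr a
  obtain ⟨e, he, hlim, hae, hup, -⟩ := ρ.orbit_lim a hx
  have hup := hup ha.le
  have hxa := ρ.F_mem a hx
  have hne : ∀ n : ℕ, ρ.F (n • a) x ≠ e := fun n h => by
    have h1 := (ρ.F_lt_iff (n • a)).2 ha
    rw [← F_nsmul_succ'] at h1
    have := hup (n + 1)
    linarith
  have hmg : ∀ m : ℕ, ∀ z, ρ.F g z = z → ρ.F (m • g) z = z := by
    intro m z hz
    induction m with
    | zero => simp [F_zero]
    | succ m ih => rw [F_nsmul_succ', hz, ih]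
  have hgn : ∀ n : ℕ, ρ.F g (ρ.F (n • a) x) = ρ.F (n • a) x := fun n => by rw [F_comm, hg]
  have hge : ρ.F g e = e := by
    refine tendsto_nhds_unique (((ρ.F_cont g).tendsto e).comp hlim) (hlim.congr fun n => ?_)
    exact (hgn n).symm
  have hle : ∀ m : ℕ, ρ.l (m • g) e = 0 := by
    intro m
    rw [← ρ.l_zero hr he]
    apply le_antisymm
    · exact ρ.l_le_of_seq hr he (hmg m e hge) (ρ.F_zero e) (fun n => ρ.F_mem (n • a) hx) hne hlim
        (fun n => by rw [hmg m _ (hgn n), F_zero])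
    · exact ρ.l_le_of_seq hr he (ρ.F_zero e) (hmg m e hge) (fun n => ρ.F_mem (n • a) hx) hne hlim
        (fun n => by rw [hmg m _ (hgn n), F_zero])
  have hmaps : ∀ m : ℕ, ∀ z ∈ Icc x (ρ.F a x), ρ.F (m • g) z ∈ Icc x (ρ.F a x) := by
    intro m z hz
    have h1 := (ρ.F_le_iff (m • g)).2 hz.1
    have h2 := (ρ.F_le_iff (m • g)).2 hz.2
    rw [hmg m x hg] at h1
    rw [F_comm, hmg m x hg] at h2
    exact ⟨h1, h2⟩
  have hbd : ∀ m : ℕ, ∀ z ∈ Icc x (ρ.F a x), |ρ.l (m • g) z| ≤ M := by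
    intro m z hz
    have := ρ.dist_lim hr hM0 hM (g := m • g) hx (Icc_subset_uIcc hz) (Icc_subset_uIcc (hmaps m z hz)) hlim
    rw [hle m, sub_zero] at this
    refine this.trans (mul_le_of_le_one_right hM0 ?_)
    rw [abs_le]; constructor <;> linarith [hx.1, hx.2, he.1, he.2]
  have hyI : y ∈ Icc (0:ℝ) 1 := ⟨hx.1.trans hy.1, hy.2.trans hxa.2⟩
  have hgy : ρ.F g y ∈ Icc x (ρ.F a x) := by simpa using hmaps 1 y hy
  have hcount : ∀ n : ℕ, n * Real.exp (-M) * |ρ.F g y - y| ≤ 1 := fun n =>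
    ρ.count hr hyI n fun i _ z hz => hbd i z (ordConnected_Icc.uIcc_subset hy hgy hz)
  by_contra hne'
  have hpos : 0 < Real.exp (-M) * |ρ.F g y - y| :=
    mul_pos (Real.exp_pos _) (abs_pos.2 (sub_ne_zero.2 hne'))
  obtain ⟨n, hn⟩ := exists_nat_gt (1 / (Real.exp (-M) * |ρ.F g y - y|))
  rw [div_lt_iff₀ hpos] at hn
  have := hcount n
  rw [mul_assoc] at this
  linarith

/-- positive set at `x` -/
def P (x : ℝ) : Set (Fin d → ℤ) := {g | x < ρ.F g x}

/-- global fixed points -/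
def Fx : Set ℝ := {p | ∀ a, ρ.F a p = p}

lemma mem_P {g : Fin d → ℤ} {x : ℝ} : g ∈ ρ.P x ↔ x < ρ.F g x := Iff.rfl

lemma neg_mem_P {g : Fin d → ℤ} {x : ℝ} : -g ∈ ρ.P x ↔ ρ.F g x < x := by
  rw [mem_P, ← ρ.F_lt_iff g, F_F_neg]

lemma F_eq_iff {g : Fin d → ℤ} {x : ℝ} : ρ.F g x = x ↔ g ∉ ρ.P x ∧ -g ∉ ρ.P x := by
  rw [neg_mem_P, mem_P]
  constructor
  · intro h; simp [h]
  · rintro ⟨h1, h2⟩; linarith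

lemma exists_mem_P {x : ℝ} (hx : x ∉ ρ.Fx) : ∃ a, a ∈ ρ.P x := by
  simp only [Fx, mem_ofPred_eq, not_forall] at hx
  obtain ⟨a, ha⟩ := hx
  rcases lt_or_gt_of_ne ha with h | h
  · exact ⟨-a, ρ.neg_mem_P.2 h⟩
  · exact ⟨a, h⟩

lemma not_Fx_of_mem_P {x : ℝ} {a : Fin d → ℤ} (ha : a ∈ ρ.P x) : x ∉ ρ.Fx := fun h => by
  have := h a
  rw [mem_P] at ha
  linarith

lemma mem_Ioo_of_not_Fx {x : ℝ} (hx : x ∉ ρ.Fx) : x ∈ Ioo (0:ℝ) 1 := by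
  simp only [Fx, mem_ofPred_eq, not_forall] at hx
  obtain ⟨a, ha⟩ := hx
  have h1 : x ∈ Icc (0:ℝ) 1 := by
    by_contra h; exact ha (ρ.F_out a h)
  refine ⟨lt_of_le_of_ne h1.1 ?_, lt_of_le_of_ne h1.2 ?_⟩
  · rintro rfl; exact ha (ρ.F_at_zero a)
  · rintro rfl; exact ha (ρ.F_at_one a)

lemma P_orbit (b : Fin d → ℤ) (x : ℝ) : ρ.P (ρ.F b x) = ρ.P x := by
  ext g
  rw [mem_P, mem_P, F_comm, F_lt_iff]

lemma kopell_two (hr : 2 ≤ r) {g a : Fin d → ℤ} {x : ℝ} (hg : ρ.F g x = x)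
    (ha : a ∈ ρ.P x) {y : ℝ} (hy : y ∈ Icc (ρ.F (-a) x) (ρ.F a x)) : ρ.F g y = y := by
  have hx := Ioo_subset_Icc_self (ρ.mem_Ioo_of_not_Fx (ρ.not_Fx_of_mem_P ha))
  rcases le_total x y with h | h
  · exact ρ.kopell_up hr hx hg ha ⟨h, hy.2⟩
  · refine ρ.kopell_up hr (x := ρ.F (-a) x) (a := a) (ρ.F_mem _ hx) ?_ ?_ ⟨hy.1, ?_⟩
    · rw [F_comm, hg]
    · rw [F_F_neg, ← ρ.F_lt_iff a, F_F_neg]; exact ha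
    · rwa [F_F_neg]

lemma P_local_aux {a : Fin d → ℤ} {x : ℝ} {y : ℝ}
    (hy : y ∈ Ioo (ρ.F (-a) x) (ρ.F a x)) : a ∈ ρ.P y ∧ x ∈ Ioo (ρ.F (-a) y) (ρ.F a y) := by
  have h1 : x < ρ.F a y := by rw [← ρ.F_lt_iff (-a), F_neg_F]; exact hy.1
  have h2 : ρ.F (-a) y < x := by rw [← ρ.F_lt_iff a, F_F_neg]; exact hy.2
  refine ⟨?_, h2, h1⟩
  by_contra h
  rw [mem_P, not_lt] at h
  have h3 := (ρ.F_le_iff (-a)).2 h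
  rw [F_neg_F] at h3
  linarith

lemma P_local (hr : 2 ≤ r) {a : Fin d → ℤ} {x : ℝ} (ha : a ∈ ρ.P x) {y : ℝ}
    (hy : y ∈ Ioo (ρ.F (-a) x) (ρ.F a x)) : ρ.P y = ρ.P x := by
  have hxx : x ∈ Ioo (ρ.F (-a) x) (ρ.F a x) := by
    refine ⟨?_, ha⟩
    rw [← ρ.F_lt_iff a, F_F_neg]; exact ha
  have key : ∀ g, ∀ z ∈ Ioo (ρ.F (-a) x) (ρ.F a x), ρ.F g z = z →
      ∀ w ∈ Ioo (ρ.F (-a) x) (ρ.F a x), ρ.F g w = w := by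
    intro g z hz hgz w hw
    obtain ⟨h1, h2⟩ := ρ.P_local_aux hz
    have := ρ.kopell_two hr hgz h1 (Ioo_subset_Icc_self h2)
    exact ρ.kopell_two hr this ha (Ioo_subset_Icc_self hw)
  have key2 : ∀ g, ∀ z ∈ Ioo (ρ.F (-a) x) (ρ.F a x), z < ρ.F g z →
      ∀ w ∈ Ioo (ρ.F (-a) x) (ρ.F a x), w < ρ.F g w := by
    intro g z hz hgz w hw
    by_contra hlt
    have hc : ContinuousOn (fun t => ρ.F g t - t) (uIcc w z) :=
      ((ρ.F_cont g).sub continuous_id).continuousOn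
    have h0 : (0:ℝ) ∈ uIcc (ρ.F g w - w) (ρ.F g z - z) :=
      Icc_subset_uIcc ⟨by linarith, by linarith⟩
    obtain ⟨t, ht, ht0⟩ := intermediate_value_uIcc hc h0
    have htI : t ∈ Ioo (ρ.F (-a) x) (ρ.F a x) := ordConnected_Ioo.uIcc_subset hw hz ht
    have := key g t htI (by simpa [sub_eq_zero] using ht0) z hz
    linarith
  ext g
  exact ⟨fun h => key2 g y hy h x hxx, fun h => key2 g x hxx h y hy⟩

lemma P_eventually (hr : 2 ≤ r) {x : ℝ} (hx : x ∉ ρ.Fx) : ∀ᶠ y in 𝓝 x, ρ.P y = ρ.P x := by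
  obtain ⟨a, ha⟩ := ρ.exists_mem_P hx
  have : ρ.F (-a) x < x := by rw [← ρ.F_lt_iff a, F_F_neg]; exact ha
  filter_upwards [Ioo_mem_nhds this ha] with y hy
  exact ρ.P_local hr ha hy

lemma lim_mem_Fx (hr : 2 ≤ r) {x e : ℝ} {h : Fin d → ℤ} (hh : ρ.F h x ≠ x)
    (he : Tendsto (fun n : ℕ => ρ.F (n • h) x) atTop (𝓝 e)) : e ∈ ρ.Fx := by
  by_contra hne
  obtain ⟨n, hn⟩ := (he.eventually (ρ.P_eventually hr hne)).exists
  rw [P_orbit] at hn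
  have hee : ρ.F h e = e := by
    have h1 := ((ρ.F_cont h).tendsto e).comp he
    have h2 := (tendsto_add_atTop_iff_nat 1).2 he
    refine tendsto_nhds_unique h1 (h2.congr fun n => ?_)
    rw [F_nsmul_succ]; rfl
  rw [F_eq_iff, ← hn, ← F_eq_iff] at hee
  exact hh hee

lemma arch (hr : 2 ≤ r) {x : ℝ} {h a : Fin d → ℤ} (hh : h ∈ ρ.P x) :
    ∃ n : ℕ, (n • h - a) ∈ ρ.P x := by
  have hxI := Ioo_subset_Icc_self (ρ.mem_Ioo_of_not_Fx (ρ.not_Fx_of_mem_P hh))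
  obtain ⟨e, he, hlim, hae, hup, -⟩ := ρ.orbit_lim h hxI
  have hF := ρ.lim_mem_Fx hr (ne_of_gt hh) hlim
  have h1 : x < e := by
    have := hup (le_of_lt hh) 1
    rw [one_smul] at this
    exact lt_of_lt_of_le hh this
  have h2 : ρ.F a x < e := by
    have := (ρ.F_lt_iff a).2 h1
    rwa [hF a] at this
  obtain ⟨n, hn⟩ := (hlim.eventually (lt_mem_nhds h2)).exists
  refine ⟨n, ?_⟩
  rw [mem_P, ← ρ.F_lt_iff a, ← F_add]
  simpa using hn

lemma F_nsmul_bound (hr : 2 ≤ r) (h : Fin d → ℤ) (n : ℕ) : ∃ C : ℝ, 0 ≤ C ∧ ∀ y ∈ Icc (0:ℝ) 1,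
    |ρ.F (n • h) y - y| ≤ C * |ρ.F h y - y| := by
  induction n with
  | zero => exact ⟨0, le_rfl, fun y _ => by simp [F_zero]⟩
  | succ n ih =>
    obtain ⟨C, hC, ih⟩ := ih
    obtain ⟨C', hC', hl⟩ := ρ.F_lip hr (n • h)
    refine ⟨C' + C, by positivity, fun y hy => ?_⟩
    rw [F_nsmul_succ', add_mul]
    exact (abs_sub_le _ (ρ.F (n • h) y) _).trans (add_le_add (hl _ hy _ (ρ.F_mem h hy)) (ih y hy))

lemma comparable (hr : 2 ≤ r) {x : ℝ} {h a : Fin d → ℤ} (hh : h ∈ ρ.P x) (ha : a ∈ ρ.P x) :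
    ∃ C : ℝ, 0 ≤ C ∧ ∀ y ∈ Icc (0:ℝ) 1, ρ.P y = ρ.P x → |ρ.F a y - y| ≤ C * |ρ.F h y - y| := by
  obtain ⟨n, hn⟩ := ρ.arch hr (a := a) hh
  obtain ⟨C, hC, hb⟩ := ρ.F_nsmul_bound hr h n
  refine ⟨C, hC, fun y hy hP => (le_trans ?_ (hb y hy))⟩
  rw [← hP] at ha hn
  rw [mem_P] at ha
  rw [mem_P, ← ρ.F_lt_iff a, ← F_add] at hn
  simp only [add_sub_cancel] at hn
  rw [abs_of_pos (by linarith), abs_of_pos (by linarith)]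
  linarith

end ZdActionCr

namespace ZdActionCr

open Polynomial in
/-- Taylor polynomial in the variable `x - p`. -/
def Tay (n : ℕ) (u : ℝ → ℝ) (p : ℝ) : ℝ[X] :=
  ∑ k ∈ Finset.range (n + 1), Polynomial.C (iteratedDerivWithin k u (Icc (0:ℝ) 1) p / k.factorial) * Polynomial.X ^ k

lemma Tay_eval (n : ℕ) (u : ℝ → ℝ) (p x : ℝ) :
    (Tay n u p).eval (x - p) = taylorWithinEval u n (Icc (0:ℝ) 1) p x := by
  rw [taylor_within_apply, Tay, Polynomial.eval_finsetSum]
  refine Finset.sum_congr rfl fun k _ => ?_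
  simp
  ring

lemma Tay_coeff (n : ℕ) (u : ℝ → ℝ) (p : ℝ) (k : ℕ) : (Tay n u p).coeff k =
    if k ≤ n then iteratedDerivWithin k u (Icc (0:ℝ) 1) p / k.factorial else 0 := by
  simp only [Tay, Polynomial.finsetSum_coeff, Polynomial.coeff_C_mul, Polynomial.coeff_X_pow]
  simp [Finset.sum_ite_eq]

lemma Tay_deriv (n : ℕ) (u : ℝ → ℝ) (p : ℝ) :
    Polynomial.derivative (Tay (n + 1) u p) = Tay n (derivWithin u (Icc (0:ℝ) 1)) p := by
  ext k
  rw [Polynomial.coeff_derivative, Tay_coeff, Tay_coeff]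
  by_cases hk : k ≤ n
  · rw [if_pos (by omega), if_pos hk, iteratedDerivWithin_succ', Nat.factorial_succ]
    push_cast
    have : (k.factorial : ℝ) ≠ 0 := by exact_mod_cast k.factorial_ne_zero
    field_simp
  · rw [if_neg (by omega), if_neg hk, zero_mul]

lemma Tay_isLittleO {n : ℕ} {u : ℝ → ℝ} {p : ℝ} (hp : p ∈ Icc (0:ℝ) 1)
    (hu : ContDiffOn ℝ n u (Icc (0:ℝ) 1)) :
    (fun x => u x - (Tay n u p).eval (x - p)) =o[𝓝[Icc (0:ℝ) 1] p] fun x => (x - p) ^ n := by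
  simp only [Tay_eval]
  exact taylor_isLittleO (convex_Icc 0 1) hp hu

variable {d r : ℕ} (ρ : ZdActionCr d r)

/-- Taylor polynomial of `F h x - x`. -/
def Q (h : Fin d → ℤ) (p : ℝ) : Polynomial ℝ := Tay r (ρ.F h) p - Polynomial.C p - Polynomial.X

lemma Q_isLittleO (h : Fin d → ℤ) {p : ℝ} (hp : p ∈ Icc (0:ℝ) 1) :
    (fun x => ρ.F h x - x - (ρ.Q h p).eval (x - p)) =o[𝓝[Icc (0:ℝ) 1] p] fun x => (x - p) ^ r := by
  refine (Tay_isLittleO hp (ρ.F_contDiffOn h)).congr_left fun x => ?_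
  simp [Q]

lemma Q_coeff (h : Fin d → ℤ) {p : ℝ} (hp : p ∈ ρ.Fx) (k : ℕ) : (ρ.Q h p).coeff k =
    if 1 ≤ k ∧ k ≤ r then iteratedDerivWithin k (ρ.F h) (Icc (0:ℝ) 1) p / k.factorial -
      (if k = 1 then 1 else 0) else if k = 1 then -1 else 0 := by
  simp only [Q, Polynomial.coeff_sub, Tay_coeff, Polynomial.coeff_C, Polynomial.coeff_X]
  rcases k with _ | k
  · simp [hp h]
  · by_cases h1 : k + 1 ≤ r
    · simp [h1, eq_comm]
    · simp [h1, eq_comm]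
      split_ifs <;> simp

lemma parabolic_of_Q {p : ℝ} (hp : p ∈ ρ.Fx) (hQ : ∀ h, ρ.Q h p = 0) :
    IsRParabolicPt ρ p := by
  refine ⟨hp, fun a k hk1 hk => ?_⟩
  have h1 := ρ.Q_coeff a hp k
  rw [hQ a, if_pos ⟨hk1, hk⟩, Polynomial.coeff_zero] at h1
  have h2 : (k.factorial : ℝ) ≠ 0 := by exact_mod_cast k.factorial_ne_zero
  have h3 : iteratedDerivWithin k (ρ.F a) (Icc (0:ℝ) 1) p = (if k = 1 then 1 else 0) * k.factorial := by
    field_simp at h1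
    linarith
  change iteratedDerivWithin k (ρ.F a) (Icc (0:ℝ) 1) p = _
  rw [h3]
  split_ifs with h
  · simp [h]
  · simp

lemma Q_order (hr : 2 ≤ r) {h : Fin d → ℤ} {p : ℝ} (hp : p ∈ ρ.Fx) (hQ : ρ.Q h p ≠ 0) :
    1 ≤ (ρ.Q h p).natTrailingDegree ∧ (ρ.Q h p).natTrailingDegree ≤ r := by
  have hc : (ρ.Q h p).coeff (ρ.Q h p).natTrailingDegree ≠ 0 := by
    rw [← Polynomial.trailingCoeff]; exact Polynomial.trailingCoeff_nonzero_iff_nonzero.2 hQ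
  rw [Q_coeff _ _ hp] at hc
  by_contra h1
  rw [if_neg h1, if_neg (by omega)] at hc
  exact hc rfl

lemma poly_order (A : Polynomial ℝ) : ∃ B : Polynomial ℝ,
    A = Polynomial.X ^ A.natTrailingDegree * B ∧ B.eval 0 = A.trailingCoeff := by
  have h1 : Polynomial.X ^ A.natTrailingDegree ∣ A := by
    rw [Polynomial.X_pow_dvd_iff]
    exact fun k hk => Polynomial.coeff_eq_zero_of_lt_natTrailingDegree hk
  obtain ⟨B, hB⟩ := h1
  refine ⟨B, hB, ?_⟩
  rw [Polynomial.trailingCoeff]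
  generalize A.natTrailingDegree = k at hB
  rw [hB, Polynomial.coeff_X_pow_mul', if_pos le_rfl, Nat.sub_self, Polynomial.coeff_zero_eq_eval_zero]

/-- `u_h(p+σ s)/ s^k → q σ^k`. -/
lemma lead_tendsto {h : Fin d → ℤ} {p : ℝ} (hp : p ∈ Icc (0:ℝ) 1)
    {σ : ℝ} (hσI : ∀ᶠ s in 𝓝[>] (0:ℝ), p + σ * s ∈ Icc (0:ℝ) 1) :
    ((ρ.Q h p).natTrailingDegree ≤ r →
      Tendsto (fun s => (ρ.F h (p + σ * s) - (p + σ * s)) / s ^ (ρ.Q h p).natTrailingDegree) (𝓝[>] 0)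
      (𝓝 ((ρ.Q h p).trailingCoeff * σ ^ (ρ.Q h p).natTrailingDegree))) ∧
    (ρ.Q h p = 0 → Tendsto (fun s => (ρ.F h (p + σ * s) - (p + σ * s)) / s ^ r) (𝓝[>] 0) (𝓝 0)) := by
  have hl : Tendsto (fun s => p + σ * s) (𝓝[>] (0:ℝ)) (𝓝[Icc (0:ℝ) 1] p) := by
    refine tendsto_nhdsWithin_iff.2 ⟨?_, hσI⟩
    have : Tendsto (fun s : ℝ => p + σ * s) (𝓝 0) (𝓝 (p + σ * 0)) :=
      (Continuous.tendsto (by fun_prop) 0)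
    rw [mul_zero, add_zero] at this
    exact this.mono_left nhdsWithin_le_nhds
  have h1 := (ρ.Q_isLittleO h hp).comp_tendsto hl
  have h1 : (fun s => ρ.F h (p + σ * s) - (p + σ * s) - (ρ.Q h p).eval (σ * s)) =o[𝓝[>] (0:ℝ)]
      fun s => s ^ r := by
    refine (h1.congr (fun s => ?_) (fun s => ?_) : _ =o[_] fun s => σ ^ r * s ^ r).trans_isBigO ?_
    · simp [Function.comp]
    · simp [Function.comp, mul_pow]
    · exact (Asymptotics.isBigO_refl _ _).const_mul_left _
  have h2 : Tendsto (fun s => (ρ.F h (p + σ * s) - (p + σ * s) - (ρ.Q h p).eval (σ * s)) / s ^ r)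
      (𝓝[>] (0:ℝ)) (𝓝 0) := h1.tendsto_div_nhds_zero
  constructor
  · intro hk
    obtain ⟨B, hB, hB0⟩ := poly_order (ρ.Q h p)
    set k := (ρ.Q h p).natTrailingDegree with hkd
    have h3 : Tendsto (fun s : ℝ => s ^ (r - k)) (𝓝[>] (0:ℝ)) (𝓝 (0 ^ (r - k))) :=
      ((continuous_pow (r - k)).tendsto 0).mono_left nhdsWithin_le_nhds
    have h4 : Tendsto (fun s : ℝ => B.eval (σ * s) * σ ^ k) (𝓝[>] (0:ℝ)) (𝓝 (B.eval (σ * 0) * σ ^ k)) :=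
      (Continuous.tendsto (by fun_prop) 0).mono_left nhdsWithin_le_nhds
    have h5 := (h2.mul h3).add h4
    rw [zero_mul, zero_add, mul_zero, hB0] at h5
    refine h5.congr' ?_
    filter_upwards [self_mem_nhdsWithin] with s hs
    have hs : s ≠ 0 := ne_of_gt hs
    have e1 : (ρ.Q h p).eval (σ * s) = σ ^ k * s ^ k * B.eval (σ * s) := by
      rw [hB]; simp [mul_pow]
    have e2 : s ^ r = s ^ (r - k) * s ^ k := by rw [← pow_add, Nat.sub_add_cancel hk]
    rw [e1, e2]
    field_simp
    ring
  · intro hQ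
    simpa [hQ] using h2

lemma ratio_cmp {A B : ℝ → ℝ} {k m : ℕ} {c c' C : ℝ} (hc : c ≠ 0)
    (hA : Tendsto (fun s => A s / s ^ k) (𝓝[>] 0) (𝓝 c))
    (hB : Tendsto (fun s => B s / s ^ m) (𝓝[>] 0) (𝓝 c'))
    (hAB : ∀ᶠ s in 𝓝[>] (0:ℝ), |A s| ≤ C * |B s|) (hkm : k ≤ m) : k = m ∧ c' ≠ 0 := by
  have h3 : Tendsto (fun s : ℝ => s ^ (m - k)) (𝓝[>] (0:ℝ)) (𝓝 (0 ^ (m - k))) :=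
    ((continuous_pow (m - k)).tendsto 0).mono_left nhdsWithin_le_nhds
  have h4 : Tendsto (fun s => C * (|B s / s ^ m| * s ^ (m - k))) (𝓝[>] 0) (𝓝 (C * (|c'| * 0 ^ (m - k)))) :=
    (hB.abs.mul h3).const_mul C
  have h5 : |c| ≤ C * (|c'| * 0 ^ (m - k)) := by
    refine le_of_tendsto_of_tendsto hA.abs h4 ?_
    filter_upwards [hAB, self_mem_nhdsWithin] with s hs hs0
    have hs0 : 0 < s := hs0
    have e2 : s ^ m = s ^ (m - k) * s ^ k := by rw [← pow_add, Nat.sub_add_cancel hkm]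
    rw [e2, abs_div, abs_div, abs_mul, abs_of_pos (pow_pos hs0 k), abs_of_pos (pow_pos hs0 (m - k)),
      div_le_iff₀ (pow_pos hs0 k)]
    refine hs.trans (le_of_eq ?_)
    field_simp
  have h6 : 0 < |c| := abs_pos.2 hc
  constructor
  · by_contra hne
    rw [zero_pow (by omega)] at h5
    simp at h5
    exact hc h5
  · rintro rfl
    simp at h5
    exact hc h5

lemma neg_bound (hr : 2 ≤ r) (h : Fin d → ℤ) : ∃ C : ℝ, 0 ≤ C ∧ ∀ y ∈ Icc (0:ℝ) 1,
    |ρ.F (-h) y - y| ≤ C * |ρ.F h y - y| := by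
  obtain ⟨C, hC, hl⟩ := ρ.F_lip hr (-h)
  refine ⟨C, hC, fun y hy => ?_⟩
  have := hl _ (ρ.F_mem h hy) _ hy
  rwa [F_neg_F, abs_sub_comm y] at this

lemma comparable' (hr : 2 ≤ r) {x : ℝ} {h : Fin d → ℤ} (hh : ρ.F h x ≠ x) (a : Fin d → ℤ) :
    ∃ C : ℝ, 0 ≤ C ∧ ∀ y ∈ Icc (0:ℝ) 1, ρ.P y = ρ.P x → |ρ.F a y - y| ≤ C * |ρ.F h y - y| := by
  have key : ∀ h', h' ∈ ρ.P x → ∃ C : ℝ, 0 ≤ C ∧ ∀ y ∈ Icc (0:ℝ) 1, ρ.P y = ρ.P x →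
      |ρ.F a y - y| ≤ C * |ρ.F h' y - y| := by
    intro h' hh'
    by_cases ha : a ∈ ρ.P x
    · exact ρ.comparable hr hh' ha
    by_cases ha' : -a ∈ ρ.P x
    · obtain ⟨C, hC, hb⟩ := ρ.comparable hr hh' ha'
      obtain ⟨C', hC', hb'⟩ := ρ.neg_bound hr (-a)
      refine ⟨C' * C, by positivity, fun y hy hP => ?_⟩
      have h1 := hb' y hy
      rw [neg_neg] at h1
      refine h1.trans ?_
      rw [mul_assoc]
      exact mul_le_mul_of_nonneg_left (hb y hy hP) hC'
    · refine ⟨0, le_rfl, fun y hy hP => ?_⟩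
      rw [← hP] at ha ha'
      rw [ρ.F_eq_iff.2 ⟨ha, ha'⟩]
      simp
  rcases lt_or_gt_of_ne hh with h1 | h1
  · obtain ⟨C, hC, hb⟩ := key (-h) (ρ.neg_mem_P.2 h1)
    obtain ⟨C', hC', hb'⟩ := ρ.neg_bound hr h
    refine ⟨C * C', by positivity, fun y hy hP => (hb y hy hP).trans ?_⟩
    rw [mul_assoc]
    exact mul_le_mul_of_nonneg_left (hb' y hy) hC
  · exact key h h1

lemma Q_tc_ne {h : Fin d → ℤ} {p : ℝ} (hQ : ρ.Q h p ≠ 0) : (ρ.Q h p).trailingCoeff ≠ 0 :=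
  Polynomial.trailingCoeff_nonzero_iff_nonzero.2 hQ

/-- all elements moving points on a side of `p` are nonflat with the same order. -/
lemma nonflat_of_ne (hr : 2 ≤ r) {p : ℝ} (hp : p ∈ ρ.Fx) (hpI : p ∈ Icc (0:ℝ) 1)
    {h0 : Fin d → ℤ} (hQ : ρ.Q h0 p ≠ 0) {σ : ℝ} (hσ : σ ≠ 0)
    (hσI : ∀ᶠ s in 𝓝[>] (0:ℝ), p + σ * s ∈ Icc (0:ℝ) 1) {S : Set (Fin d → ℤ)}
    (hS : ∀ᶠ s in 𝓝[>] (0:ℝ), ρ.P (p + σ * s) = S) {h : Fin d → ℤ} (hh : h ∈ S ∨ -h ∈ S) :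
    ρ.Q h p ≠ 0 ∧ (ρ.Q h p).natTrailingDegree = (ρ.Q h0 p).natTrailingDegree := by
  obtain ⟨k01, k0r⟩ := ρ.Q_order hr hp hQ
  obtain ⟨s, hs, hsI⟩ := (hS.and hσI).exists
  have hx : ρ.F h (p + σ * s) ≠ p + σ * s := by
    rw [Ne, F_eq_iff, hs]; tauto
  have c0 := (ρ.lead_tendsto (h := h0) hpI hσI).1 k0r
  have n0 : (ρ.Q h0 p).trailingCoeff * σ ^ (ρ.Q h0 p).natTrailingDegree ≠ 0 :=
    mul_ne_zero (ρ.Q_tc_ne hQ) (pow_ne_zero _ hσ)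
  obtain ⟨C, hC, hb⟩ := ρ.comparable' hr hx h0
  have hcmp : ∀ᶠ s in 𝓝[>] (0:ℝ), |ρ.F h0 (p + σ * s) - (p + σ * s)| ≤
      C * |ρ.F h (p + σ * s) - (p + σ * s)| := by
    filter_upwards [hS, hσI] with s' h1 h2
    exact hb _ h2 (by rw [h1, hs])
  have hne : ρ.Q h p ≠ 0 := by
    intro h0'
    have c1 := (ρ.lead_tendsto (h := h) hpI hσI).2 h0'
    exact (ratio_cmp n0 c0 c1 hcmp k0r).2 rfl
  refine ⟨hne, ?_⟩
  obtain ⟨k1, kr⟩ := ρ.Q_order hr hp hne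
  have c1 := (ρ.lead_tendsto (h := h) hpI hσI).1 kr
  have n1 : (ρ.Q h p).trailingCoeff * σ ^ (ρ.Q h p).natTrailingDegree ≠ 0 :=
    mul_ne_zero (ρ.Q_tc_ne hne) (pow_ne_zero _ hσ)
  have hx0 : ρ.F h0 (p + σ * s) ≠ p + σ * s := by
    intro h0f
    have hz : ∀ᶠ s in 𝓝[>] (0:ℝ), (ρ.F h0 (p + σ * s) - (p + σ * s)) / s ^ (ρ.Q h0 p).natTrailingDegree = 0 := by
      filter_upwards [hS] with s' h1
      rw [F_eq_iff, hs, ← h1, ← F_eq_iff] at h0f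
      rw [h0f]; simp
    exact n0 (tendsto_nhds_unique c0 (tendsto_const_nhds.congr' (hz.mono fun _ h => h.symm)))
  obtain ⟨C', hC', hb'⟩ := ρ.comparable' hr hx0 h
  have hcmp' : ∀ᶠ s in 𝓝[>] (0:ℝ), |ρ.F h (p + σ * s) - (p + σ * s)| ≤
      C' * |ρ.F h0 (p + σ * s) - (p + σ * s)| := by
    filter_upwards [hS, hσI] with s' h1 h2
    exact hb' _ h2 (by rw [h1, hs])
  rcases le_total (ρ.Q h p).natTrailingDegree (ρ.Q h0 p).natTrailingDegree with hle | hle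
  · exact (ratio_cmp n1 c1 c0 hcmp' hle).1
  · exact (ratio_cmp n0 c0 c1 hcmp hle).1.symm

/-- sign near a nonflat point -/
lemma lead_sign {h : Fin d → ℤ} {p : ℝ} (hpI : p ∈ Icc (0:ℝ) 1) {σ : ℝ}
    (hσI : ∀ᶠ s in 𝓝[>] (0:ℝ), p + σ * s ∈ Icc (0:ℝ) 1)
    (hk : (ρ.Q h p).natTrailingDegree ≤ r)  :
    (0 < (ρ.Q h p).trailingCoeff * σ ^ (ρ.Q h p).natTrailingDegree →
      ∀ᶠ s in 𝓝[>] (0:ℝ), h ∈ ρ.P (p + σ * s)) ∧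
    ((ρ.Q h p).trailingCoeff * σ ^ (ρ.Q h p).natTrailingDegree < 0 →
      ∀ᶠ s in 𝓝[>] (0:ℝ), -h ∈ ρ.P (p + σ * s)) := by
  have c0 := (ρ.lead_tendsto (h := h) hpI hσI).1 hk
  constructor
  · intro hpos
    filter_upwards [c0.eventually (lt_mem_nhds hpos), self_mem_nhdsWithin] with s hs hs0
    have := (div_pos_iff_of_pos_right (pow_pos (show 0 < s from hs0) _)).1 hs
    rw [mem_P]; linarith
  · intro hneg
    filter_upwards [c0.eventually (gt_mem_nhds hneg), self_mem_nhdsWithin] with s hs hs0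
    rw [div_lt_iff₀ (pow_pos (show 0 < s from hs0) _), zero_mul] at hs
    rw [neg_mem_P]; linarith

lemma P_disj {x : ℝ} {h : Fin d → ℤ} (h1 : h ∈ ρ.P x) (h2 : -h ∈ ρ.P x) : False := by
  rw [neg_mem_P] at h2
  rw [mem_P] at h1
  linarith

lemma cross_aux (hr : 2 ≤ r) {p : ℝ} (hp : p ∈ ρ.Fx) (hpI : p ∈ Icc (0:ℝ) 1)
    {h0 : Fin d → ℤ} (hQ : ρ.Q h0 p ≠ 0) {σ : ℝ} (hσ : σ ≠ 0)
    (hσI : ∀ᶠ s in 𝓝[>] (0:ℝ), p + σ * s ∈ Icc (0:ℝ) 1)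
    (hσI' : ∀ᶠ s in 𝓝[>] (0:ℝ), p + (-σ) * s ∈ Icc (0:ℝ) 1) {S S' : Set (Fin d → ℤ)}
    (hS : ∀ᶠ s in 𝓝[>] (0:ℝ), ρ.P (p + σ * s) = S)
    (hS' : ∀ᶠ s in 𝓝[>] (0:ℝ), ρ.P (p + (-σ) * s) = S') :
    (∀ h ∈ S, h ∈ S') ∨ (∀ h ∈ S, -h ∈ S') := by
  have pos : ∀ h ∈ S, 0 < (ρ.Q h p).trailingCoeff * σ ^ (ρ.Q h0 p).natTrailingDegree := by
    intro h hh
    obtain ⟨h1, h2⟩ := ρ.nonflat_of_ne hr hp hpI hQ hσ hσI hS (Or.inl hh)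
    obtain ⟨k1, kr⟩ := ρ.Q_order hr hp h1
    rw [← h2]
    by_contra hn
    rcases eq_or_lt_of_le (not_lt.1 hn) with h3 | h3
    · exact mul_ne_zero (ρ.Q_tc_ne h1) (pow_ne_zero _ hσ) h3
    · obtain ⟨s, h4, h5⟩ := (((ρ.lead_sign hpI hσI kr).2 h3).and hS).exists
      rw [← h5] at hh
      exact ρ.P_disj hh h4
  rcases Nat.even_or_odd (ρ.Q h0 p).natTrailingDegree with he | ho
  · left
    intro h hh
    obtain ⟨h1, h2⟩ := ρ.nonflat_of_ne hr hp hpI hQ hσ hσI hS (Or.inl hh)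
    obtain ⟨k1, kr⟩ := ρ.Q_order hr hp h1
    have h3 := pos h hh
    rw [← he.neg_pow, ← h2] at h3
    obtain ⟨s, h4, h5⟩ := (((ρ.lead_sign hpI hσI' kr).1 h3).and hS').exists
    rwa [← h5]
  · right
    intro h hh
    obtain ⟨h1, h2⟩ := ρ.nonflat_of_ne hr hp hpI hQ hσ hσI hS (Or.inl hh)
    obtain ⟨k1, kr⟩ := ρ.Q_order hr hp h1
    have h3 := pos h hh
    rw [← neg_neg (σ ^ _), ← ho.neg_pow, ← h2, mul_neg, neg_pos] at h3
    obtain ⟨s, h4, h5⟩ := (((ρ.lead_sign hpI hσI' kr).2 h3).and hS').exists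
    rwa [← h5]

lemma P_const (hr : 2 ≤ r) {u v : ℝ} (h : ∀ x ∈ Ioo u v, x ∉ ρ.Fx) {x y : ℝ} (hx : x ∈ Ioo u v)
    (hy : y ∈ Ioo u v) : ρ.P y = ρ.P x := by
  refine isPreconnected_Ioo.induction₂ (fun x y => ρ.P y = ρ.P x) (fun x hx => ?_)
    (fun x y z _ _ _ h1 h2 => h2.trans h1) (fun x y _ _ h => h.symm) hx hy
  exact (ρ.P_eventually hr (h x hx)).filter_mono nhdsWithin_le_nhds

/-- nonflat points are isolated -/
lemma isolated (hr : 2 ≤ r) {p : ℝ} (hp : p ∈ ρ.Fx) (hpI : p ∈ Icc (0:ℝ) 1)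
    {h0 : Fin d → ℤ} (hQ : ρ.Q h0 p ≠ 0) {σ : ℝ} (hσ : σ ≠ 0)
    (hσI : ∀ᶠ s in 𝓝[>] (0:ℝ), p + σ * s ∈ Icc (0:ℝ) 1) :
    ∀ᶠ s in 𝓝[>] (0:ℝ), p + σ * s ∉ ρ.Fx := by
  obtain ⟨k01, k0r⟩ := ρ.Q_order hr hp hQ
  have n0 : (ρ.Q h0 p).trailingCoeff * σ ^ (ρ.Q h0 p).natTrailingDegree ≠ 0 :=
    mul_ne_zero (ρ.Q_tc_ne hQ) (pow_ne_zero _ hσ)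
  have := ρ.lead_sign hpI hσI k0r
  rcases lt_or_gt_of_ne n0 with h | h
  · exact (this.2 h).mono fun s hs => ρ.not_Fx_of_mem_P hs
  · exact (this.1 h).mono fun s hs => ρ.not_Fx_of_mem_P hs

lemma side_const (hr : 2 ≤ r) {p : ℝ} (hp : p ∈ ρ.Fx) (hpI : p ∈ Icc (0:ℝ) 1)
    {h0 : Fin d → ℤ} (hQ : ρ.Q h0 p ≠ 0) {σ : ℝ} (hσ : σ = 1 ∨ σ = -1)
    (hσI : ∀ᶠ s in 𝓝[>] (0:ℝ), p + σ * s ∈ Icc (0:ℝ) 1) :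
    ∃ S : Set (Fin d → ℤ), S.Nonempty ∧ ∀ᶠ s in 𝓝[>] (0:ℝ), ρ.P (p + σ * s) = S := by
  have hσ0 : σ ≠ 0 := by rcases hσ with h | h <;> simp [h]
  have h1 := ρ.isolated hr hp hpI hQ hσ0 hσI
  obtain ⟨δ, hδ, h2⟩ := mem_nhdsGT_iff_exists_Ioo_subset.1 h1
  have hδ : 0 < δ := hδ
  have hd : δ / 2 ∈ Ioo 0 δ := ⟨by linarith, by linarith⟩
  refine ⟨ρ.P (p + σ * (δ / 2)), ρ.exists_mem_P (h2 hd), ?_⟩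
  filter_upwards [Ioo_mem_nhdsGT hδ] with s hs
  rcases hσ with rfl | rfl
  · refine ρ.P_const hr (u := p) (v := p + δ) (fun x hx => ?_) ?_ ?_
    · have := h2 (show x - p ∈ Ioo 0 δ from ⟨by linarith [hx.1], by linarith [hx.2]⟩)
      simpa using this
    · constructor <;> linarith
    · constructor <;> linarith [hs.1, hs.2]
  · refine ρ.P_const hr (u := p - δ) (v := p) (fun x hx => ?_) ?_ ?_
    · have := h2 (show p - x ∈ Ioo 0 δ from ⟨by linarith [hx.2], by linarith [hx.1]⟩)
      simpa using this
    · constructor <;> linarith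
    · constructor <;> linarith [hs.1, hs.2]

/-- sign-equivalence -/
def E (x y : ℝ) : Prop := (∀ h, h ∈ ρ.P y ↔ h ∈ ρ.P x) ∨ (∀ h, h ∈ ρ.P y ↔ -h ∈ ρ.P x)

lemma E_trans {x y z : ℝ} (h1 : ρ.E x y) (h2 : ρ.E y z) : ρ.E x z := by
  rcases h1 with h1 | h1 <;> rcases h2 with h2 | h2
  · left; intro h; rw [h2, h1]
  · right; intro h; rw [h2, h1]
  · right; intro h; rw [h2, h1]
  · left; intro h; rw [h2, h1, neg_neg]

lemma E_symm {x y : ℝ} (h1 : ρ.E x y) : ρ.E y x := by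
  rcases h1 with h1 | h1
  · left; intro h; rw [h1]
  · right; intro h; rw [h1, neg_neg]

lemma E_of_eq {x y : ℝ} (h : ρ.P y = ρ.P x) : ρ.E x y := Or.inl fun _ => by rw [h]

lemma side_mem {p : ℝ} (hp : p ∈ Ioo (0:ℝ) 1) (σ : ℝ) : ∀ᶠ s in 𝓝[>] (0:ℝ), p + σ * s ∈ Icc (0:ℝ) 1 := by
  have : Tendsto (fun s : ℝ => p + σ * s) (𝓝 0) (𝓝 (p + σ * 0)) :=
    (Continuous.tendsto (by fun_prop) 0)
  rw [mul_zero, add_zero] at this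
  exact (this.mono_left nhdsWithin_le_nhds).eventually (Icc_mem_nhds hp.1 hp.2)

lemma E_near (hr : 2 ≤ r) (hnp : ∀ p ∈ Ioo (0:ℝ) 1, ¬ IsRParabolicPt ρ p) {p : ℝ}
    (hpI : p ∈ Ioo (0:ℝ) 1) : ∃ u v : ℝ, p ∈ Ioo u v ∧ ∀ x ∈ Ioo u v, ∀ y ∈ Ioo u v,
      x ≠ p → y ≠ p → (ρ.E x y ∧ x ∉ ρ.Fx) := by
  by_cases hp : p ∈ ρ.Fx
  · obtain ⟨h0, hQ⟩ : ∃ h0, ρ.Q h0 p ≠ 0 := by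
      by_contra hcon
      push Not at hcon
      exact hnp p hpI (ρ.parabolic_of_Q hp hcon)
    have hpI' := Ioo_subset_Icc_self hpI
    have i1 := side_mem hpI 1
    have i2 := side_mem hpI (-1)
    obtain ⟨S, ⟨hS, hhS⟩, hS1⟩ := ρ.side_const hr hp hpI' hQ (Or.inl rfl) i1
    obtain ⟨S', ⟨hS', hhS'⟩, hS1'⟩ := ρ.side_const hr hp hpI' hQ (Or.inr rfl) i2
    have c1 := ρ.cross_aux hr hp hpI' hQ one_ne_zero i1 i2 hS1 hS1'
    have c2 := ρ.cross_aux hr hp hpI' hQ (neg_ne_zero.2 one_ne_zero) i2 (by simpa using i1) hS1'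
      (by simpa using hS1)
    obtain ⟨δ, hδ, h2⟩ := mem_nhdsGT_iff_exists_Ioo_subset.1 (hS1.and hS1')
    have hδ : 0 < δ := hδ
    have hd : ∀ h, h ∈ S → -h ∈ S → False := by
      obtain ⟨s, hs⟩ := hS1.exists
      intro h; rw [← hs]; exact ρ.P_disj
    have hd' : ∀ h, h ∈ S' → -h ∈ S' → False := by
      obtain ⟨s, hs⟩ := hS1'.exists
      intro h; rw [← hs]; exact ρ.P_disj
    have hSS : (∀ h, h ∈ S' ↔ h ∈ S) ∨ (∀ h, h ∈ S' ↔ -h ∈ S) := by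
      rcases c1 with c1 | c1 <;> rcases c2 with c2 | c2
      · left; exact fun h => ⟨c2 h, c1 h⟩
      · exact (hd hS hhS (c2 _ (c1 _ hhS))).elim
      · exact (hd' hS' hhS' (c1 _ (c2 _ hhS'))).elim
      · right; exact fun h => ⟨c2 h, fun h' => by simpa using c1 _ h'⟩
    have hside : ∀ x ∈ Ioo (p - δ) (p + δ), x ≠ p → ρ.P x = S ∨ ρ.P x = S' := by
      intro x hx hne
      rcases lt_or_gt_of_ne hne with h | h
      · right
        have := (h2 (show p - x ∈ Ioo 0 δ from ⟨by linarith [hx.2], by linarith [hx.1]⟩)).2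
        simpa using this
      · left
        have := (h2 (show x - p ∈ Ioo 0 δ from ⟨by linarith, by linarith [hx.2]⟩)).1
        simpa using this
    refine ⟨p - δ, p + δ, ⟨by linarith, by linarith⟩, fun x hx y hy hxp hyp => ⟨?_, ?_⟩⟩
    · rcases hside x hx hxp with h3 | h3 <;> rcases hside y hy hyp with h4 | h4
      · exact ρ.E_of_eq (by rw [h3, h4])
      · simp only [E, h3, h4]; exact hSS
      · apply ρ.E_symm; simp only [E, h3, h4]; exact hSS
      · exact ρ.E_of_eq (by rw [h3, h4])
    · rcases hside x hx hxp with h3 | h3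
      · exact ρ.not_Fx_of_mem_P (h3 ▸ hhS)
      · exact ρ.not_Fx_of_mem_P (h3 ▸ hhS')
  · obtain ⟨u, v, hp', huv⟩ := mem_nhds_iff_exists_Ioo_subset.1 (ρ.P_eventually hr hp)
    obtain ⟨a, ha⟩ := ρ.exists_mem_P hp
    exact ⟨u, v, hp', fun x hx y hy _ _ => ⟨ρ.E_of_eq ((huv hy).trans (huv hx).symm),
      ρ.not_Fx_of_mem_P (a := a) (by rw [show ρ.P x = ρ.P p from huv hx]; exact ha)⟩⟩

lemma E_all (hr : 2 ≤ r) (hnp : ∀ p ∈ Ioo (0:ℝ) 1, ¬ IsRParabolicPt ρ p) {x y : ℝ}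
    (hx : x ∉ ρ.Fx) (hy : y ∉ ρ.Fx) : ρ.E x y := by
  have hR : ∀ᶠ x' in 𝓝[≠] x, ∀ᶠ y' in 𝓝[≠] y, ρ.E x' y' := by
    refine isPreconnected_Ioo.induction₂ (s := Ioo (0:ℝ) 1)
      (fun x y => ∀ᶠ x' in 𝓝[≠] x, ∀ᶠ y' in 𝓝[≠] y, ρ.E x' y' ∧ ρ.E y' x')
      (fun p hp => ?_) (fun x y z _ _ _ h1 h2 => ?_) (fun x y hx hy h => ?_)
      (ρ.mem_Ioo_of_not_Fx hx) (ρ.mem_Ioo_of_not_Fx hy) |>.mono fun _ h => h.mono fun _ h => h.1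
    · obtain ⟨u, v, hpuv, H⟩ := ρ.E_near hr hnp hp
      have hU : ∀ y ∈ Ioo u v, ∀ᶠ x' in 𝓝[≠] y, x' ∈ Ioo u v ∧ x' ≠ p := by
        intro y hy
        by_cases hyp : y = p
        · subst hyp
          filter_upwards [self_mem_nhdsWithin, nhdsWithin_le_nhds (Ioo_mem_nhds hy.1 hy.2)] with x' h1 h2
          exact ⟨h2, h1⟩
        · filter_upwards [nhdsWithin_le_nhds (Ioo_mem_nhds hy.1 hy.2),
            nhdsWithin_le_nhds (isOpen_ne.mem_nhds hyp)] with x' h1 h2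
          exact ⟨h1, h2⟩
      filter_upwards [nhdsWithin_le_nhds (Ioo_mem_nhds hpuv.1 hpuv.2)] with y hy
      filter_upwards [hU p hpuv] with x' hx'
      filter_upwards [hU y hy] with y' hy'
      have := (H x' hx'.1 y' hy'.1 hx'.2 hy'.2).1
      exact ⟨this, ρ.E_symm this⟩
    · filter_upwards [h1] with x' hx'
      obtain ⟨y', h3, h4⟩ := (hx'.and h2).exists
      filter_upwards [h4] with z' hz'
      exact ⟨ρ.E_trans h3.1 hz'.1, ρ.E_trans hz'.2 h3.2⟩
    · obtain ⟨u, v, huv, H⟩ := ρ.E_near hr hnp hx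
      obtain ⟨u', v', huv', H'⟩ := ρ.E_near hr hnp hy
      have e1 : ∀ᶠ x' in 𝓝[≠] x, x' ∈ Ioo u v ∧ x' ≠ x := by
        filter_upwards [self_mem_nhdsWithin, nhdsWithin_le_nhds (Ioo_mem_nhds huv.1 huv.2)] with x' h1 h2
        exact ⟨h2, h1⟩
      have e2 : ∀ᶠ x' in 𝓝[≠] y, x' ∈ Ioo u' v' ∧ x' ≠ y := by
        filter_upwards [self_mem_nhdsWithin, nhdsWithin_le_nhds (Ioo_mem_nhds huv'.1 huv'.2)] with x' h1 h2
        exact ⟨h2, h1⟩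
      obtain ⟨x0, hx0, hx0'⟩ := (h.and e1).exists
      obtain ⟨y0, hy0, hy0'⟩ := (hx0.and e2).exists
      filter_upwards [e2] with y' hy'
      filter_upwards [e1] with x' hx'
      have := ρ.E_trans ((H' _ hy'.1 _ hy0'.1 hy'.2 hy0'.2).1) (ρ.E_trans hy0.2
        (H _ hx0'.1 _ hx'.1 hx0'.2 hx'.2).1)
      exact ⟨this, ρ.E_symm this⟩
  have ex := (ρ.P_eventually hr hx).filter_mono (nhdsWithin_le_nhds (s := {x}ᶜ))
  have ey := (ρ.P_eventually hr hy).filter_mono (nhdsWithin_le_nhds (s := {y}ᶜ))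
  obtain ⟨x', h1, h2⟩ := (hR.and ex).exists
  obtain ⟨y', h3, h4⟩ := (h1.and ey).exists
  exact ρ.E_trans (ρ.E_of_eq h2) (ρ.E_trans h3 (ρ.E_of_eq h4.symm))

end ZdActionCr

namespace ZdActionCr

variable {d r : ℕ} (ρ : ZdActionCr d r)

/-- stabilizer -/
def stab (x : ℝ) : AddSubgroup (Fin d → ℤ) where
  carrier := {g | ρ.F g x = x}
  add_mem' := fun {a b} ha hb => by
    change ρ.F (a + b) x = x
    rw [F_add, show ρ.F b x = x from hb]; exact ha
  zero_mem' := ρ.F_zero x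
  neg_mem' := fun {a} ha => by
    change ρ.F (-a) x = x
    have ha : ρ.F a x = x := ha
    conv_lhs => rw [← ha]
    exact ρ.F_neg_F a x

lemma mem_stab {x : ℝ} {g : Fin d → ℤ} : g ∈ ρ.stab x ↔ ρ.F g x = x := Iff.rfl

/-- orbit map -/
def orb (x : ℝ) : ((Fin d → ℤ) ⧸ ρ.stab x) → ℝ :=
  Quotient.lift (fun g => ρ.F g x) fun a b hab => by
    have hab := QuotientAddGroup.leftRel_apply.1 hab
    rw [mem_stab, F_add] at hab
    have := congrArg (ρ.F a) hab
    rw [F_F_neg] at this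
    exact this.symm

lemma orb_mk (x : ℝ) (g : Fin d → ℤ) : ρ.orb x (QuotientAddGroup.mk g) = ρ.F g x := rfl

lemma orb_inj (x : ℝ) : Function.Injective (ρ.orb x) := by
  intro a b
  induction a using QuotientAddGroup.induction_on with | _ a => ?_
  induction b using QuotientAddGroup.induction_on with | _ b => ?_
  intro h
  rw [orb_mk, orb_mk] at h
  rw [QuotientAddGroup.eq, mem_stab, F_add, ← h, F_neg_F]

lemma holder_aux (hr : 2 ≤ r) (x : ℝ) : ∃ τ : (Fin d → ℤ) →+ ℝ, ∀ g, g ∈ ρ.P x ↔ 0 < τ g := by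
  let M := (Fin d → ℤ) ⧸ ρ.stab x
  let _ : LinearOrder M := LinearOrder.lift' (ρ.orb x) (ρ.orb_inj x)
  have hle : ∀ a b : M, a ≤ b ↔ ρ.orb x a ≤ ρ.orb x b := fun a b => Iff.rfl
  have hlt : ∀ a b : M, a < b ↔ ρ.orb x a < ρ.orb x b := fun a b => Iff.rfl
  have : IsOrderedAddMonoid M := by
    refine { add_le_add_left := ?_ }
    intro a b hab c
    induction a using QuotientAddGroup.induction_on with | _ a => ?_
    induction b using QuotientAddGroup.induction_on with | _ b => ?_
    induction c using QuotientAddGroup.induction_on with | _ c => ?_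
    rw [hle, orb_mk, orb_mk] at hab
    rw [hle, ← QuotientAddGroup.mk_add, ← QuotientAddGroup.mk_add, orb_mk, orb_mk, add_comm a, add_comm b,
      F_add, F_add, F_le_iff]
    exact hab
  have hpos : ∀ g : Fin d → ℤ, (0 : M) < QuotientAddGroup.mk g ↔ g ∈ ρ.P x := by
    intro g
    rw [hlt, ← QuotientAddGroup.mk_zero, orb_mk, orb_mk, F_zero]; rfl
  have : Archimedean M := by
    constructor
    intro a b hb
    induction a using QuotientAddGroup.induction_on with | _ a => ?_
    induction b using QuotientAddGroup.induction_on with | _ b => ?_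
    obtain ⟨n, hn⟩ := ρ.arch hr (a := a) ((hpos b).1 hb)
    refine ⟨n, ?_⟩
    have := (hpos _).2 hn
    rw [QuotientAddGroup.mk_sub, sub_pos] at this
    exact this.le
  obtain ⟨f, hf⟩ := Archimedean.exists_orderAddMonoidHom_real_injective M
  refine ⟨(f : M →+ ℝ).comp (QuotientAddGroup.mk' _), fun g => ?_⟩
  have hmono : StrictMono f := f.monotone'.strictMono_of_injective hf
  rw [← hpos]
  have := hmono.lt_iff_lt (a := (0:M)) (b := QuotientAddGroup.mk g)
  rw [map_zero] at this
  exact this.symm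

/-- The translation-number data. -/
structure Hol (τ : (Fin d → ℤ) →+ ℝ) (a0 : Fin d → ℤ) : Prop where
  one : τ a0 = 1
  dense : DenseRange τ
  sgn : ∀ x, x ∉ ρ.Fx → (∀ g, g ∈ ρ.P x ↔ 0 < τ g) ∨ (∀ g, g ∈ ρ.P x ↔ τ g < 0)
  iso : ∀ p ∈ Ioo (0:ℝ) 1, ∀ᶠ x in 𝓝[≠] p, x ∉ ρ.Fx
  nonflat : ∀ p ∈ Icc (0:ℝ) 1, p ∈ ρ.Fx → ¬ IsRParabolicPt ρ p → ∃ h, ρ.Q h p ≠ 0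
  r2 : 2 ≤ r
  np : ∀ p ∈ Ioo (0:ℝ) 1, ¬ IsRParabolicPt ρ p

lemma holder (hr : 2 ≤ r)
    (hnc : ¬ ∃ c : Fin d → ℤ, ∀ a : Fin d → ℤ, ∃ n : ℤ, ∀ x : ℝ,
      (ρ.elt a).toFun x = (ρ.elt (n • c)).toFun x)
    (hnp : ∀ p ∈ Ioo (0:ℝ) 1, ¬ IsRParabolicPt ρ p) :
    ∃ τ : (Fin d → ℤ) →+ ℝ, ∃ a0, ρ.Hol τ a0 := by
  obtain ⟨x0, hx0⟩ : ∃ x0, x0 ∉ ρ.Fx := by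
    by_contra hcon
    push Not at hcon
    exact hnc ⟨0, fun a => ⟨0, fun x => ((hcon x a).trans (hcon x _).symm : ρ.F a x = ρ.F _ x)⟩⟩
  obtain ⟨τ, hτ⟩ := ρ.holder_aux hr x0
  have hsg : ∀ x, x ∉ ρ.Fx → (∀ g, g ∈ ρ.P x ↔ 0 < τ g) ∨ (∀ g, g ∈ ρ.P x ↔ τ g < 0) := by
    intro x hx
    rcases ρ.E_all hr hnp hx0 hx with h | h
    · left; intro g; rw [h, hτ]
    · right; intro g; rw [h, hτ, map_neg, neg_pos]
  have hker : ∀ g, τ g = 0 → ∀ x, ρ.F g x = x := by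
    intro g hg x
    by_cases hx : x ∈ ρ.Fx
    · exact hx g
    · rw [F_eq_iff]
      rcases hsg x hx with h | h <;> rw [h, h, map_neg, hg] <;> simp
  have hd : DenseRange τ := by
    rcases AddSubgroup.dense_or_cyclic τ.range with h | ⟨c', hc'⟩
    · simpa [DenseRange] using h
    · exfalso
      have : c' ∈ τ.range := by rw [hc']; exact AddSubgroup.subset_closure rfl
      obtain ⟨c, rfl⟩ := this
      refine hnc ⟨c, fun a => ?_⟩
      have : τ a ∈ τ.range := ⟨a, rfl⟩
      rw [hc', AddSubgroup.mem_closure_singleton] at this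
      obtain ⟨n, hn⟩ := this
      refine ⟨n, fun x => ?_⟩
      have := hker (-(n • c) + a) (by rw [map_add, map_neg, map_zsmul, hn]; simp) x
      rw [F_add] at this
      have := congrArg (ρ.F (n • c)) this
      rw [F_F_neg] at this
      exact this
  obtain ⟨b, hb⟩ : ∃ b, τ b ≠ 0 := by
    obtain ⟨a, ha⟩ := ρ.exists_mem_P hx0
    exact ⟨a, ne_of_gt ((hτ a).1 ha)⟩
  refine ⟨(AddMonoidHom.mulLeft (τ b)⁻¹).comp τ, b, ?_, ?_, ?_, ?_, ?_, hr, hnp⟩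
  · simp [hb]
  · have hs : Function.Surjective (fun x : ℝ => (τ b)⁻¹ * x) := fun y => ⟨τ b * y, by simp [hb]⟩
    exact hs.denseRange.comp hd (by fun_prop)
  · intro x hx
    rcases lt_or_gt_of_ne hb with hb' | hb'
    · have e : ∀ g, (0 < (τ b)⁻¹ * τ g ↔ τ g < 0) ∧ ((τ b)⁻¹ * τ g < 0 ↔ 0 < τ g) := by
        intro g
        have := inv_neg''.2 hb'
        exact ⟨⟨fun h => by nlinarith, fun h => mul_pos_of_neg_of_neg this h⟩,
          ⟨fun h => by nlinarith, fun h => mul_neg_of_neg_of_pos this h⟩⟩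
      rcases hsg x hx with h | h
      · right; intro g; rw [h]; exact (e g).2.symm
      · left; intro g; rw [h]; exact (e g).1.symm
    · have e : ∀ g, (0 < (τ b)⁻¹ * τ g ↔ 0 < τ g) ∧ ((τ b)⁻¹ * τ g < 0 ↔ τ g < 0) := by
        intro g
        have := inv_pos.2 hb'
        exact ⟨by rw [mul_pos_iff_of_pos_left this], ⟨fun h => by nlinarith, fun h => mul_neg_of_pos_of_neg this h⟩⟩
      rcases hsg x hx with h | h
      · left; intro g; rw [h]; exact (e g).1.symm
      · right; intro g; rw [h]; exact (e g).2.symm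
  · intro p hp
    obtain ⟨u, v, huv, H⟩ := ρ.E_near hr hnp hp
    filter_upwards [self_mem_nhdsWithin, nhdsWithin_le_nhds (Ioo_mem_nhds huv.1 huv.2)] with x h1 h2
    exact (H x h2 x h2 h1 h1).2
  · intro p _ hp hpar
    by_contra hcon
    push Not at hcon
    exact hpar (ρ.parabolic_of_Q hp hcon)

end ZdActionCr

namespace ZdActionCr

variable {d r : ℕ} {ρ : ZdActionCr d r} {τ : (Fin d → ℤ) →+ ℝ} {a0 : Fin d → ℤ}

namespace Hol

lemma ord (H : ρ.Hol τ a0) {x : ℝ} (hx : x ∉ ρ.Fx) {b : Fin d → ℤ} (hb : τ b = 1 ∨ τ b = -1) :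
    (x < ρ.F b x ∧ ∀ g h, τ g * τ b ≤ τ h * τ b → ρ.F g x ≤ ρ.F h x) ∨
    (ρ.F b x < x ∧ ∀ g h, τ g * τ b ≤ τ h * τ b → ρ.F h x ≤ ρ.F g x) := by
  have key : ∀ g h, ¬ ρ.F g x ≤ ρ.F h x → g - h ∈ ρ.P x := by
    intro g h hgh
    rw [mem_P, ← ρ.F_lt_iff h, ← F_add]
    simpa using hgh
  rcases H.sgn x hx with h | h <;> rcases hb with hb | hb
  · left
    refine ⟨(h b).2 (by rw [hb]; norm_num), fun g h' hle => ?_⟩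
    by_contra hcon
    have := (h _).1 (key _ _ hcon)
    rw [map_sub] at this
    rw [hb] at hle
    linarith
  · right
    refine ⟨ρ.neg_mem_P.1 ((h _).2 (by rw [map_neg, hb]; norm_num)), fun g h' hle => ?_⟩
    by_contra hcon
    have := (h _).1 (key _ _ hcon)
    rw [map_sub] at this
    rw [hb] at hle
    linarith
  · right
    refine ⟨ρ.neg_mem_P.1 ((h _).2 (by rw [map_neg, hb]; norm_num)), fun g h' hle => ?_⟩
    by_contra hcon
    have := (h _).1 (key _ _ hcon)
    rw [map_sub] at this
    rw [hb] at hle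
    linarith
  · left
    refine ⟨(h b).2 (by rw [hb]; norm_num), fun g h' hle => ?_⟩
    by_contra hcon
    have := (h _).1 (key _ _ hcon)
    rw [map_sub] at this
    rw [hb] at hle
    linarith

lemma l_mono (H : ρ.Hol τ a0) {x : ℝ} (hx : x ∉ ρ.Fx) {b : Fin d → ℤ} (hb : τ b = 1 ∨ τ b = -1)
    {e : ℝ} (he : Tendsto (fun n : ℕ => ρ.F (n • b) x) atTop (𝓝 e)) {g h : Fin d → ℤ}
    (hgh : τ g * τ b ≤ τ h * τ b) : ρ.l h e ≤ ρ.l g e := by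
  have hxI := ρ.mem_Ioo_of_not_Fx hx
  have hxI' := Ioo_subset_Icc_self hxI
  obtain ⟨e', he'I, he', -, hup, hdn⟩ := ρ.orbit_lim b hxI'
  obtain rfl := tendsto_nhds_unique he he'
  have hne : ρ.F b x ≠ x := by
    rcases H.ord hx hb with h | h
    · exact h.1.ne'
    · exact h.1.ne
  have hF := ρ.lim_mem_Fx H.r2 hne he
  have hxe : x ≠ e := by rintro rfl; exact hx hF
  refine ρ.l_le_of_seq H.r2 he'I (hF h) (hF g) (fun n => ρ.F_mem (n • b) hxI') (fun n => ?_) he (fun n => ?_)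
  · rw [← hF (n • b), Ne, F_inj]; exact hxe
  · rw [F_comm, F_comm ρ g]
    rcases H.ord hx hb with h1 | h1
    · have h2 : x < e := lt_of_le_of_ne (by simpa [F_zero] using hup h1.1.le 0) hxe
      have h3 := (ρ.F_lt_iff (n • b)).2 ((ρ.F_lt_iff h).2 h2)
      have h4 := (ρ.F_le_iff (n • b)).2 (h1.2 g h hgh)
      rw [hF h, hF] at h3
      rw [abs_of_neg (by linarith), abs_of_neg (by linarith)]
      linarith
    · have h2 : e < x := lt_of_le_of_ne (by simpa [F_zero] using hdn h1.1.le 0) hxe.symm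
      have h3 := (ρ.F_lt_iff (n • b)).2 ((ρ.F_lt_iff h).2 h2)
      have h4 := (ρ.F_le_iff (n • b)).2 (h1.2 g h hgh)
      rw [hF h, hF] at h3
      rw [abs_of_pos (by linarith), abs_of_pos (by linarith)]
      linarith

lemma l_neg (hr : 2 ≤ r) {e : ℝ} (he : e ∈ Icc (0:ℝ) 1) {b : Fin d → ℤ} (hF : ρ.F b e = e) :
    ρ.l (-b) e = - ρ.l b e := by
  have := ρ.l_add hr (-b) b he
  rw [hF, neg_add_cancel, ρ.l_zero hr he] at this
  linarith

lemma l_e_bound (H : ρ.Hol τ a0) {x : ℝ} (hx : x ∉ ρ.Fx) {b : Fin d → ℤ} (hb : τ b = 1 ∨ τ b = -1)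
    {e : ℝ} (he : Tendsto (fun n : ℕ => ρ.F (n • b) x) atTop (𝓝 e)) {g : Fin d → ℤ}
    (hg : |τ g| ≤ 1) : |ρ.l g e| ≤ |ρ.l b e| := by
  have hxI' := Ioo_subset_Icc_self (ρ.mem_Ioo_of_not_Fx hx)
  obtain ⟨e', he'I, he', hbe, -⟩ := ρ.orbit_lim b hxI'
  obtain rfl := tendsto_nhds_unique he he'
  rw [abs_le] at hg
  have h1 : ρ.l b e ≤ ρ.l g e := H.l_mono hx hb he (by rcases hb with h | h <;> rw [h] <;> linarith)
  have h2 : ρ.l g e ≤ ρ.l (-b) e := H.l_mono hx hb he (by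
    rw [map_neg]; rcases hb with h | h <;> rw [h] <;> linarith)
  rw [l_neg H.r2 he'I hbe] at h2
  rw [abs_le]
  have := neg_abs_le (ρ.l b e)
  have := le_abs_self (ρ.l b e)
  have := neg_le_abs (ρ.l b e)
  constructor <;> linarith

lemma l_dist (H : ρ.Hol τ a0) {x : ℝ} (hx : x ∉ ρ.Fx) {b : Fin d → ℤ} (hb : τ b = 1 ∨ τ b = -1)
    {M : ℝ} (hM0 : 0 ≤ M)
    (hM : ∀ x ∈ Icc (0:ℝ) 1, ∀ y ∈ Icc (0:ℝ) 1, |ρ.l b x - ρ.l b y| ≤ M * |x - y|)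
    {e : ℝ} (he : Tendsto (fun n : ℕ => ρ.F (n • b) x) atTop (𝓝 e)) {g : Fin d → ℤ}
    (hg : |τ g| ≤ 1) : |ρ.l g x - ρ.l g e| ≤ M * |ρ.F (-b) x - e| := by
  have hxI' := Ioo_subset_Icc_self (ρ.mem_Ioo_of_not_Fx hx)
  obtain ⟨e', he'I, he', hbe, hup, hdn⟩ := ρ.orbit_lim b hxI'
  obtain rfl := tendsto_nhds_unique he he'
  rw [abs_le] at hg
  have hbb : τ b * τ b = 1 := by rcases hb with h | h <;> rw [h] <;> norm_num
  have hle : τ g * τ b ≤ τ b * τ b := by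
    rw [hbb]; rcases hb with h | h <;> rw [h] <;> linarith
  have hge : τ (-b) * τ b ≤ τ g * τ b := by
    rw [map_neg, neg_mul, hbb]; rcases hb with h | h <;> rw [h] <;> linarith
  have h0 : τ (0 : Fin d → ℤ) * τ b = 0 := by simp
  have hb0 : τ (-b) * τ b ≤ τ (0 : Fin d → ℤ) * τ b := by
    rw [h0, map_neg, neg_mul, hbb]; norm_num
  have hw0 : Tendsto (fun n : ℕ => ρ.F (n • b) (ρ.F (-b) x)) atTop (𝓝 e) := by
    refine (tendsto_add_atTop_iff_nat 1).1 (he.congr fun n => ?_)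
    rw [F_nsmul_succ', F_F_neg]
  by_cases hsg : 0 ≤ τ g * τ b
  · have hy : x ∈ uIcc x (ρ.F b x) := left_mem_uIcc
    have hgy : ρ.F g x ∈ uIcc x (ρ.F b x) := by
      rcases H.ord hx hb with h1 | h1
      · exact Icc_subset_uIcc ⟨by simpa [F_zero] using h1.2 0 g (by rw [h0]; exact hsg), h1.2 g b hle⟩
      · exact Icc_subset_uIcc' ⟨h1.2 g b hle, by simpa [F_zero] using h1.2 0 g (by rw [h0]; exact hsg)⟩
    refine (ρ.dist_lim H.r2 hM0 hM hxI' hy hgy he).trans (mul_le_mul_of_nonneg_left ?_ hM0)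
    rcases H.ord hx hb with h1 | h1
    · have h2 := h1.2 (-b) 0 hb0
      have h3 := hup h1.1.le 0
      rw [zero_smul] at h3
      simp only [F_zero] at h2 h3
      rw [abs_of_nonpos (by linarith), abs_of_nonpos (by linarith)]; linarith
    · have h2 := h1.2 (-b) 0 hb0
      have h3 := hdn h1.1.le 0
      rw [zero_smul] at h3
      simp only [F_zero] at h2 h3
      rw [abs_of_nonneg (by linarith), abs_of_nonneg (by linarith)]; linarith
  · have hsg : τ g * τ b ≤ 0 := by linarith
    have hy : x ∈ uIcc (ρ.F (-b) x) (ρ.F b (ρ.F (-b) x)) := by rw [F_F_neg]; exact right_mem_uIcc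
    have hgy : ρ.F g x ∈ uIcc (ρ.F (-b) x) (ρ.F b (ρ.F (-b) x)) := by
      rw [F_F_neg]
      rcases H.ord hx hb with h1 | h1
      · exact Icc_subset_uIcc ⟨h1.2 _ g hge, by simpa [F_zero] using h1.2 g 0 (by rw [h0]; exact hsg)⟩
      · exact Icc_subset_uIcc' ⟨by simpa [F_zero] using h1.2 g 0 (by rw [h0]; exact hsg), h1.2 _ g hge⟩
    exact ρ.dist_lim H.r2 hM0 hM (ρ.F_mem _ hxI') hy hgy hw0

lemma dense_nFx (H : ρ.Hol τ a0) : Icc (0:ℝ) 1 ⊆ closure (ρ.Fxᶜ) := by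
  rw [← closure_Ioo zero_ne_one]
  refine closure_minimal (fun p hp => ?_) isClosed_closure
  have := (H.iso p hp).frequently
  rw [mem_closure_iff_frequently]
  exact this.filter_mono nhdsWithin_le_nhds

lemma l_bound (H : ρ.Hol τ a0) : ∃ K : ℝ, 0 ≤ K ∧ ∀ g, |τ g| ≤ 1 → ∀ x ∈ Icc (0:ℝ) 1, |ρ.l g x| ≤ K := by
  obtain ⟨M, hM0, hM⟩ := ρ.l_lip H.r2 a0
  obtain ⟨N, hN0, hN⟩ := ρ.l_bdd H.r2 a0
  refine ⟨N + M, by positivity, fun g hg => ?_⟩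
  have hcl : IsClosed (Icc (0:ℝ) 1 ∩ (fun x => |ρ.l g x|) ⁻¹' Iic (N + M)) :=
    (ρ.l_continuousOn H.r2 g).abs.preimage_isClosed_of_isClosed isClosed_Icc isClosed_Iic
  have hsub : ρ.Fxᶜ ⊆ Icc (0:ℝ) 1 ∩ (fun x => |ρ.l g x|) ⁻¹' Iic (N + M) := by
    intro x hx
    have hxI' := Ioo_subset_Icc_self (ρ.mem_Ioo_of_not_Fx hx)
    refine ⟨hxI', ?_⟩
    obtain ⟨e, heI, he, -⟩ := ρ.orbit_lim a0 hxI'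
    have h1 := H.l_e_bound hx (Or.inl H.one) he hg
    have h2 := H.l_dist hx (Or.inl H.one) hM0 hM he hg
    have h3 : |ρ.F (-a0) x - e| ≤ 1 := by
      have := ρ.F_mem (-a0) hxI'
      rw [abs_le]; constructor <;> linarith [this.1, this.2, heI.1, heI.2]
    have h4 := hN e heI
    have h5 : M * |ρ.F (-a0) x - e| ≤ M := mul_le_of_le_one_right hM0 h3
    have h6 : |ρ.l g x| ≤ |ρ.l g x - ρ.l g e| + |ρ.l g e| := by
      have := abs_add_le (ρ.l g x - ρ.l g e) (ρ.l g e)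
      simpa using this
    change |ρ.l g x| ≤ N + M
    linarith
  exact fun x hx => ((closure_minimal hsub hcl) (H.dense_nFx hx)).2

lemma tau_nsmul (n : ℕ) (g : Fin d → ℤ) : |τ (n • g)| = n * |τ g| := by
  rw [map_nsmul, nsmul_eq_mul, abs_mul, Nat.abs_cast]

lemma u_bound {K : ℝ} (H : ρ.Hol τ a0)
    (hK : ∀ g, |τ g| ≤ 1 → ∀ x ∈ Icc (0:ℝ) 1, |ρ.l g x| ≤ K) (n : ℕ) {g : Fin d → ℤ}
    (hg : n * |τ g| ≤ 1) {x : ℝ} (hx : x ∈ Icc (0:ℝ) 1) : n * Real.exp (-K) * |ρ.F g x - x| ≤ 1 := by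
  refine ρ.count H.r2 hx n fun i hi z hz => hK _ ?_ z (uIcc_sub hx (ρ.F_mem g hx) hz)
  rw [tau_nsmul]
  refine le_trans ?_ hg
  have : (i:ℝ) ≤ n := by exact_mod_cast hi.le
  gcongr

lemma l_Fx_nsmul (hr : 2 ≤ r) {e : ℝ} (he : e ∈ Icc (0:ℝ) 1) (hF : e ∈ ρ.Fx) (n : ℕ) (g : Fin d → ℤ) :
    ρ.l (n • g) e = n * ρ.l g e := by
  induction n with
  | zero => simp [ρ.l_zero hr he]
  | succ n ih =>
    rw [succ_nsmul, ρ.l_add hr _ _ he, hF g, ih]; push_cast; ring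

lemma u_small (H : ρ.Hol τ a0) {ε : ℝ} (hε : 0 < ε) : ∃ η > 0, ∀ g, |τ g| < η → ∀ x ∈ Icc (0:ℝ) 1,
    |ρ.F g x - x| ≤ ε := by
  obtain ⟨K, hK0, hK⟩ := H.l_bound
  obtain ⟨n, hn⟩ := exists_nat_gt (1 / (Real.exp (-K) * ε))
  have hp : 0 < Real.exp (-K) * ε := by positivity
  have hn0 : (0:ℝ) < n := lt_trans (by positivity) hn
  refine ⟨1 / n, by positivity, fun g hg x hx => ?_⟩
  rw [lt_div_iff₀ hn0, mul_comm] at hg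
  have h1 := H.u_bound hK n hg.le hx
  rw [div_lt_iff₀ hp] at hn
  by_contra hcon
  push Not at hcon
  have : n * Real.exp (-K) * ε < n * Real.exp (-K) * |ρ.F g x - x| := by
    have := Real.exp_pos (-K)
    gcongr
  nlinarith

lemma key_Fx (H : ρ.Hol τ a0) {ε : ℝ} (hε : 0 < ε) {p : ℝ} (hp : p ∈ ρ.Fx) :
    ∃ η > 0, ∀ᶠ x in 𝓝 p, x ∈ Icc (0:ℝ) 1 → ∀ g, |τ g| < η → |ρ.l g x| ≤ ε := by
  obtain ⟨K, hK0, hK⟩ := H.l_bound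
  obtain ⟨M, hM0, hM⟩ := ρ.l_lip H.r2 a0
  obtain ⟨M', hM0', hM'⟩ := ρ.l_lip H.r2 (-a0)
  obtain ⟨n, hn⟩ := exists_nat_gt (2 * K / ε)
  have hn0 : (0:ℝ) < n := lt_of_le_of_lt (by positivity) hn
  have hn1 : (1:ℝ) ≤ n := by exact_mod_cast (by exact_mod_cast hn0 : 0 < n)
  have hFx : ∀ e ∈ Icc (0:ℝ) 1, e ∈ ρ.Fx → ∀ g, |τ g| < 1 / n → |ρ.l g e| ≤ ε / 2 := by
    intro e heI he g hg
    rw [lt_div_iff₀ hn0, mul_comm] at hg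
    have h1 := hK (n • g) (by rw [tau_nsmul]; exact hg.le) e heI
    rw [l_Fx_nsmul H.r2 heI he, abs_mul, Nat.abs_cast] at h1
    rw [div_lt_iff₀ hε] at hn
    by_contra hcon
    push Not at hcon
    nlinarith
  refine ⟨1 / n, by positivity, ?_⟩
  have c1 : ∀ᶠ x in 𝓝 p, M * |ρ.F (-a0) x - p| < ε / 2 := by
    have : Tendsto (fun x => M * |ρ.F (-a0) x - p|) (𝓝 p) (𝓝 (M * |ρ.F (-a0) p - p|)) :=
      (((ρ.F_cont (-a0)).sub continuous_const).abs.const_mul M).tendsto p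
    rw [hp, sub_self, abs_zero, mul_zero] at this
    exact this.eventually (gt_mem_nhds (by positivity))
  have c2 : ∀ᶠ x in 𝓝 p, M' * |ρ.F (-(-a0)) x - p| < ε / 2 := by
    have : Tendsto (fun x => M' * |ρ.F (-(-a0)) x - p|) (𝓝 p) (𝓝 (M' * |ρ.F (-(-a0)) p - p|)) :=
      (((ρ.F_cont (-(-a0))).sub continuous_const).abs.const_mul M').tendsto p
    rw [hp, sub_self, abs_zero, mul_zero] at this
    exact this.eventually (gt_mem_nhds (by positivity))
  filter_upwards [c1, c2] with x hx1 hx2 hxI g hg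
  by_cases hx : x ∈ ρ.Fx
  · exact (hFx x hxI hx g hg).trans (by linarith)
  have hgg : |τ g| ≤ 1 := hg.le.trans (by rw [div_le_one hn0]; exact hn1)
  have fin : ∀ b, (τ b = 1 ∨ τ b = -1) → ∀ M, 0 ≤ M →
    (∀ x ∈ Icc (0:ℝ) 1, ∀ y ∈ Icc (0:ℝ) 1, |ρ.l b x - ρ.l b y| ≤ M * |x - y|) →
    M * |ρ.F (-b) x - p| < ε / 2 → ((x < p ∧ x < ρ.F b x) ∨ (p < x ∧ ρ.F b x < x)) → |ρ.l g x| ≤ ε := by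
    intro b hb M hM0 hM hMx hcase
    obtain ⟨e, heI, he, -, hup, hdn⟩ := ρ.orbit_lim b hxI
    have hne : ρ.F b x ≠ x := by
      rcases hcase with h | h
      · exact h.2.ne'
      · exact h.2.ne
    have hFe := ρ.lim_mem_Fx H.r2 hne he
    have h1 := H.l_dist hx hb hM0 hM he hgg
    have h2 := hFx e heI hFe g hg
    have h3 : |ρ.F (-b) x - e| ≤ |ρ.F (-b) x - p| := by
      rcases hcase with h | h
      · have q1 : e ≤ p := le_of_tendsto' he fun n => by
          have := (ρ.F_lt_iff (n • b)).2 h.1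
          rw [hp] at this; exact this.le
        have q2 : ρ.F (-b) x < x := by rw [← ρ.F_lt_iff b, F_F_neg]; exact h.2
        have q3 := hup h.2.le 0
        rw [zero_smul, F_zero] at q3
        rw [abs_of_nonpos (by linarith), abs_of_nonpos (by linarith)]; linarith
      · have q1 : p ≤ e := ge_of_tendsto' he fun n => by
          have := (ρ.F_lt_iff (n • b)).2 h.1
          rw [hp] at this; exact this.le
        have q2 : x < ρ.F (-b) x := by rw [← ρ.F_lt_iff b, F_F_neg]; exact h.2
        have q3 := hdn h.2.le 0
        rw [zero_smul, F_zero] at q3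
        rw [abs_of_nonneg (by linarith), abs_of_nonneg (by linarith)]; linarith
    have h4 : M * |ρ.F (-b) x - e| ≤ M * |ρ.F (-b) x - p| := mul_le_mul_of_nonneg_left h3 hM0
    have h6 : |ρ.l g x| ≤ |ρ.l g x - ρ.l g e| + |ρ.l g e| := by
      have := abs_add_le (ρ.l g x - ρ.l g e) (ρ.l g e)
      simpa using this
    linarith
  have hb1 : τ a0 = 1 ∨ τ a0 = -1 := Or.inl H.one
  have hb2 : τ (-a0) = 1 ∨ τ (-a0) = -1 := Or.inr (by rw [map_neg, H.one])
  have hxp : x ≠ p := by rintro rfl; exact hx hp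
  have hn' : ρ.F a0 x < x ↔ x < ρ.F (-a0) x := by rw [← ρ.F_lt_iff a0 (x := x) (y := ρ.F (-a0) x), F_F_neg]
  have hn'' : x < ρ.F a0 x ↔ ρ.F (-a0) x < x := by rw [← ρ.F_lt_iff a0 (y := x) (x := ρ.F (-a0) x), F_F_neg]
  rcases H.ord hx hb1 with ⟨h1, -⟩ | ⟨h1, -⟩ <;> rcases lt_or_gt_of_ne hxp with h2 | h2
  · exact fin a0 hb1 M hM0 hM hx1 (Or.inl ⟨h2, h1⟩)
  · exact fin (-a0) hb2 M' hM0' hM' hx2 (Or.inr ⟨h2, hn''.1 h1⟩)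
  · exact fin (-a0) hb2 M' hM0' hM' hx2 (Or.inl ⟨h2, hn'.1 h1⟩)
  · exact fin a0 hb1 M hM0 hM hx1 (Or.inr ⟨h2, h1⟩)

lemma key_local (H : ρ.Hol τ a0) {ε : ℝ} (hε : 0 < ε) {p : ℝ} (hpI : p ∈ Icc (0:ℝ) 1) :
    ∃ η > 0, ∀ᶠ x in 𝓝 p, x ∈ Icc (0:ℝ) 1 → ∀ g, |τ g| < η → |ρ.l g x| ≤ ε := by
  by_cases hp : p ∈ ρ.Fx
  · exact H.key_Fx hε hp
  obtain ⟨e, heI, he, -⟩ := ρ.orbit_lim a0 hpI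
  have hne : ρ.F a0 p ≠ p := by
    rcases H.ord hp (Or.inl H.one) with h | h
    · exact h.1.ne'
    · exact h.1.ne
  have hFe := ρ.lim_mem_Fx H.r2 hne he
  obtain ⟨η, hη, hev⟩ := H.key_Fx (half_pos hε) hFe
  obtain ⟨N, hN⟩ := (he.eventually hev.eventually_nhds).exists
  obtain ⟨M, hM0, hM⟩ := ρ.l_lip H.r2 (N • a0)
  obtain ⟨η', hη', hu⟩ := H.u_small (ε := ε / 2 / (M + 1)) (by positivity)
  refine ⟨min η η', lt_min hη hη', ?_⟩
  filter_upwards [((ρ.F_cont (N • a0)).tendsto p).eventually hN] with x hx hxI g hg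
  rw [lt_min_iff] at hg
  have h1 := hx (ρ.F_mem _ hxI) g hg.1
  have h2 := hM _ hxI _ (ρ.F_mem g hxI)
  have h3 := hu g hg.2 x hxI
  rw [abs_sub_comm, le_div_iff₀ (by positivity)] at h3
  have h5 := abs_nonneg (x - ρ.F g x)
  rw [ρ.l_comm H.r2 g (N • a0) hxI, add_sub_assoc]
  refine (abs_add_le _ _).trans ?_
  nlinarith

/-- Key proposition. -/
lemma l_small (H : ρ.Hol τ a0) {ε : ℝ} (hε : 0 < ε) : ∃ η > 0, ∀ g, |τ g| < η → ∀ x ∈ Icc (0:ℝ) 1,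
    |ρ.l g x| ≤ ε := by
  have := isCompact_Icc.induction_on (s := Icc (0:ℝ) 1)
    (p := fun S => ∃ η > 0, ∀ x ∈ S, x ∈ Icc (0:ℝ) 1 → ∀ g, |τ g| < η → |ρ.l g x| ≤ ε)
    ⟨1, one_pos, fun x hx => hx.elim⟩
    (fun s t hst ⟨η, hη, h⟩ => ⟨η, hη, fun x hx => h x (hst hx)⟩)
    (fun s t ⟨η, hη, h⟩ ⟨η', hη', h'⟩ => ⟨min η η', lt_min hη hη', fun x hx hxI g hg => by
      rw [lt_min_iff] at hg
      rcases hx with hx | hx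
      · exact h x hx hxI g hg.1
      · exact h' x hx hxI g hg.2⟩)
    (fun x hx => by
      obtain ⟨η, hη, h⟩ := H.key_local hε hx
      exact ⟨_, nhdsWithin_le_nhds h, η, hη, fun y hy => hy⟩)
  obtain ⟨η, hη, h⟩ := this
  exact ⟨η, hη, fun g hg x hx => h x hx hx g hg⟩

end Hol

end ZdActionCr

lemma ext_of_modulus {G : Type*} {τ : G → ℝ} (hd : DenseRange τ) {q : G → ℝ → ℝ}
    (hq : ∀ g, Continuous (q g))
    (hm : ∀ ε > 0, ∃ η > 0, ∀ g h, |τ g - τ h| < η → ∀ x, |q g x - q h x| ≤ ε) :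
    ∃ Q : ℝ → ℝ → ℝ, Continuous (Function.uncurry Q) ∧ ∀ g x, Q (τ g) x = q g x := by
  have hne : ∀ t, (comap τ (𝓝 t)).NeBot := fun t => by
    rw [comap_neBot_iff]
    intro s hs
    obtain ⟨g, hg⟩ := hd.mem_nhds hs
    exact ⟨g, hg⟩
  have hball : ∀ t, ∀ η > 0, ∀ᶠ g in comap τ (𝓝 t), |τ g - t| < η := fun t η hη =>
    preimage_mem_comap (Metric.ball_mem_nhds t hη)
  have hex : ∀ t x, ∃ y, Tendsto (fun g => q g x) (comap τ (𝓝 t)) (𝓝 y) := by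
    intro t x
    have := hne t
    apply cauchy_map_iff_exists_tendsto.1
    rw [Metric.cauchy_iff]
    refine ⟨inferInstance, fun ε hε => ?_⟩
    obtain ⟨η, hη, h⟩ := hm (ε / 2) (by positivity)
    refine ⟨_, image_mem_map (hball t (η / 2) (by positivity)), ?_⟩
    rintro _ ⟨g, hg, rfl⟩ _ ⟨g', hg', rfl⟩
    have hg1 : |τ g - t| < η / 2 := hg
    have hg2 : |τ g' - t| < η / 2 := hg'
    rw [Real.dist_eq]
    refine lt_of_le_of_lt (h g g' ?_ x) (by linarith)
    rw [abs_lt] at *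
    constructor <;> linarith
  choose Q hQ using hex
  have key : ∀ ε > 0, ∃ η > 0, ∀ t g, |τ g - t| < η → ∀ x, |q g x - Q t x| ≤ ε := by
    intro ε hε
    obtain ⟨η, hη, h⟩ := hm ε hε
    refine ⟨η, hη, fun t g hg x => ?_⟩
    have := hne t
    refine le_of_tendsto ((tendsto_const_nhds.sub (hQ t x)).abs) ?_
    filter_upwards [hball t (η - |τ g - t|) (by linarith)] with g' hg'
    refine h g g' ?_ x
    calc |τ g - τ g'| = |(τ g - t) - (τ g' - t)| := by ring_nf
      _ ≤ |τ g - t| + |τ g' - t| := abs_sub _ _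
      _ < η := by linarith
  refine ⟨Q, ?_, fun g x => ?_⟩
  · rw [continuous_iff_continuousAt]
    rintro ⟨t, x⟩
    rw [Metric.continuousAt_iff']
    intro ε hε
    obtain ⟨η, hη, h⟩ := key (ε / 4) (by positivity)
    have := hne t
    obtain ⟨g, hg⟩ := (hball t (η / 2) (by positivity)).exists
    have hc : ∀ᶠ p : ℝ × ℝ in 𝓝 (t, x), |q g p.2 - q g x| < ε / 4 := by
      have h1 : Continuous fun p : ℝ × ℝ => |q g p.2 - q g x| := by
        have := hq g
        fun_prop
      have := h1.tendsto (t, x)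
      simp only [sub_self, abs_zero] at this
      exact this.eventually (gt_mem_nhds (by positivity))
    have ht : ∀ᶠ p : ℝ × ℝ in 𝓝 (t, x), |t - p.1| < η / 2 := by
      have h1 : Continuous fun p : ℝ × ℝ => |t - p.1| := by fun_prop
      have := h1.tendsto (t, x)
      simp only [sub_self, abs_zero] at this
      exact this.eventually (gt_mem_nhds (by positivity))
    filter_upwards [hc, ht] with p hp1 hp2
    have e1 := h t g (by linarith) x
    have e2 := h p.1 g (by
      calc |τ g - p.1| = |(τ g - t) + (t - p.1)| := by ring_nf
        _ ≤ |τ g - t| + |t - p.1| := abs_add_le _ _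
        _ < η := by linarith) p.2
    rw [Real.dist_eq]
    simp only [Function.uncurry]
    rw [abs_le] at e1 e2
    rw [abs_lt] at hp1 ⊢
    constructor <;> linarith
  · have : ∀ ε > 0, |q g x - Q (τ g) x| ≤ ε := fun ε hε => by
      obtain ⟨η, hη, h⟩ := key ε hε
      exact h _ g (by simpa using hη) x
    have := le_of_forall_pos_le_add (a := |q g x - Q (τ g) x|) (b := 0) (by simpa using this)
    have := abs_nonpos_iff.1 this
    linarith

/-- Abstract data of a `C¹` flow on `[0,1]`; `L` is the logarithm of the spatial derivative. -/
structure FlowD (Φ L : ℝ → ℝ → ℝ) : Prop where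
  cF : Continuous (Function.uncurry Φ)
  cL : Continuous (Function.uncurry L)
  zero : ∀ x, Φ 0 x = x
  add : ∀ s t x, Φ (s + t) x = Φ s (Φ t x)
  out : ∀ t, ∀ x ∉ Icc (0:ℝ) 1, Φ t x = x
  mem : ∀ t, ∀ x ∈ Icc (0:ℝ) 1, Φ t x ∈ Icc (0:ℝ) 1
  Ladd : ∀ s t, ∀ x ∈ Icc (0:ℝ) 1, L (s + t) x = L s (Φ t x) + L t x
  deriv : ∀ t, ∀ x ∈ Icc (0:ℝ) 1, HasDerivWithinAt (Φ t) (Real.exp (L t x)) (Icc (0:ℝ) 1) x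

namespace ZdActionCr
variable {d r : ℕ} {ρ : ZdActionCr d r} {τ : (Fin d → ℤ) →+ ℝ} {a0 : Fin d → ℤ}

def cl (x : ℝ) : ℝ := max 0 (min 1 x)
lemma cl_mem (x : ℝ) : cl x ∈ Icc (0:ℝ) 1 := ⟨le_max_left _ _, max_le zero_le_one (min_le_left _ _)⟩
lemma cl_of {x : ℝ} (hx : x ∈ Icc (0:ℝ) 1) : cl x = x := by
  rw [cl, min_eq_right hx.2, max_eq_right hx.1]
lemma cl_cont : Continuous cl := by unfold cl; fun_prop

lemma Hol.flow (H : ρ.Hol τ a0) : ∃ Φ L, FlowD Φ L ∧ (∀ g x, Φ (τ g) x = ρ.F g x) ∧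
    (∀ g, ∀ x ∈ Icc (0:ℝ) 1, L (τ g) x = ρ.l g x) := by
  have hr := H.r2
  obtain ⟨Φ, hΦc, hΦ⟩ := ext_of_modulus H.dense (q := ρ.F) ρ.F_cont (by
    intro ε hε
    obtain ⟨η, hη, h⟩ := H.u_small hε
    refine ⟨η, hη, fun g g' hg x => ?_⟩
    by_cases hx : x ∈ Icc (0:ℝ) 1
    · have := h (g - g') (by rwa [map_sub]) (ρ.F g' x) (ρ.F_mem g' hx)
      rwa [← F_add, sub_add_cancel] at this
    · rw [F_out _ _ hx, F_out _ _ hx]; simpa using hε.le)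
  obtain ⟨L, hLc, hL⟩ := ext_of_modulus H.dense (q := fun g x => ρ.l g (cl x))
    (fun g => (ρ.l_continuousOn hr g).comp_continuous cl_cont cl_mem) (by
    intro ε hε
    obtain ⟨η, hη, h⟩ := H.l_small hε
    refine ⟨η, hη, fun g g' hg x => ?_⟩
    have := h (g - g') (by rwa [map_sub]) (ρ.F g' (cl x)) (ρ.F_mem g' (cl_mem x))
    have h2 := ρ.l_add hr (g - g') g' (cl_mem x)
    rw [sub_add_cancel] at h2
    rw [h2]
    simpa using this)
  have hΦ1 : ∀ x, Continuous fun t => Φ t x := fun x => hΦc.comp (by fun_prop : Continuous fun t : ℝ => (t, x))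
  have hL1 : ∀ x, Continuous fun t => L t x := fun x => hLc.comp (by fun_prop : Continuous fun t : ℝ => (t, x))
  have hL2 : ∀ t, Continuous fun x => L t x := fun t => hLc.comp (by fun_prop : Continuous fun x : ℝ => (t, x))
  have hLg : ∀ g, ∀ x ∈ Icc (0:ℝ) 1, L (τ g) x = ρ.l g x := fun g x hx => by rw [hL, cl_of hx]
  have hd2 : DenseRange fun p : (Fin d → ℤ) × (Fin d → ℤ) => (τ p.1, τ p.2) := H.dense.prodMap H.dense
  have hmem : ∀ t, ∀ x ∈ Icc (0:ℝ) 1, Φ t x ∈ Icc (0:ℝ) 1 := by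
    intro t x hx
    exact H.dense.induction_on t (isClosed_Icc.preimage (hΦ1 x)) (fun g => by
      rw [hΦ]; exact ρ.F_mem g hx)
  have hinr : ∀ x ∈ Icc (0:ℝ) 1, ∀ t, Φ t x = ∫ z in (0:ℝ)..x, Real.exp (L t z) := by
    intro x hx t
    have hc : Continuous fun t => ∫ z in (0:ℝ)..x, Real.exp (L t z) := by
      apply intervalIntegral.continuous_parametric_intervalIntegral_of_continuous'
      exact Real.continuous_exp.comp hLc
    have := H.dense.equalizer (hΦ1 x) hc (by
      ext g
      simp only [Function.comp]
      rw [hΦ]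
      have := intervalIntegral.integral_eq_sub_of_hasDeriv_right (a := 0) (b := x) (f := ρ.F g)
        (f' := fun z => Real.exp (L (τ g) z)) (ρ.F_cont g).continuousOn (by
          intro z hz
          rw [min_eq_left hx.1, max_eq_right hx.1] at hz
          have hz' : z ∈ Icc (0:ℝ) 1 := ⟨hz.1.le, hz.2.le.trans hx.2⟩
          rw [hLg g z hz']
          exact ((ρ.F_hasDeriv hr g hz').hasDerivAt
            (Icc_mem_nhds hz.1 (hz.2.trans_le hx.2))).hasDerivWithinAt)
        ((Real.continuous_exp.comp (hL2 _)).intervalIntegrable _ _)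
      rw [this, F_at_zero, sub_zero])
    exact congrFun this t
  refine ⟨Φ, L, ⟨hΦc, hLc, ?_, ?_, ?_, hmem, ?_, ?_⟩, hΦ, hLg⟩
  · intro x
    have := hΦ 0 x
    rwa [map_zero, F_zero] at this
  · intro s t x
    have := hd2.equalizer (g := fun p : ℝ × ℝ => Φ (p.1 + p.2) x) (h := fun p : ℝ × ℝ => Φ p.1 (Φ p.2 x))
      (hΦc.comp (by fun_prop : Continuous fun p : ℝ × ℝ => (p.1 + p.2, x)))
      (hΦc.comp ((continuous_fst).prodMk ((hΦ1 x).comp continuous_snd))) (by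
        ext ⟨g, g'⟩
        simp only [Function.comp]
        rw [← map_add, hΦ, hΦ, hΦ, F_add])
    exact congrFun this (s, t)
  · intro t x hx
    have := H.dense.equalizer (hΦ1 x) (continuous_const (y := x)) (by
      ext g
      simp only [Function.comp]
      rw [hΦ, F_out _ _ hx])
    exact congrFun this t
  · intro s t x hx
    have := hd2.equalizer (g := fun p : ℝ × ℝ => L (p.1 + p.2) x)
      (h := fun p : ℝ × ℝ => L p.1 (Φ p.2 x) + L p.2 x)
      (hLc.comp (by fun_prop : Continuous fun p : ℝ × ℝ => (p.1 + p.2, x)))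
      ((hLc.comp ((continuous_fst).prodMk ((hΦ1 x).comp continuous_snd))).add
        ((hL1 x).comp continuous_snd)) (by
        ext ⟨g, g'⟩
        simp only [Function.comp]
        rw [← map_add, hLg _ _ hx, hLg _ _ hx, hLg _ _ (hmem _ _ hx), hΦ, l_add _ hr _ _ hx])
    exact congrFun this (s, t)
  · intro t x hx
    have hc : Continuous fun z => Real.exp (L t z) := Real.continuous_exp.comp (hL2 t)
    have h1 : HasDerivAt (fun x => ∫ z in (0:ℝ)..x, Real.exp (L t z)) (Real.exp (L t x)) x :=
      intervalIntegral.integral_hasDerivAt_right (hc.intervalIntegrable _ _)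
        (hc.stronglyMeasurableAtFilter _ _) hc.continuousAt
    exact h1.hasDerivWithinAt.congr (fun y hy => hinr y hy t) (hinr x hx t)

end ZdActionCr

/-- average derivative -/
def FJ (L : ℝ → ℝ → ℝ) (x : ℝ) : ℝ := ∫ s in (0:ℝ)..1, Real.exp (L s x)
/-- the generating vector field -/
def FX (Φ L : ℝ → ℝ → ℝ) (x : ℝ) : ℝ := (Φ 1 x - x) / FJ L x

namespace FlowD
variable {Φ L : ℝ → ℝ → ℝ}

lemma c1 (H : FlowD Φ L) (x : ℝ) : Continuous fun t => Φ t x :=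
  H.cF.comp (by fun_prop : Continuous fun t : ℝ => (t, x))
lemma c2 (H : FlowD Φ L) (t : ℝ) : Continuous (Φ t) :=
  H.cF.comp (by fun_prop : Continuous fun x : ℝ => (t, x))
lemma cL1 (H : FlowD Φ L) (x : ℝ) : Continuous fun t => L t x :=
  H.cL.comp (by fun_prop : Continuous fun t : ℝ => (t, x))
lemma cL2 (H : FlowD Φ L) (t : ℝ) : Continuous (L t) :=
  H.cL.comp (by fun_prop : Continuous fun x : ℝ => (t, x))

lemma neg_left (H : FlowD Φ L) (t x : ℝ) : Φ (-t) (Φ t x) = x := by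
  rw [← H.add, neg_add_cancel, H.zero]
lemma neg_right (H : FlowD Φ L) (t x : ℝ) : Φ t (Φ (-t) x) = x := by
  rw [← H.add, add_neg_cancel, H.zero]

lemma L0 (H : FlowD Φ L) {x : ℝ} (hx : x ∈ Icc (0:ℝ) 1) : L 0 x = 0 := by
  have := H.Ladd 0 0 x hx
  rw [add_zero, H.zero] at this
  linarith

lemma rev (H : FlowD Φ L) : FlowD (fun t => Φ (-t)) (fun t => L (-t)) where
  cF := H.cF.comp (by fun_prop : Continuous fun p : ℝ × ℝ => (-p.1, p.2))
  cL := H.cL.comp (by fun_prop : Continuous fun p : ℝ × ℝ => (-p.1, p.2))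
  zero := by simpa using H.zero
  add s t x := by simp only [neg_add]; exact H.add _ _ _
  out t := H.out _
  mem t := H.mem _
  Ladd s t x hx := by simp only [neg_add]; exact H.Ladd _ _ _ hx
  deriv t := H.deriv _

lemma cexp (H : FlowD Φ L) : Continuous (Function.uncurry fun x s => Real.exp (L s x)) :=
  Real.continuous_exp.comp (H.cL.comp continuous_swap)

lemma J_cont (H : FlowD Φ L) : Continuous (FJ L) :=
  intervalIntegral.continuous_parametric_intervalIntegral_of_continuous' H.cexp _ _

lemma J_pos (H : FlowD Φ L) (x : ℝ) : 0 < FJ L x :=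
  intervalIntegral.intervalIntegral_pos_of_pos
    ((Real.continuous_exp.comp (H.cL1 x)).intervalIntegrable _ _) (fun _ => Real.exp_pos _) zero_lt_one

lemma X_cont (H : FlowD Φ L) : Continuous (FX Φ L) :=
  ((H.c2 1).sub continuous_id).div H.J_cont fun x => (H.J_pos x).ne'

lemma int_eq (H : FlowD Φ L) (t : ℝ) {x : ℝ} (hx : x ∈ Icc (0:ℝ) 1) :
    Φ t x = Φ t 0 + ∫ z in (0:ℝ)..x, Real.exp (L t z) := by
  have := intervalIntegral.integral_eq_sub_of_hasDeriv_right (a := 0) (b := x) (f := Φ t)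
        (f' := fun z => Real.exp (L t z)) (H.c2 t).continuousOn (by
          intro z hz
          rw [min_eq_left hx.1, max_eq_right hx.1] at hz
          have hz' : z ∈ Icc (0:ℝ) 1 := ⟨hz.1.le, hz.2.le.trans hx.2⟩
          exact ((H.deriv t z hz').hasDerivAt
            (Icc_mem_nhds hz.1 (hz.2.trans_le hx.2))).hasDerivWithinAt)
        ((Real.continuous_exp.comp (H.cL2 _)).intervalIntegrable _ _)
  rw [this]; ring

lemma avg_deriv (H : FlowD Φ L) {x : ℝ} (hx : x ∈ Icc (0:ℝ) 1) :
    HasDerivWithinAt (fun y => ∫ s in (0:ℝ)..1, Φ s y) (FJ L x) (Icc (0:ℝ) 1) x := by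
  have h1 : ∀ y ∈ Icc (0:ℝ) 1, (∫ s in (0:ℝ)..1, Φ s y) =
      (∫ s in (0:ℝ)..1, Φ s 0) + ∫ z in (0:ℝ)..y, FJ L z := by
    intro y hy
    have hcexp2 : Continuous (Function.uncurry fun s x => Real.exp (L s x)) :=
      Real.continuous_exp.comp H.cL
    have hc : Continuous fun s => ∫ z in (0:ℝ)..y, Real.exp (L s z) :=
      intervalIntegral.continuous_parametric_intervalIntegral_of_continuous' hcexp2 _ _
    rw [show (fun s => Φ s y) = fun s => Φ s 0 + ∫ z in (0:ℝ)..y, Real.exp (L s z) from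
      funext fun s => H.int_eq s hy]
    rw [intervalIntegral.integral_add ((H.c1 0).intervalIntegrable _ _) (hc.intervalIntegrable _ _)]
    congr 1
    unfold FJ
    simp_rw [intervalIntegral.integral_of_le hy.1, intervalIntegral.integral_of_le zero_le_one]
    rw [integral_integral_swap]
    rw [Measure.prod_restrict]
    exact (hcexp2.continuousOn.integrableOn_compact
      (isCompact_Icc.prod isCompact_Icc)).mono_set (prod_mono Ioc_subset_Icc_self Ioc_subset_Icc_self)
  have h2 : HasDerivAt (fun y => (∫ s in (0:ℝ)..1, Φ s 0) + ∫ z in (0:ℝ)..y, FJ L z) (FJ L x) x :=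
    (intervalIntegral.integral_hasDerivAt_right (H.J_cont.intervalIntegrable _ _)
        (H.J_cont.stronglyMeasurableAtFilter _ _) H.J_cont.continuousAt).const_add _
  exact h2.hasDerivWithinAt.congr h1 (h1 x hx)

lemma hasDeriv0 (H : FlowD Φ L) {x : ℝ} (hx : x ∈ Icc (0:ℝ) 1) :
    HasDerivAt (fun t => Φ t x) (FX Φ L x) 0 := by
  set A : ℝ → ℝ := fun y => ∫ s in (0:ℝ)..1, Φ s y with hA
  have hc := H.c1 x
  have hB : ∀ h, A (Φ h x) = (∫ s in (0:ℝ)..(1 + h), Φ s x) - ∫ s in (0:ℝ)..h, Φ s x := by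
    intro h
    simp only [hA]
    have := intervalIntegral.integral_comp_add_right (a := 0) (b := 1) (fun s => Φ s x) h
    rw [← intervalIntegral.integral_interval_sub_left (a := (0:ℝ)) (hc.intervalIntegrable _ _) (hc.intervalIntegrable _ _)] at this
    simp only [zero_add] at this
    rw [← this]
    simp_rw [H.add]
  have hB' : HasDerivAt (fun h => A (Φ h x)) (Φ 1 x - x) 0 := by
    rw [funext hB]
    have h1 : ∀ u, HasDerivAt (fun h => ∫ s in (0:ℝ)..h, Φ s x) (Φ u x) u := fun u =>
      intervalIntegral.integral_hasDerivAt_right (hc.intervalIntegrable _ _)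
        (hc.stronglyMeasurableAtFilter _ _) hc.continuousAt
    have h2 : HasDerivAt (fun h => ∫ s in (0:ℝ)..(1 + h), Φ s x) (Φ 1 x) 0 := by
      have h3 : HasDerivAt (fun h : ℝ => 1 + h) 1 0 := (hasDerivAt_id _).const_add _
      have := HasDerivAt.comp (0:ℝ) (h₂ := fun h => ∫ s in (0:ℝ)..h, Φ s x) (h1 (1 + 0)) h3
      simpa [Function.comp_def] using this
    have := h2.sub (h1 0)
    rwa [H.zero] at this
  have hd := hasDerivWithinAt_iff_tendsto_slope.1 (H.avg_deriv hx)
  set S := Function.update (slope A x) x (FJ L x) with hSd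
  have hS1 : ContinuousWithinAt S (Icc (0:ℝ) 1) x := continuousWithinAt_update_same.2 hd
  have hS2 : S x = FJ L x := Function.update_self ..
  have hS3 : ∀ y, (y - x) * S y = A y - A x := by
    intro y
    by_cases hy : y = x
    · simp [hy]
    · rw [hSd, Function.update_of_ne hy, slope_def_field]
      field_simp [sub_ne_zero.2 hy]
  have hS : Tendsto (fun h => S (Φ h x)) (𝓝 0) (𝓝 (FJ L x)) := by
    have h1 : Tendsto (fun h => Φ h x) (𝓝 0) (𝓝[Icc (0:ℝ) 1] x) := by
      refine tendsto_nhdsWithin_iff.2 ⟨?_, Eventually.of_forall fun h => H.mem h x hx⟩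
      have := hc.tendsto 0
      rwa [H.zero] at this
    have := hS1.tendsto.comp h1
    rwa [hS2] at this
  rw [hasDerivAt_iff_tendsto_slope] at hB' ⊢
  have := hB'.div (hS.mono_left nhdsWithin_le_nhds) (H.J_pos x).ne'
  refine this.congr' ?_
  have hpos : ∀ᶠ h in 𝓝[≠] (0:ℝ), 0 < S (Φ h x) :=
    (hS.mono_left nhdsWithin_le_nhds).eventually (lt_mem_nhds (H.J_pos x))
  filter_upwards [hpos] with h hh
  simp only [slope_def_field, Pi.div_apply]
  rw [H.zero, ← hS3]
  field_simp

lemma hasDeriv (H : FlowD Φ L) {x : ℝ} (hx : x ∈ Icc (0:ℝ) 1) (t : ℝ) :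
    HasDerivAt (fun t => Φ t x) (FX Φ L (Φ t x)) t := by
  have h1 := H.hasDeriv0 (H.mem t x hx)
  have h2 : (fun s => Φ s x) = (fun s => Φ s (Φ t x)) ∘ fun s => s - t := by
    ext s
    simp [Function.comp, ← H.add]
  rw [h2]
  have h3 : HasDerivAt (fun s : ℝ => s - t) 1 t := (hasDerivAt_id t).sub_const t
  rw [← sub_self t] at h1
  simpa using HasDerivAt.comp (h := fun s : ℝ => s - t) t h1 h3

lemma X_push (H : FlowD Φ L) {x : ℝ} (hx : x ∈ Icc (0:ℝ) 1) (t : ℝ) :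
    FX Φ L (Φ t x) = Real.exp (L t x) * FX Φ L x := by
  have h1 := H.hasDeriv0 (H.mem t x hx)
  have h2 : (fun s => Φ s (Φ t x)) = Φ t ∘ fun s => Φ s x := by
    ext s
    simp only [Function.comp]
    rw [← H.add, ← H.add, add_comm]
  rw [h2] at h1
  have h3 := H.deriv t x hx
  have h3' : HasDerivWithinAt (Φ t) (Real.exp (L t x)) (Icc (0:ℝ) 1) (Φ 0 x) := by rwa [H.zero]
  have h4 := h3'.comp_hasDerivAt (0:ℝ) (H.hasDeriv0 hx) (Eventually.of_forall fun s => H.mem s x hx)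
  exact h1.unique h4

lemma X_eq_zero (H : FlowD Φ L) {x : ℝ} : FX Φ L x = 0 ↔ Φ 1 x = x := by
  rw [FX, div_eq_zero_iff, sub_eq_zero, or_iff_left (H.J_pos x).ne']

lemma L_bound (H : FlowD Φ L) : ∃ K : ℝ, 0 ≤ K ∧ ∀ t ∈ Icc (-1:ℝ) 1, ∀ x ∈ Icc (0:ℝ) 1, |L t x| ≤ K := by
  obtain ⟨K, hK⟩ := (isCompact_Icc (a := (-1:ℝ)) (b := 1)).prod (isCompact_Icc (a := (0:ℝ)) (b := 1))
    |>.exists_bound_of_continuousOn H.cL.continuousOn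
  exact ⟨K, (norm_nonneg _).trans (hK (0, 0) (by simp)), fun t ht x hx => hK (t, x) ⟨ht, hx⟩⟩

end FlowD

/-- derivative-recursive classes of functions -/
def Cl (P : (ℝ → ℝ) → Prop) : ℕ → (ℝ → ℝ) → Prop
  | 0, u => P u
  | n + 1, u => P u ∧ Differentiable ℝ u ∧ Cl P n (deriv u)

namespace Cl
variable {P Q R : (ℝ → ℝ) → Prop}

lemma base {n : ℕ} {u : ℝ → ℝ} (h : Cl P n u) : P u := by
  cases n with
  | zero => exact h
  | succ n => exact h.1

lemma of_succ {n : ℕ} {u : ℝ → ℝ} (h : Cl P (n + 1) u) : Cl P n u := by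
  induction n generalizing u with
  | zero => exact h.1
  | succ n ih => exact ⟨h.1, h.2.1, ih h.2.2⟩

lemma mono {n m : ℕ} {u : ℝ → ℝ} (h : Cl P n u) (hmn : m ≤ n) : Cl P m u := by
  induction n with
  | zero => obtain rfl : m = 0 := by omega
            exact h
  | succ n ih =>
    rcases Nat.lt_or_ge m (n + 1) with h1 | h1
    · exact ih h.of_succ (by omega)
    · obtain rfl : m = n + 1 := by omega
      exact h

lemma imp (hPQ : ∀ u, P u → Q u) {n : ℕ} {u : ℝ → ℝ} (h : Cl P n u) : Cl Q n u := by
  induction n generalizing u with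
  | zero => exact hPQ _ h
  | succ n ih => exact ⟨hPQ _ h.1, h.2.1, ih h.2.2⟩

lemma add (hP : ∀ u v, P u → P v → P (u + v)) {n : ℕ} {u v : ℝ → ℝ} (hu : Cl P n u) (hv : Cl P n v) :
    Cl P n (u + v) := by
  induction n generalizing u v with
  | zero => exact hP _ _ hu hv
  | succ n ih =>
    refine ⟨hP _ _ hu.1 hv.1, hu.2.1.add hv.2.1, ?_⟩
    have : deriv (u + v) = deriv u + deriv v := by
      ext s; exact deriv_add (hu.2.1 s) (hv.2.1 s)
    rw [this]; exact ih hu.2.2 hv.2.2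

lemma mul (hPQ : ∀ u v, P u → Q v → R (u * v)) (hR : ∀ u v, R u → R v → R (u + v)) {n : ℕ}
    {u v : ℝ → ℝ} (hu : Cl P n u) (hv : Cl Q n v) : Cl R n (u * v) := by
  induction n generalizing u v with
  | zero => exact hPQ _ _ hu hv
  | succ n ih =>
    refine ⟨hPQ _ _ hu.1 hv.1, hu.2.1.mul hv.2.1, ?_⟩
    have : deriv (u * v) = deriv u * v + u * deriv v := by
      ext s; exact deriv_mul (hu.2.1 s) (hv.2.1 s)
    rw [this]; exact add hR (ih hu.2.2 hv.of_succ) (ih hu.of_succ hv.2.2)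

lemma smul (hP : ∀ (k : ℝ) u, P u → P (k • u)) {n : ℕ} (k : ℝ) {u : ℝ → ℝ} (hu : Cl P n u) :
    Cl P n (k • u) := by
  induction n generalizing u with
  | zero => exact hP _ _ hu
  | succ n ih =>
    refine ⟨hP _ _ hu.1, hu.2.1.const_smul k, ?_⟩
    have : deriv (k • u) = k • deriv u := by
      ext s; exact deriv_const_smul _ (hu.2.1 s)
    rw [this]; exact ih hu.2.2

lemma const (hP : ∀ k : ℝ, P fun _ => k) (n : ℕ) (k : ℝ) : Cl P n fun _ => k := by
  induction n generalizing k with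
  | zero => exact hP _
  | succ n ih =>
    refine ⟨hP _, differentiable_const k, ?_⟩
    have : deriv (fun _ : ℝ => k) = fun _ => 0 := by ext s; simp
    rw [this]; exact ih 0

lemma contDiff (hP : ∀ u, P u → Continuous u) {n : ℕ} {u : ℝ → ℝ} (hu : Cl P n u) :
    ContDiff ℝ n u := by
  induction n generalizing u with
  | zero => exact contDiff_zero.2 (hP _ hu)
  | succ n ih =>
    push_cast
    exact contDiff_succ_iff_deriv.2 ⟨hu.2.1, by simp, ih hu.2.2⟩

end Cl

/-- continuous and dominated by `ξ` -/
def PD (ξ : ℝ → ℝ) (u : ℝ → ℝ) : Prop := Continuous u ∧ ∃ C, 0 ≤ C ∧ ∀ s, |u s| ≤ C * |ξ s|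
/-- continuous and bounded -/
def PB (u : ℝ → ℝ) : Prop := Continuous u ∧ ∃ C, 0 ≤ C ∧ ∀ s, |u s| ≤ C
/-- continuous, bounded, and tending to zero -/
def PZ (u : ℝ → ℝ) : Prop := PB u ∧ Tendsto u atTop (𝓝 0)

lemma PD.add {ξ : ℝ → ℝ} (u v : ℝ → ℝ) : PD ξ u → PD ξ v → PD ξ (u + v) := by
  rintro ⟨h1, C, hC, h2⟩ ⟨h3, C', hC', h4⟩
  refine ⟨h1.add h3, C + C', by positivity, fun s => ?_⟩
  have := abs_add_le (u s) (v s)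
  have := h2 s
  have := h4 s
  simp only [Pi.add_apply, add_mul]
  linarith
lemma PB.add (u v : ℝ → ℝ) : PB u → PB v → PB (u + v) := by
  rintro ⟨h1, C, hC, h2⟩ ⟨h3, C', hC', h4⟩
  refine ⟨h1.add h3, C + C', by positivity, fun s => ?_⟩
  have := abs_add_le (u s) (v s)
  have := h2 s
  have := h4 s
  simp only [Pi.add_apply]
  linarith
lemma PZ.add (u v : ℝ → ℝ) : PZ u → PZ v → PZ (u + v) := by
  rintro ⟨h1, h2⟩ ⟨h3, h4⟩
  refine ⟨PB.add _ _ h1 h3, ?_⟩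
  have := Tendsto.add h2 h4
  rw [add_zero] at this
  exact this
lemma PB.mulD {ξ : ℝ → ℝ} (u v : ℝ → ℝ) : PB u → PD ξ v → PD ξ (u * v) := by
  rintro ⟨h1, C, hC, h2⟩ ⟨h3, C', hC', h4⟩
  refine ⟨h1.mul h3, C * C', by positivity, fun s => ?_⟩
  simp only [Pi.mul_apply, abs_mul]
  rw [mul_assoc]
  exact mul_le_mul (h2 s) (h4 s) (abs_nonneg _) hC
lemma PB.mul (u v : ℝ → ℝ) : PB u → PB v → PB (u * v) := by
  rintro ⟨h1, C, hC, h2⟩ ⟨h3, C', hC', h4⟩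
  refine ⟨h1.mul h3, C * C', by positivity, fun s => ?_⟩
  simp only [Pi.mul_apply, abs_mul]
  exact mul_le_mul (h2 s) (h4 s) (abs_nonneg _) hC
lemma PB.mulZ (u v : ℝ → ℝ) : PB u → PZ v → PZ (u * v) := by
  intro h ⟨h1, h2⟩
  refine ⟨PB.mul _ _ h h1, ?_⟩
  obtain ⟨-, C, hC, h3⟩ := h
  have h4 : Tendsto (fun s => C * |v s|) atTop (𝓝 0) := by simpa using (h2.abs).const_mul C
  refine squeeze_zero_norm (fun s => ?_) h4
  simp only [Pi.mul_apply, norm_mul, Real.norm_eq_abs]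
  exact mul_le_mul_of_nonneg_right (h3 s) (abs_nonneg _)
lemma PZ.smul (k : ℝ) (u : ℝ → ℝ) : PZ u → PZ (k • u) := by
  intro h
  exact PB.mulZ (fun _ => k) u ⟨continuous_const, |k|, abs_nonneg _, fun _ => le_rfl⟩ h
lemma PB.const (k : ℝ) : PB fun _ => k := ⟨continuous_const, |k|, abs_nonneg _, fun _ => le_rfl⟩

structure Orb (Φ L : ℝ → ℝ → ℝ) (m : ℕ) (x e : ℝ) : Prop where
  H : FlowD Φ L
  hm : 1 ≤ m
  hl : ContDiffOn ℝ m (L 1) (Icc (0:ℝ) 1)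
  hx : x ∈ Ioo (0:ℝ) 1
  hX : FX Φ L x ≠ 0
  he : Tendsto (fun s => Φ s x) atTop (𝓝 e)

namespace FlowD
variable {Φ L : ℝ → ℝ → ℝ}

lemma strictMonoOn (H : FlowD Φ L) (t : ℝ) : StrictMonoOn (Φ t) (Icc (0:ℝ) 1) := by
  apply strictMonoOn_of_deriv_pos (convex_Icc 0 1) (H.c2 t).continuousOn
  intro x hx
  rw [interior_Icc] at hx
  rw [((H.deriv t x (Ioo_subset_Icc_self hx)).hasDerivAt (Icc_mem_nhds hx.1 hx.2)).deriv]
  exact Real.exp_pos _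

lemma mem_Ioo (H : FlowD Φ L) (t : ℝ) {x : ℝ} (hx : x ∈ Ioo (0:ℝ) 1) : Φ t x ∈ Ioo (0:ℝ) 1 := by
  have h0 := H.strictMonoOn t (by simp) (Ioo_subset_Icc_self hx) hx.1
  have h1 := H.strictMonoOn t (Ioo_subset_Icc_self hx) (by simp) hx.2
  exact ⟨(H.mem t 0 (by simp)).1.trans_lt h0, h1.trans_le (H.mem t 1 (by simp)).2⟩

lemma L_bound' (H : FlowD Φ L) (R : ℝ) : ∃ K : ℝ, ∀ t, |t| ≤ R → ∀ x ∈ Icc (0:ℝ) 1, |L t x| ≤ K := by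
  obtain ⟨K, hK⟩ := (isCompact_Icc (a := -R) (b := R)).prod (isCompact_Icc (a := (0:ℝ)) (b := 1))
    |>.exists_bound_of_continuousOn H.cL.continuousOn
  exact ⟨K, fun t ht x hx => hK (t, x) ⟨abs_le.1 ht, hx⟩⟩

end FlowD

namespace Orb
variable {Φ L : ℝ → ℝ → ℝ} {m : ℕ} {x e : ℝ}

lemma hxI (O : Orb Φ L m x e) : x ∈ Icc (0:ℝ) 1 := Ioo_subset_Icc_self O.hx
lemma gI (O : Orb Φ L m x e) (s : ℝ) : Φ s x ∈ Icc (0:ℝ) 1 := O.H.mem s x O.hxI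
lemma eI (O : Orb Φ L m x e) : e ∈ Icc (0:ℝ) 1 :=
  isClosed_Icc.mem_of_tendsto O.he (Eventually.of_forall O.gI)

/-- the speed along the orbit -/
def xi (Φ L : ℝ → ℝ → ℝ) (x s : ℝ) : ℝ := FX Φ L (Φ s x)

lemma xi_add (O : Orb Φ L m x e) (s u : ℝ) : xi Φ L x (s + u) = Real.exp (L u (Φ s x)) * xi Φ L x s := by
  rw [xi, xi, add_comm, O.H.add, O.H.X_push (O.gI s)]

lemma xi_eq (O : Orb Φ L m x e) (s : ℝ) : xi Φ L x s = Real.exp (L s x) * FX Φ L x := by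
  rw [xi, O.H.X_push O.hxI]

lemma xi_ne (O : Orb Φ L m x e) (s : ℝ) : xi Φ L x s ≠ 0 := by
  rw [O.xi_eq]; exact mul_ne_zero (Real.exp_pos _).ne' O.hX

lemma xi_cont (O : Orb Φ L m x e) : Continuous (xi Φ L x) := O.H.X_cont.comp (O.H.c1 x)

lemma g_deriv (O : Orb Φ L m x e) (s : ℝ) : HasDerivAt (fun s => Φ s x) (xi Φ L x s) s :=
  O.H.hasDeriv O.hxI s

lemma xi_shift (O : Orb Φ L m x e) (R : ℝ) : ∃ K, 0 < K ∧ ∀ s u, |u| ≤ R →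
    |xi Φ L x (s + u)| ≤ K * |xi Φ L x s| := by
  obtain ⟨K, hK⟩ := O.H.L_bound' R
  refine ⟨Real.exp K, Real.exp_pos _, fun s u hu => ?_⟩
  rw [O.xi_add, abs_mul, Real.abs_exp]
  exact mul_le_mul_of_nonneg_right (Real.exp_le_exp.2 ((le_abs_self _).trans (hK u hu _ (O.gI s))))
    (abs_nonneg _)

lemma xi_sum (O : Orb Φ L m x e) : ∃ C, 0 < C ∧ ∀ s, Summable (fun i : ℕ => |xi Φ L x (s + i)|) ∧
    ∑' i : ℕ, |xi Φ L x (s + i)| ≤ C * |Φ s x - e| := by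
  obtain ⟨K, hK0, hK⟩ := O.xi_shift 1
  obtain ⟨σ, hσ, hσ1⟩ : ∃ σ : ℝ, |σ| = 1 ∧ σ * FX Φ L x = |FX Φ L x| := by
    rcases lt_or_gt_of_ne O.hX with h | h
    · exact ⟨-1, by simp, by rw [abs_of_neg h]; ring⟩
    · exact ⟨1, by simp, by rw [abs_of_pos h]; ring⟩
  have hstep : ∀ s, |xi Φ L x s| ≤ K * (σ * (Φ (s + 1) x - Φ s x)) := by
    intro s
    obtain ⟨v, hv, hv'⟩ := exists_hasDerivAt_eq_slope (fun s => Φ s x) (xi Φ L x) (lt_add_one s)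
      (O.H.c1 x).continuousOn (fun v _ => O.g_deriv v)
    have h1 : Φ (s + 1) x - Φ s x = xi Φ L x v := by rw [hv']; simp
    rw [h1]
    have h2 : σ * xi Φ L x v = |xi Φ L x v| := by
      rw [O.xi_eq, abs_mul, Real.abs_exp, ← hσ1]; ring
    rw [h2]
    have := hK v (s - v) (by rw [abs_le]; constructor <;> linarith [hv.1, hv.2])
    simpa using this
  refine ⟨K, hK0, fun s => ?_⟩
  have hs : HasSum (fun i : ℕ => K * (σ * (Φ (s + i + 1) x - Φ (s + i) x))) (K * (σ * (e - Φ s x))) := by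
    rw [hasSum_iff_tendsto_nat_of_nonneg (fun i => (abs_nonneg _).trans (hstep _))]
    have h1 : ∀ n : ℕ, ∑ i ∈ Finset.range n, K * (σ * (Φ (s + i + 1) x - Φ (s + i) x)) =
        K * (σ * (Φ (s + n) x - Φ s x)) := by
      intro n
      have := Finset.sum_range_sub (fun i : ℕ => Φ (s + i) x) n
      simp only [Nat.cast_zero, add_zero] at this
      rw [← this, Finset.mul_sum, Finset.mul_sum]
      refine Finset.sum_congr rfl fun i _ => ?_
      push_cast
      rw [add_assoc]
    simp_rw [h1]
    have h2 : Tendsto (fun n : ℕ => s + (n : ℝ)) atTop atTop :=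
      tendsto_atTop_add_const_left _ _ tendsto_natCast_atTop_atTop
    exact (((O.he.comp h2).sub_const _).const_mul _).const_mul _
  have hsum := Summable.of_nonneg_of_le (fun i => abs_nonneg _) (fun i : ℕ => hstep (s + i)) hs.summable
  refine ⟨hsum, ?_⟩
  have h3 := hsum.tsum_le_tsum (fun i : ℕ => hstep (s + i)) hs.summable
  rw [hs.tsum_eq] at h3
  refine h3.trans (mul_le_mul_of_nonneg_left ?_ hK0.le)
  calc σ * (e - Φ s x) ≤ |σ * (e - Φ s x)| := le_abs_self _
    _ = |Φ s x - e| := by rw [abs_mul, hσ, one_mul, abs_sub_comm]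

end Orb

namespace Orb
variable {Φ L : ℝ → ℝ → ℝ} {m : ℕ} {x e : ℝ}

/-- the orbit-sum operator -/
def SS (u : ℝ → ℝ) (s : ℝ) : ℝ := ∑' i : ℕ, u (s + i)

lemma sum_deriv (O : Orb Φ L m x e) {g : ℕ → ℝ → ℝ} {v : ℝ → ℝ} (hv : PD (xi Φ L x) v)
    (hg : ∀ i s, HasDerivAt (g i) (v (s + i)) s) (h0 : Summable fun i => g i 0) (s : ℝ) :
    Summable (fun i => g i s) ∧ HasDerivAt (fun s => ∑' i, g i s) (SS v s) s := by
  obtain ⟨-, C, hC, hv⟩ := hv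
  obtain ⟨K, hK0, hK⟩ := O.xi_shift (|s| + 1)
  obtain ⟨C', -, hC'⟩ := O.xi_sum
  have hu : Summable fun i : ℕ => C * (K * |xi Φ L x i|) := by
    have := (hC' 0).1
    simp only [zero_add] at this
    exact (this.mul_left K).mul_left C
  have hb : ∀ (i : ℕ) (y : ℝ), y ∈ Ioo (-(|s| + 1)) (|s| + 1) → ‖v (y + i)‖ ≤ C * (K * |xi Φ L x i|) := by
    intro i y hy
    refine (hv _).trans (mul_le_mul_of_nonneg_left ?_ hC)
    rw [add_comm]
    exact hK i y (abs_le.2 ⟨hy.1.le, hy.2.le⟩)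
  have h0' : (0:ℝ) ∈ Ioo (-(|s| + 1)) (|s| + 1) := by
    constructor <;> linarith [abs_nonneg s]
  have hs' : s ∈ Ioo (-(|s| + 1)) (|s| + 1) := by
    constructor <;> linarith [neg_abs_le s, le_abs_self s]
  exact ⟨summable_of_summable_hasDerivAt_of_isPreconnected hu isOpen_Ioo isPreconnected_Ioo
      (fun i y _ => hg i y) hb h0' h0 hs',
    hasDerivAt_tsum_of_isPreconnected hu isOpen_Ioo isPreconnected_Ioo
      (fun i y _ => hg i y) hb h0' h0 hs'⟩

lemma summ (O : Orb Φ L m x e) {v : ℝ → ℝ} (hv : PD (xi Φ L x) v) (s : ℝ) :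
    Summable fun i : ℕ => v (s + i) := by
  obtain ⟨-, C, hC, hv⟩ := hv
  obtain ⟨C', -, hC'⟩ := O.xi_sum
  exact Summable.of_norm_bounded ((hC' s).1.mul_left C) fun i => hv _

lemma SS_PZ (O : Orb Φ L m x e) {v : ℝ → ℝ} (hv : PD (xi Φ L x) v) : PZ (SS v) := by
  have hv0 := hv
  obtain ⟨hvc, C, hC, hv⟩ := hv
  obtain ⟨C', hC'0, hC'⟩ := O.xi_sum
  have hb : ∀ s, |SS v s| ≤ C * (C' * |Φ s x - e|) := by
    intro s
    have h1 : ‖SS v s‖ ≤ ∑' i : ℕ, C * |xi Φ L x (s + i)| :=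
      tsum_of_norm_bounded ((hC' s).1.mul_left C).hasSum fun i => hv _
    rw [tsum_mul_left] at h1
    exact h1.trans (mul_le_mul_of_nonneg_left (hC' s).2 hC)
  refine ⟨⟨?_, C * (C' * 1), by positivity, fun s => (hb s).trans ?_⟩, ?_⟩
  · -- continuity
    rw [continuous_iff_continuousAt]
    intro s
    obtain ⟨K, hK0, hK⟩ := O.xi_shift (|s| + 1)
    have hu : Summable fun i : ℕ => C * (K * |xi Φ L x i|) := by
      have := (hC' 0).1
      simp only [zero_add] at this
      exact (this.mul_left K).mul_left C
    have : ContinuousOn (SS v) (Ioo (-(|s| + 1)) (|s| + 1)) := by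
      refine continuousOn_tsum (fun i => ?_) hu ?_
      · exact (hvc.comp (by fun_prop : Continuous fun s : ℝ => s + i)).continuousOn
      · intro i y hy
        refine (hv _).trans (mul_le_mul_of_nonneg_left ?_ hC)
        rw [add_comm]
        exact hK i y (abs_le.2 ⟨hy.1.le, hy.2.le⟩)
    exact this.continuousAt (Ioo_mem_nhds (by linarith [neg_abs_le s]) (by linarith [le_abs_self s]))
  · refine mul_le_mul_of_nonneg_left (mul_le_mul_of_nonneg_left ?_ hC'0.le) hC
    have h1 := O.gI s
    have h2 := O.eI
    rw [abs_le]
    constructor <;> linarith [h1.1, h1.2, h2.1, h2.2]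
  · have h1 : Tendsto (fun s => C * (C' * |Φ s x - e|)) atTop (𝓝 (C * (C' * |e - e|))) :=
      (((O.he.sub_const e).abs).const_mul C').const_mul C
    rw [sub_self, abs_zero, mul_zero, mul_zero] at h1
    exact squeeze_zero_norm hb h1

lemma SS_Cl (O : Orb Φ L m x e) {n : ℕ} {u : ℝ → ℝ} (hu : Cl (PD (xi Φ L x)) n u) : Cl PZ n (SS u) := by
  induction n generalizing u with
  | zero => exact O.SS_PZ hu
  | succ n ih =>
    have h1 : ∀ s, HasDerivAt (SS u) (SS (deriv u) s) s := fun s =>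
      (O.sum_deriv (g := fun i s => u (s + i)) hu.2.2.base
        (fun i s => (hu.2.1 (s + i)).hasDerivAt.comp_add_const s i) (by
          exact O.summ hu.1 0) s).2
    refine ⟨O.SS_PZ hu.1, fun s => (h1 s).differentiableAt, ?_⟩
    rw [show deriv (SS u) = SS (deriv u) from funext fun s => (h1 s).deriv]
    exact ih hu.2.2

lemma xi_PD (O : Orb Φ L m x e) : PD (xi Φ L x) (xi Φ L x) :=
  ⟨O.xi_cont, 1, zero_le_one, fun s => by rw [one_mul]⟩

lemma PD_PB (O : Orb Φ L m x e) (u : ℝ → ℝ) (h : PD (xi Φ L x) u) : PB u := by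
  obtain ⟨h1, C, hC, h2⟩ := h
  obtain ⟨M, hM⟩ := isCompact_Icc.exists_bound_of_continuousOn (O.H.X_cont.continuousOn (s := Icc (0:ℝ) 1))
  have hM0 : 0 ≤ M := (norm_nonneg _).trans (hM x O.hxI)
  exact ⟨h1, C * M, by positivity, fun s => (h2 s).trans (mul_le_mul_of_nonneg_left (hM _ (O.gI s)) hC)⟩

lemma comp_Cl (O : Orb Φ L m x e) {n : ℕ} {w : ℝ → ℝ} (hw : ContDiffOn ℝ n w (Icc (0:ℝ) 1))
    (hx : Cl PB (n - 1) (xi Φ L x)) : Cl PB n fun s => w (Φ s x) := by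
  have hb : ∀ w : ℝ → ℝ, ContinuousOn w (Icc (0:ℝ) 1) → PB fun s => w (Φ s x) := by
    intro w hw
    obtain ⟨M, hM⟩ := isCompact_Icc.exists_bound_of_continuousOn hw
    exact ⟨hw.comp_continuous (O.H.c1 x) O.gI, M, (norm_nonneg _).trans (hM x O.hxI), fun s => hM _ (O.gI s)⟩
  induction n generalizing w with
  | zero => exact hb _ hw.continuousOn
  | succ n ih =>
    have h1 : ∀ s, HasDerivAt (fun s => w (Φ s x)) (derivWithin w (Icc (0:ℝ) 1) (Φ s x) * xi Φ L x s) s := by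
      intro s
      have h2 := (hw.differentiableOn (by norm_cast) (Φ s x) (O.gI s)).hasDerivWithinAt
      exact h2.comp_hasDerivAt s (O.g_deriv s) (Eventually.of_forall O.gI)
    refine ⟨hb _ hw.continuousOn, fun s => (h1 s).differentiableAt, ?_⟩
    rw [show deriv (fun s => w (Φ s x)) = (fun s => derivWithin w (Icc (0:ℝ) 1) (Φ s x)) * xi Φ L x from
      funext fun s => (h1 s).deriv]
    refine Cl.mul PB.mul PB.add (ih (hw.derivWithin (uniqueDiffOn_Icc zero_lt_one) (by norm_cast)) ?_) hx
    exact hx.mono (by omega)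

lemma e_fix (O : Orb Φ L m x e) (s : ℝ) : Φ s e = e := by
  have h1 : Tendsto (fun t => Φ s (Φ t x)) atTop (𝓝 (Φ s e)) := ((O.H.c2 s).tendsto e).comp O.he
  have h2 : Tendsto (fun t => Φ (s + t) x) atTop (𝓝 e) :=
    O.he.comp (tendsto_atTop_add_const_left _ _ tendsto_id)
  simp_rw [O.H.add] at h2
  exact tendsto_nhds_unique h1 h2

lemma e_lin (O : Orb Φ L m x e) (s : ℝ) : L s e = s * L 1 e := by
  let φ : ℝ →+ ℝ := ⟨⟨fun s => L s e, O.H.L0 O.eI⟩, fun s t => by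
    have := O.H.Ladd s t e O.eI
    rwa [O.e_fix] at this⟩
  have := map_real_smul φ (O.H.cL1 e) s 1
  simpa [φ] using this

/-- the derivative of log-derivative along the orbit -/
def B0 (Φ L : ℝ → ℝ → ℝ) (x : ℝ) : ℝ → ℝ :=
  (fun s => derivWithin (L 1) (Icc (0:ℝ) 1) (Φ s x)) * xi Φ L x

/-- logarithmic derivative of the speed -/
def th (Φ L : ℝ → ℝ → ℝ) (x e : ℝ) : ℝ → ℝ := (fun _ => L 1 e) + (-1 : ℝ) • SS (B0 Φ L x)

lemma L_nat (O : Orb Φ L m x e) (s : ℝ) (n : ℕ) :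
    L s x = L s (Φ n x) - ∑ i ∈ Finset.range n, (L 1 (Φ (s + i) x) - L 1 (Φ i x)) := by
  have h1 : ∀ y ∈ Icc (0:ℝ) 1, L n y = ∑ i ∈ Finset.range n, L 1 (Φ i y) := by
    intro y hy
    induction n with
    | zero => simp [O.H.L0 hy]
    | succ n ih =>
      rw [Finset.sum_range_succ, ← ih]
      push_cast
      rw [add_comm, O.H.Ladd _ _ _ hy, add_comm]
  have h2 := O.H.Ladd s n x O.hxI
  have h3 := O.H.Ladd n s x O.hxI
  rw [add_comm] at h3
  rw [h3, h1 _ (O.gI s), h1 x O.hxI] at h2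
  have h4 : ∀ i : ℕ, Φ i (Φ s x) = Φ (s + i) x := fun i => by rw [← O.H.add, add_comm]
  simp_rw [h4] at h2
  rw [Finset.sum_sub_distrib]
  linarith

lemma B0_PD (O : Orb Φ L m x e) : PD (xi Φ L x) (B0 Φ L x) := by
  refine PB.mulD _ _ ?_ O.xi_PD
  have h1 : ContDiffOn ℝ ((0:ℕ):WithTop ℕ∞) (derivWithin (L 1) (Icc (0:ℝ) 1)) (Icc (0:ℝ) 1) :=
    O.hl.derivWithin (uniqueDiffOn_Icc zero_lt_one) (by have := O.hm; norm_cast)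
  exact O.comp_Cl h1 (O.PD_PB _ O.xi_PD)

lemma L_deriv (O : Orb Φ L m x e) (s : ℝ) : HasDerivAt (fun s => L s x) (th Φ L x e s) s := by
  have hd : ∀ (i : ℕ) s, HasDerivAt (fun s => L 1 (Φ (s + i) x) - L 1 (Φ i x)) (B0 Φ L x (s + i)) s := by
    intro i s
    have h1 : ∀ s, HasDerivAt (fun s => L 1 (Φ s x)) (B0 Φ L x s) s := by
      intro s
      have h2 := (O.hl.differentiableOn (by have := O.hm; norm_cast; omega) (Φ s x) (O.gI s)).hasDerivWithinAt
      exact h2.comp_hasDerivAt s (O.g_deriv s) (Eventually.of_forall O.gI)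
    exact ((h1 (s + i)).comp_add_const s i).sub_const _
  have key := O.sum_deriv O.B0_PD hd (by simp [summable_zero])
  have h3 : (fun s => L s x) = fun s => s * L 1 e - ∑' i : ℕ, (L 1 (Φ (s + i) x) - L 1 (Φ i x)) := by
    ext s
    have h4 := (key s).1.hasSum.tendsto_sum_nat
    have h5 : Tendsto (fun n : ℕ => L s (Φ n x)) atTop (𝓝 (L s e)) :=
      ((O.H.cL2 s).tendsto e).comp (O.he.comp tendsto_natCast_atTop_atTop)
    have h6 := h5.sub h4
    simp_rw [← O.L_nat s] at h6
    rw [← O.e_lin]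
    exact tendsto_nhds_unique tendsto_const_nhds h6
  rw [h3]
  have := ((hasDerivAt_id s).mul_const (L 1 e)).sub (key s).2
  refine this.congr_deriv ?_
  simp only [th, Pi.add_apply, Pi.smul_apply, smul_eq_mul]; ring

lemma xi_deriv (O : Orb Φ L m x e) (s : ℝ) :
    HasDerivAt (xi Φ L x) (th Φ L x e s * xi Φ L x s) s := by
  rw [funext O.xi_eq]
  refine ((O.L_deriv s).exp.mul_const (FX Φ L x)).congr_deriv ?_
  ring

lemma boot (O : Orb Φ L m x e) {n : ℕ} (hn : n + 1 ≤ m) :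
    Cl (PD (xi Φ L x)) (n + 1) (xi Φ L x) ∧ Cl PZ n (SS (B0 Φ L x)) := by
  have step : ∀ n, n + 1 ≤ m → Cl (PD (xi Φ L x)) n (xi Φ L x) →
      Cl (PD (xi Φ L x)) (n + 1) (xi Φ L x) ∧ Cl PZ n (SS (B0 Φ L x)) := by
    intro n hn h
    have h1 : ContDiffOn ℝ n (derivWithin (L 1) (Icc (0:ℝ) 1)) (Icc (0:ℝ) 1) :=
      O.hl.derivWithin (uniqueDiffOn_Icc zero_lt_one) (by norm_cast)
    have h2 : Cl PB n (xi Φ L x) := h.imp O.PD_PB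
    have h3 := O.comp_Cl h1 (h2.mono (by omega))
    have h4 : Cl (PD (xi Φ L x)) n (B0 Φ L x) := Cl.mul PB.mulD PD.add h3 h
    have h5 := O.SS_Cl h4
    refine ⟨⟨O.xi_PD, fun s => (O.xi_deriv s).differentiableAt, ?_⟩, h5⟩
    rw [show deriv (xi Φ L x) = th Φ L x e * xi Φ L x from funext fun s => (O.xi_deriv s).deriv]
    refine Cl.mul PB.mulD PD.add ?_ h
    exact Cl.add PB.add (Cl.const PB.const _ _) ((Cl.smul PZ.smul _ h5).imp fun _ h => h.1)
  induction n with
  | zero => exact step 0 hn O.xi_PD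
  | succ n ih => exact step _ hn (ih (by omega)).1

lemma th_PB (O : Orb Φ L m x e) : Cl PB (m - 1) (th Φ L x e) := by
  have h5 := (O.boot (n := m - 1) (by have := O.hm; omega)).2
  exact Cl.add PB.add (Cl.const PB.const _ _) ((Cl.smul PZ.smul _ h5).imp fun _ h => h.1)

lemma th_lim (O : Orb Φ L m x e) : Tendsto (th Φ L x e) atTop (𝓝 (L 1 e)) := by
  have h5 := (O.boot (n := m - 1) (by have := O.hm; omega)).2
  have h6 : Tendsto (fun s => L 1 e + (-1) * SS (B0 Φ L x) s) atTop (𝓝 (L 1 e + (-1) * 0)) :=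
    (h5.base.2.const_mul _).const_add _
  rw [mul_zero, add_zero] at h6
  exact h6

/-- the sequence `ξ^j X^{(j+1)}` along the orbit -/
def WW (Φ L : ℝ → ℝ → ℝ) (x e : ℝ) : ℕ → ℝ → ℝ
  | 0 => th Φ L x e
  | j + 1 => deriv (WW Φ L x e j) + (-(j:ℝ)) • (th Φ L x e * WW Φ L x e j)

lemma WW_Cl (O : Orb Φ L m x e) {j : ℕ} (hj : j + 2 ≤ m) : Cl PZ (m - 2 - j) (WW Φ L x e (j + 1)) := by
  induction j with
  | zero =>
    have h5 := (O.boot (n := m - 1) (by omega)).2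
    have h6 : WW Φ L x e (0 + 1) = deriv ((-1 : ℝ) • SS (B0 Φ L x)) := by
      ext s
      simp only [WW, Nat.cast_zero, neg_zero, zero_smul, add_zero, th]
      exact deriv_const_add (L 1 e) 
    rw [h6]
    obtain ⟨k, rfl⟩ : ∃ k, m = k + 2 := ⟨m - 2, by omega⟩
    exact (Cl.smul PZ.smul (-1) h5).2.2
  | succ j ih =>
    have h := ih (by omega)
    obtain ⟨k, rfl⟩ : ∃ k, m = k + 3 + j := ⟨m - 3 - j, by omega⟩
    rw [WW]
    have e1 : k + 3 + j - 2 - j = k + 1 := by omega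
    have e2 : k + 3 + j - 2 - (j + 1) = k := by omega
    rw [e1] at h
    rw [e2]
    exact Cl.add PZ.add h.2.2 (Cl.smul PZ.smul _ (Cl.mul PB.mulZ PZ.add (O.th_PB.mono (by omega)) h.of_succ))

lemma WW_diff (O : Orb Φ L m x e) {j : ℕ} (hj : j + 2 ≤ m) : Differentiable ℝ (WW Φ L x e j) := by
  cases j with
  | zero =>
    have := O.th_PB
    obtain ⟨k, rfl⟩ : ∃ k, m = k + 2 := ⟨m - 2, by omega⟩
    exact this.2.1
  | succ j =>
    have := O.WW_Cl (j := j) (by omega)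
    obtain ⟨k, rfl⟩ : ∃ k, m = k + 3 + j := ⟨m - 3 - j, by omega⟩
    have e1 : k + 3 + j - 2 - j = k + 1 := by omega
    rw [e1] at this
    exact this.2.1

lemma strict (O : Orb Φ L m x e) (s : ℝ) : HasStrictDerivAt (fun s => Φ s x) (xi Φ L x s) s :=
  hasStrictDerivAt_of_hasDerivAt_of_continuousAt (Eventually.of_forall O.g_deriv) O.xi_cont.continuousAt

lemma inv_deriv (O : Orb Φ L m x e) {g w : ℝ → ℝ} (hgw : ∀ s, g (Φ s x) = w s) {s w' : ℝ}
    (hw : HasDerivAt w w' s) : HasDerivAt g (w' / xi Φ L x s) (Φ s x) := by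
  set T := (O.strict s).localInverse _ _ _ (O.xi_ne s) with hT
  have h1 : HasDerivAt T (xi Φ L x s)⁻¹ (Φ s x) := ((O.strict s).to_localInverse (O.xi_ne s)).hasDerivAt
  have h2 : T (Φ s x) = s := HasStrictFDerivAt.localInverse_apply_image _
  have h3 : ∀ᶠ y in 𝓝 (Φ s x), Φ (T y) x = y := (O.strict s).eventually_right_inverse (O.xi_ne s)
  have h4 : HasDerivAt (w ∘ T) (w' * (xi Φ L x s)⁻¹) (Φ s x) := by
    rw [← h2] at hw
    exact HasDerivAt.comp _ hw h1
  rw [div_eq_mul_inv]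
  refine h4.congr_of_eventuallyEq ?_
  filter_upwards [h3] with y hy
  simp only [Function.comp]
  rw [← hgw, hy]

lemma inv_cont (O : Orb Φ L m x e) {g w : ℝ → ℝ} (hgw : ∀ s, g (Φ s x) = w s) {s : ℝ}
    (hw : Continuous w) : ContinuousAt g (Φ s x) := by
  set T := (O.strict s).localInverse _ _ _ (O.xi_ne s) with hT
  have h1 : HasDerivAt T (xi Φ L x s)⁻¹ (Φ s x) := ((O.strict s).to_localInverse (O.xi_ne s)).hasDerivAt
  have h3 : ∀ᶠ y in 𝓝 (Φ s x), Φ (T y) x = y := (O.strict s).eventually_right_inverse (O.xi_ne s)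
  have h4 : ContinuousAt (w ∘ T) (Φ s x) := ContinuousAt.comp hw.continuousAt h1.continuousAt
  refine h4.congr ?_
  filter_upwards [h3] with y hy
  simp only [Function.comp]
  rw [← hgw, hy]

lemma open_range (O : Orb Φ L m x e) : IsOpen (range fun s => Φ s x) :=
  (isOpenMap_of_hasStrictDerivAt O.strict O.xi_ne).isOpen_range

lemma inv_contDiff (O : Orb Φ L m x e) {n : ℕ} (hn : n ≤ m) {g w : ℝ → ℝ} (hgw : ∀ s, g (Φ s x) = w s)
    (hw : ContDiff ℝ n w) : ContDiffOn ℝ n g (range fun s => Φ s x) := by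
  induction n generalizing g w with
  | zero =>
    refine contDiffOn_zero.2 ?_
    rintro _ ⟨s, rfl⟩
    exact (O.inv_cont hgw hw.continuous).continuousWithinAt
  | succ n ih =>
    push_cast at hw ⊢
    obtain ⟨hd, -, hw'⟩ := contDiff_succ_iff_deriv.1 hw
    rw [contDiffOn_succ_iff_deriv_of_isOpen O.open_range]
    refine ⟨?_, by simp, ?_⟩
    · rintro _ ⟨s, rfl⟩
      exact (O.inv_deriv hgw (hd s).hasDerivAt).differentiableAt.differentiableWithinAt
    · refine ih (by omega) (w := fun s => deriv w s / xi Φ L x s)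
        (fun s => (O.inv_deriv hgw (hd s).hasDerivAt).deriv) ?_
      have h1 := (O.boot (n := m - 1) (by have := O.hm; omega)).1
      have h2 : ContDiff ℝ n (xi Φ L x) := ((h1.mono (by omega : n ≤ m - 1 + 1)).contDiff fun u hu => hu.1)
      exact hw'.div h2 O.xi_ne

lemma X_contDiffAt (O : Orb Φ L m x e) : ContDiffAt ℝ m (FX Φ L) x := by
  have h1 := (O.boot (n := m - 1) (by have := O.hm; omega)).1
  have h2 : ContDiff ℝ m (xi Φ L x) := ((h1.mono (by omega : m ≤ m - 1 + 1)).contDiff fun u hu => hu.1)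
  have h3 := O.inv_contDiff le_rfl (g := FX Φ L) (fun s => rfl) h2
  exact h3.contDiffAt (O.open_range.mem_nhds ⟨0, O.H.zero x⟩)

lemma X_iter (O : Orb Φ L m x e) {j : ℕ} (hj : j + 1 ≤ m) (s : ℝ) :
    iteratedDeriv (j + 1) (FX Φ L) (Φ s x) = WW Φ L x e j s / xi Φ L x s ^ j := by
  induction j generalizing s with
  | zero =>
    rw [zero_add, iteratedDeriv_one, (O.inv_deriv (fun s => rfl) (O.xi_deriv s)).deriv]
    have := O.xi_ne s
    simp only [WW]
    field_simp
  | succ j ih =>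
    rw [iteratedDeriv_succ]
    have hn := O.xi_ne s
    have h1 := ((O.WW_diff (j := j) (by omega)) s).hasDerivAt.div ((O.xi_deriv s).pow j) (pow_ne_zero _ hn)
    rw [(O.inv_deriv (fun s => ih (by omega) s) h1).deriv]
    simp only [WW, Pi.add_apply, Pi.smul_apply, Pi.mul_apply, Pi.pow_apply, smul_eq_mul]
    cases j with
    | zero => simp
    | succ k =>
      simp only [Nat.add_sub_cancel]
      field_simp
      push_cast
      ring

lemma X1_lim (O : Orb Φ L m x e) : Tendsto (fun s => deriv (FX Φ L) (Φ s x)) atTop (𝓝 (L 1 e)) := by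
  refine O.th_lim.congr fun s => ?_
  have := O.X_iter (j := 0) O.hm s
  rw [zero_add, iteratedDeriv_one] at this
  rw [this]
  simp [WW]

lemma Xj_lim (O : Orb Φ L m x e) {j : ℕ} (hj : j + 2 ≤ m) :
    Tendsto (fun s => FX Φ L (Φ s x) ^ (j + 1) * iteratedDeriv (j + 2) (FX Φ L) (Φ s x)) atTop (𝓝 0) := by
  refine (O.WW_Cl hj).base.2.congr fun s => ?_
  rw [O.X_iter (j := j + 1) hj s]
  have := O.xi_ne s
  simp only [xi] at *
  field_simp

end Orb

open Asymptotics in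
/-- weighted classes at `0+` -/
def SC : ℕ → ℕ → (ℝ → ℝ) → Prop
  | m, 0, u => u =O[𝓝[>] (0:ℝ)] fun t => t ^ m
  | m, n + 1, u => (u =O[𝓝[>] (0:ℝ)] fun t => t ^ m) ∧
      (∀ᶠ t in 𝓝[>] (0:ℝ), DifferentiableAt ℝ u t) ∧ SC (m - 1) n (deriv u)

lemma ev_nhds {p : ℝ → Prop} (h : ∀ᶠ t in 𝓝[>] (0:ℝ), p t) :
    ∀ᶠ t in 𝓝[>] (0:ℝ), ∀ᶠ t' in 𝓝 t, p t' := by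
  obtain ⟨δ, hδ, h⟩ := mem_nhdsGT_iff_exists_Ioo_subset.1 h
  filter_upwards [Ioo_mem_nhdsGT hδ] with t ht
  filter_upwards [Ioo_mem_nhds ht.1 ht.2] with t' ht' using h ht'

lemma ev_deriv {u v : ℝ → ℝ} (h : u =ᶠ[𝓝[>] (0:ℝ)] v) : deriv u =ᶠ[𝓝[>] (0:ℝ)] deriv v := by
  filter_upwards [ev_nhds h] with t ht
  exact EventuallyEq.deriv_eq ht

lemma pow_isBigO {m m' : ℕ} (h : m' ≤ m) : (fun t : ℝ => t ^ m) =O[𝓝[>] (0:ℝ)] fun t => t ^ m' := by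
  refine Asymptotics.IsBigO.of_bound 1 ?_
  filter_upwards [Ioo_mem_nhdsGT (zero_lt_one : (0:ℝ) < 1)] with t ht
  rw [one_mul, norm_pow, norm_pow]
  exact pow_le_pow_of_le_one (norm_nonneg _) (by rw [Real.norm_eq_abs, abs_of_pos ht.1]; exact ht.2.le) h

namespace SC

lemma base {m n : ℕ} {u : ℝ → ℝ} (h : SC m n u) : u =O[𝓝[>] (0:ℝ)] fun t => t ^ m := by
  cases n with
  | zero => exact h
  | succ n => exact h.1

lemma congr {m n : ℕ} {u v : ℝ → ℝ} (h : SC m n u) (huv : u =ᶠ[𝓝[>] (0:ℝ)] v) : SC m n v := by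
  induction n generalizing m u v with
  | zero => exact Asymptotics.IsBigO.congr' h huv EventuallyEq.rfl
  | succ n ih =>
    refine ⟨h.1.congr' huv EventuallyEq.rfl, ?_, ih h.2.2 (ev_deriv huv)⟩
    filter_upwards [ev_nhds huv, h.2.1] with t h1 h2
    exact (EventuallyEq.differentiableAt_iff h1).1 h2

lemma mono {m m' n : ℕ} {u : ℝ → ℝ} (h : SC m n u) (hm : m' ≤ m) : SC m' n u := by
  induction n generalizing m m' u with
  | zero => exact Asymptotics.IsBigO.trans h (pow_isBigO hm)
  | succ n ih => exact ⟨h.1.trans (pow_isBigO hm), h.2.1, ih h.2.2 (by omega)⟩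

lemma of_succ {m n : ℕ} {u : ℝ → ℝ} (h : SC m (n + 1) u) : SC m n u := by
  induction n generalizing m u with
  | zero => exact h.1
  | succ n ih => exact ⟨h.1, h.2.1, ih h.2.2⟩

lemma mono' {m n n' : ℕ} {u : ℝ → ℝ} (h : SC m n u) (hn : n' ≤ n) : SC m n' u := by
  induction n with
  | zero => obtain rfl : n' = 0 := by omega
            exact h
  | succ n ih =>
    rcases Nat.lt_or_ge n' (n + 1) with h1 | h1
    · exact ih h.of_succ (by omega)
    · obtain rfl : n' = n + 1 := by omega
      exact h

lemma deriv' {m n : ℕ} {u : ℝ → ℝ} (h : SC m n u) (hn : 1 ≤ n) : SC (m - 1) (n - 1) (deriv u) := by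
  obtain ⟨k, rfl⟩ : ∃ k, n = k + 1 := ⟨n - 1, by omega⟩
  exact h.2.2

lemma diff {m n : ℕ} {u : ℝ → ℝ} (h : SC m n u) (hn : 1 ≤ n) : ∀ᶠ t in 𝓝[>] (0:ℝ), DifferentiableAt ℝ u t := by
  obtain ⟨k, rfl⟩ : ∃ k, n = k + 1 := ⟨n - 1, by omega⟩
  exact h.2.1

lemma add {m n : ℕ} {u v : ℝ → ℝ} (hu : SC m n u) (hv : SC m n v) : SC m n (fun t => u t + v t) := by
  induction n generalizing m u v with
  | zero => exact Asymptotics.IsBigO.add hu hv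
  | succ n ih =>
    refine ⟨hu.1.add hv.1, ?_, (ih hu.2.2 hv.2.2).congr ?_⟩
    · filter_upwards [hu.2.1, hv.2.1] with t h1 h2 using h1.add h2
    · filter_upwards [hu.2.1, hv.2.1] with t h1 h2
      exact (deriv_fun_add h1 h2).symm

lemma mul {m m' n : ℕ} {u v : ℝ → ℝ} (hu : SC m n u) (hv : SC m' n v) :
    SC (m + m') n (fun t => u t * v t) := by
  induction n generalizing m m' u v with
  | zero =>
    have := Asymptotics.IsBigO.mul hu hv
    simp_rw [← pow_add] at this
    exact this
  | succ n ih =>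
    have hb := Asymptotics.IsBigO.mul hu.1 hv.1
    simp_rw [← pow_add] at hb
    refine ⟨hb, ?_, ?_⟩
    · filter_upwards [hu.2.1, hv.2.1] with t h1 h2 using h1.mul h2
    · refine (add ((ih hu.2.2 hv.of_succ).mono (by omega)) ((ih hu.of_succ hv.2.2).mono (by omega))).congr ?_
      filter_upwards [hu.2.1, hv.2.1] with t h1 h2
      exact (deriv_fun_mul h1 h2).symm

lemma const (n : ℕ) (k : ℝ) : SC 0 n fun _ => k := by
  have hb : ∀ k : ℝ, (fun _ : ℝ => k) =O[𝓝[>] (0:ℝ)] fun t => t ^ 0 := by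
    intro k
    simp_rw [pow_zero]
    exact Asymptotics.isBigO_const_const k (one_ne_zero (α := ℝ)) _
  induction n generalizing k with
  | zero => exact hb k
  | succ n ih =>
    refine ⟨hb k, Eventually.of_forall fun _ => differentiableAt_const _, (ih 0).congr ?_⟩
    exact Eventually.of_forall fun t => (deriv_const t k).symm

lemma cmul {m n : ℕ} {u : ℝ → ℝ} (k : ℝ) (hu : SC m n u) : SC m n (fun t => k * u t) := by
  simpa using (const n k).mul hu

lemma neg {m n : ℕ} {u : ℝ → ℝ} (hu : SC m n u) : SC m n (fun t => - u t) := by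
  simpa using hu.cmul (-1)

lemma sub {m n : ℕ} {u v : ℝ → ℝ} (hu : SC m n u) (hv : SC m n v) : SC m n (fun t => u t - v t) := by
  simpa [sub_eq_add_neg] using hu.add hv.neg

lemma zero (m n : ℕ) : SC m n fun _ => 0 := by
  induction n generalizing m with
  | zero => exact Asymptotics.isBigO_zero _ _
  | succ n ih =>
    refine ⟨Asymptotics.isBigO_zero _ _, Eventually.of_forall fun _ => differentiableAt_const _,
      (ih _).congr (Eventually.of_forall fun t => (deriv_const t 0).symm)⟩

lemma sum {ι : Type*} {s : Finset ι} {m n : ℕ} {u : ι → ℝ → ℝ} (h : ∀ i ∈ s, SC m n (u i)) :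
    SC m n (fun t => ∑ i ∈ s, u i t) := by
  classical
  induction s using Finset.induction_on with
  | empty => simpa using zero m n
  | insert a s ha ih =>
    simp_rw [Finset.sum_insert ha]
    exact (h a (by simp)).add (ih fun i hi => h i (by simp [hi]))

lemma id (n : ℕ) : SC 1 n fun t => t := by
  cases n with
  | zero => simpa [SC] using Asymptotics.isBigO_refl _ _
  | succ n =>
    refine ⟨by simpa using Asymptotics.isBigO_refl _ _, Eventually.of_forall fun _ => differentiableAt_id,
      (const n 1).congr (Eventually.of_forall fun t => ?_)⟩
    simp

lemma pow {n : ℕ} {u : ℝ → ℝ} {m : ℕ} (hu : SC m n u) (i : ℕ) : SC (i * m) n (fun t => u t ^ i) := by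
  induction i with
  | zero => simpa using const n 1
  | succ i ih =>
    simp_rw [pow_succ, add_mul, one_mul]
    exact ih.mul hu

lemma poly (n : ℕ) {k : ℕ} {A : Polynomial ℝ} (hA : Polynomial.X ^ k ∣ A) : SC k n fun t => A.eval t := by
  obtain ⟨B, rfl⟩ := hA
  simp_rw [Polynomial.eval_mul, Polynomial.eval_pow, Polynomial.eval_X]
  have h1 : SC 0 n fun t => B.eval t := by
    simp_rw [Polynomial.eval_eq_sum_range]
    refine sum fun i _ => cmul _ ?_
    exact ((id n).pow i).mono (Nat.zero_le _)
  simpa using ((id n).pow k).mul h1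

lemma inv {n : ℕ} {u : ℝ → ℝ} (hu : SC 0 n u) {c : ℝ} (hc : 0 < c) (hcu : ∀ᶠ t in 𝓝[>] (0:ℝ), c ≤ u t) :
    SC 0 n (fun t => (u t)⁻¹) := by
  have hb : (fun t => (u t)⁻¹) =O[𝓝[>] (0:ℝ)] fun t => t ^ 0 := by
    refine Asymptotics.IsBigO.of_bound c⁻¹ ?_
    filter_upwards [hcu] with t ht
    rw [norm_inv, pow_zero, norm_one, mul_one, Real.norm_eq_abs, abs_of_pos (hc.trans_le ht)]
    exact inv_anti₀ hc ht
  induction n with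
  | zero => exact hb
  | succ n ih =>
    refine ⟨hb, ?_, ?_⟩
    · filter_upwards [hu.2.1, hcu] with t h1 h2 using h1.inv (hc.trans_le h2).ne'
    · have h1 := ih hu.of_succ
      refine ((hu.2.2.mul (h1.mul h1)).neg).congr ?_
      filter_upwards [hu.2.1, hcu] with t h1 h2
      rw [deriv_fun_inv'' h1 (hc.trans_le h2).ne']
      have := (hc.trans_le h2).ne'
      field_simp

/-- composition with a polynomial -/
lemma comp_sub {n q k : ℕ} {f P : ℝ → ℝ} (hf : SC 1 n f) (hP : SC 1 n P) (hfP : SC q n fun t => f t - P t)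
    {Y : Polynomial ℝ} (hY : Polynomial.X ^ k ∣ Y) :
    SC (q + k - 1) n fun t => Y.eval (f t) - Y.eval (P t) := by
  simp_rw [Polynomial.eval_eq_sum_range, ← Finset.sum_sub_distrib, ← mul_sub]
  refine sum fun i _ => ?_
  by_cases hi : i < k
  · rw [(Polynomial.X_pow_dvd_iff.1 hY i hi)]
    simpa using zero _ n
  · refine cmul _ ?_
    rcases Nat.eq_zero_or_pos i with rfl | hi0
    · simpa using zero _ n
    have h1 : ∀ t, f t ^ i - P t ^ i = (f t - P t) * ∑ j ∈ Finset.range i, f t ^ j * P t ^ (i - 1 - j) := by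
      intro t
      rw [mul_comm, Commute.geom_sum₂_mul (Commute.all _ _)]
    simp_rw [h1]
    refine (hfP.mul (m' := i - 1) (sum fun j hj => ?_)).mono (by omega)
    have h2 := (hf.pow j).mul (hP.pow (i - 1 - j))
    refine h2.mono ?_
    have := Finset.mem_range.1 hj
    omega

end SC

namespace PolL
open Polynomial

lemma X_dvd_sub (G : ℝ[X]) : X ∣ G - C (G.coeff 0) := by
  rw [X_dvd_iff]; simp

lemma expand {k : ℕ} (hk : 1 ≤ k) {B P : ℝ[X]} (hP : P = X + X ^ k * B) (hB : B.coeff 0 ≠ 0)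
    (h1 : k = 1 → 0 < 1 + B.coeff 0) :
    ∃ a : ℕ → ℝ, a k = 0 ∧ (∀ q, k < q → a q ≠ 0) ∧
      ∀ q, 1 ≤ q → X ^ (q + k) ∣ P ^ q - derivative P * X ^ q - C (a q) * X ^ (q + k - 1) := by
  rcases hk.lt_or_eq with hk2 | hk1
  · refine ⟨fun q => ((q:ℝ) - k) * B.coeff 0, by simp, ?_, ?_⟩
    · intro q hq
      have : (k:ℝ) < q := by exact_mod_cast hq
      exact mul_ne_zero (by linarith) hB
    · intro q hq
      obtain ⟨j, rfl⟩ : ∃ j, k = j + 2 := ⟨k - 2, by omega⟩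
      obtain ⟨W, hW⟩ := Polynomial.powAddExpansion (1 : ℝ[X]) (X ^ (j + 1) * B) q
      obtain ⟨G, hG⟩ := X_dvd_sub B
      have hB' : B = C (B.coeff 0) + X * G := by rw [← hG]; ring
      have hPq : P ^ q = X ^ q * (1 + X ^ (j + 1) * B) ^ q := by
        rw [← mul_pow, hP]; ring
      rw [hPq, hW]
      have hd : derivative P = 1 + (C ((j:ℝ) + 2) * X ^ (j + 1) * B + X ^ (j + 2) * derivative B) := by
        rw [hP]
        simp only [derivative_add, derivative_X, derivative_mul, derivative_X_pow]
        push_cast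
        rfl
      rw [hd]
      have e1 : q + (j + 2) - 1 = q + j + 1 := by omega
      rw [e1]
      refine ⟨C ((q:ℝ) - (j + 2)) * G + X ^ j * B ^ 2 * W - derivative B, ?_⟩
      have hc : C (((q:ℝ) - ((j + 2 : ℕ):ℝ)) * B.coeff 0) = C ((q:ℝ) - (j + 2)) * (B - X * G) := by
        rw [← hG, C_mul]; push_cast; ring
      rw [hc]
      simp only [C_sub, C_add, one_pow, mul_one, map_natCast]
      ring
  · subst hk1
    have hl := h1 rfl
    refine ⟨fun q => (1 + B.coeff 0) ^ q - (1 + B.coeff 0), by simp, ?_, ?_⟩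
    · intro q hq h
      have h2 : (1 + B.coeff 0) ^ (q - 1) = 1 := by
        have h3 : (1 + B.coeff 0) ^ (q - 1) * (1 + B.coeff 0) = 1 * (1 + B.coeff 0) := by
          rw [← pow_succ, Nat.sub_add_cancel hq.le]; linarith
        exact mul_right_cancel₀ hl.ne' h3
      have h4 := (pow_eq_one_iff_of_nonneg hl.le (by omega)).1 h2
      exact hB (by linarith)
    · intro q hq
      have e1 : q + 1 - 1 = q := by omega
      rw [e1]
      have hd : derivative P = 1 + (B + X * derivative B) := by
        rw [hP]; simp
      have hPq : P ^ q = X ^ q * (1 + B) ^ q := by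
        rw [← mul_pow, hP]; ring
      obtain ⟨G, hG⟩ := X_dvd_sub ((1 + B) ^ q - (1 + B))
      have hc0 : ((1 + B) ^ q - (1 + B)).coeff 0 = (1 + B.coeff 0) ^ q - (1 + B.coeff 0) := by
        simp [coeff_zero_eq_eval_zero]
      rw [hc0] at hG
      refine ⟨G - derivative B, ?_⟩
      rw [hPq, hd, pow_succ, mul_assoc, mul_sub X, ← hG]
      ring

lemma exists_Y {k : ℕ} (hk : 1 ≤ k) {B P : ℝ[X]} (hP : P = X + X ^ k * B) (hB : B.coeff 0 ≠ 0)
    (h1 : k = 1 → 0 < 1 + B.coeff 0) (y : ℝ) (N : ℕ) :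
    ∃ Y : ℝ[X], X ^ k ∣ Y ∧ Y.coeff k = y ∧ X ^ (2 * k + N) ∣ Y.comp P - derivative P * Y := by
  obtain ⟨a, ha0, ha1, ha2⟩ := expand hk hP hB h1
  induction N with
  | zero =>
    refine ⟨C y * X ^ k, Dvd.intro_left _ rfl, by simp, ?_⟩
    have h := ha2 k hk
    rw [ha0] at h
    simp only [C_0, zero_mul, sub_zero] at h
    have e : (C y * X ^ k).comp P - derivative P * (C y * X ^ k) = C y * (P ^ k - derivative P * X ^ k) := by
      simp; ring
    rw [e, add_zero, two_mul]
    exact Dvd.dvd.mul_left h _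
  | succ N ih =>
    obtain ⟨Y, hY1, hY2, G, hG⟩ := ih
    have hq := ha2 (k + N + 1) (by omega)
    have han := ha1 (k + N + 1) (by omega)
    have e1 : k + N + 1 + k - 1 = 2 * k + N := by omega
    have e2 : k + N + 1 + k = 2 * k + (N + 1) := by omega
    rw [e1, e2] at hq
    obtain ⟨W, hW⟩ := X_dvd_sub G
    set b : ℝ := - G.coeff 0 / a (k + N + 1) with hb
    have hb' : C (G.coeff 0) = - (C b * C (a (k + N + 1))) := by
      rw [← C_mul, ← C_neg, hb]; congr 1; field_simp
    refine ⟨Y + C b * X ^ (k + N + 1), ?_, ?_, ?_⟩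
    · exact dvd_add hY1 (Dvd.dvd.mul_left (pow_dvd_pow _ (by omega)) _)
    · rw [coeff_add, hY2, coeff_C_mul, coeff_X_pow, if_neg (by omega)]; ring
    · have e : (Y + C b * X ^ (k + N + 1)).comp P - derivative P * (Y + C b * X ^ (k + N + 1))
        = X ^ (2 * k + (N + 1)) * W + C b * (P ^ (k + N + 1) - derivative P * X ^ (k + N + 1) - C (a (k + N + 1)) * X ^ (2 * k + N)) := by
        have : X ^ (2 * k + (N + 1)) * W = X ^ (2 * k + N) * (G - C (G.coeff 0)) := by
          rw [hW]; ring
        rw [this, mul_sub, ← hG, hb']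
        simp
        ring
      rw [e]
      exact dvd_add (dvd_mul_right _ _) (Dvd.dvd.mul_left hq _)

end PolL

/-- sum lemma -/
lemma sum_lemma {V g : ℝ → ℝ} {k m : ℕ} (hk : 1 ≤ k) {c C : ℝ} (hc : 0 < c)
    (hg : ∀ᶠ t in 𝓝[>] (0:ℝ), 0 < g t ∧ g t < t ∧ c * t ^ k ≤ t - g t)
    (hgc : ∀ᶠ t in 𝓝[>] (0:ℝ), ContinuousAt g t)
    (hV : ∀ᶠ t in 𝓝[>] (0:ℝ), |V (g t) - V t| ≤ C * t ^ (m + k - 1))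
    (hV0 : Tendsto V (𝓝[>] (0:ℝ)) (𝓝 0)) :
    V =O[𝓝[>] (0:ℝ)] fun t => t ^ m := by
  rcases Nat.eq_zero_or_pos m with rfl | hm
  · simp_rw [pow_zero]
    exact hV0.isBigO_one ℝ
  obtain ⟨δ, hδ, h⟩ := mem_nhdsGT_iff_exists_Ioo_subset.1 ((hg.and hgc).and hV)
  have hC : 0 ≤ C := by
    have ht : δ / 2 ∈ Ioo 0 δ := ⟨half_pos hδ, half_lt_self hδ⟩
    have h1 := (abs_nonneg _).trans (h ht).2
    by_contra hC
    push Not at hC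
    have := mul_neg_of_neg_of_pos hC (pow_pos ht.1 (m + k - 1))
    linarith
  refine Asymptotics.IsBigO.of_bound (C / c) ?_
  filter_upwards [Ioo_mem_nhdsGT hδ] with t ht
  have hit : ∀ n, g^[n] t ∈ Ioo 0 δ ∧ g^[n] t ≤ t := by
    intro n
    induction n with
    | zero => exact ⟨ht, le_rfl⟩
    | succ n ih =>
      rw [Function.iterate_succ_apply']
      obtain ⟨⟨⟨h1, h2, h3⟩, -⟩, -⟩ := h ih.1
      exact ⟨⟨h1, h2.trans ih.1.2⟩, h2.le.trans ih.2⟩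
  have hbd : ∀ n, |V (g^[n] t) - V t| ≤ C / c * (t ^ m - (g^[n] t) ^ m) := by
    intro n
    induction n with
    | zero => simp
    | succ n ih =>
      rw [Function.iterate_succ_apply']
      obtain ⟨hI, -⟩ := hit n
      set w := g^[n] t with hw
      obtain ⟨⟨⟨h1, h2, h3⟩, -⟩, h4⟩ := h hI
      have h5 : C * w ^ (m + k - 1) ≤ C / c * (w ^ m - (g w) ^ m) := by
        have h6 : w ^ (m - 1) * (w - g w) ≤ w ^ m - (g w) ^ m := by
          obtain ⟨j, rfl⟩ : ∃ j, m = j + 1 := ⟨m - 1, by omega⟩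
          have h7 : (g w) ^ j ≤ w ^ j := pow_le_pow_left₀ h1.le h2.le _
          have h8 := mul_le_mul_of_nonneg_right h7 h1.le
          simp only [Nat.add_sub_cancel, pow_succ]
          linarith
        have h9 : w ^ (m + k - 1) = w ^ (m - 1) * w ^ k := by
          rw [← pow_add]; congr 1; omega
        have h10 : c * w ^ (m + k - 1) ≤ w ^ m - g w ^ m := by
          rw [h9]
          have := mul_le_mul_of_nonneg_left h3 (pow_pos hI.1 (m - 1)).le
          linarith
        calc C * w ^ (m + k - 1) = C / c * (c * w ^ (m + k - 1)) := by field_simp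
          _ ≤ _ := mul_le_mul_of_nonneg_left h10 (by positivity)
      calc |V (g w) - V t| ≤ |V (g w) - V w| + |V w - V t| := abs_sub_le _ _ _
        _ ≤ _ := by linarith
  -- the iterates converge to 0
  have hanti : Antitone fun n => g^[n] t := by
    refine antitone_nat_of_succ_le fun n => ?_
    rw [Function.iterate_succ_apply']
    exact (h (hit n).1).1.1.2.1.le
  have hbb : BddBelow (range fun n => g^[n] t) := ⟨0, by rintro _ ⟨n, rfl⟩; exact (hit n).1.1.le⟩
  have hlim := tendsto_atTop_ciInf hanti hbb
  set e := ⨅ n, g^[n] t with he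
  have he0 : 0 ≤ e := le_ciInf fun n => (hit n).1.1.le
  have he1 : e < δ := (ciInf_le hbb 0).trans_lt ht.2
  have hez : e = 0 := by
    by_contra hne
    have hI : e ∈ Ioo 0 δ := ⟨lt_of_le_of_ne he0 (Ne.symm hne), he1⟩
    obtain ⟨⟨⟨h1, h2, h3⟩, hco⟩, -⟩ := h hI
    have h5 := (hco.tendsto.comp hlim)
    have h6 := hlim.comp (tendsto_add_atTop_nat 1)
    have h7 : (fun n => g^[n] t) ∘ (fun n => n + 1) = g ∘ fun n => g^[n] t := by
      funext n; simp [Function.iterate_succ_apply']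
    rw [h7] at h6
    have := tendsto_nhds_unique h5 h6
    linarith
  rw [hez] at hlim
  have hlim' : Tendsto (fun n => g^[n] t) atTop (𝓝[>] 0) :=
    tendsto_nhdsWithin_iff.2 ⟨hlim, Eventually.of_forall fun n => (hit n).1.1⟩
  have h1 : Tendsto (fun n => |V (g^[n] t) - V t|) atTop (𝓝 |0 - V t|) :=
    ((hV0.comp hlim').sub_const _).abs
  have h2 : |0 - V t| ≤ C / c * t ^ m := by
    refine le_of_tendsto h1 (Eventually.of_forall fun n => (hbd n).trans ?_)
    refine mul_le_mul_of_nonneg_left ?_ (by positivity)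
    have := pow_pos (hit n).1.1 m
    linarith
  rw [zero_sub, abs_neg] at h2
  rw [Real.norm_eq_abs, Real.norm_eq_abs, abs_of_pos (pow_pos ht.1 m)]
  exact h2

/-- indicator lemma -/
lemma ind_lemma {n : ℕ} {z : ℝ → ℝ} {δ : ℝ} (hδ : 0 < δ) (hz : ContDiffOn ℝ n z (Ioo 0 δ)) (hS : SC (n + 1) n z) :
    ContDiffOn ℝ n (indicator (Ioi 0) z) (Ioo (-δ) δ) := by
  have hev1 : ∀ {t : ℝ}, 0 < t → ∀ u : ℝ → ℝ, indicator (Ioi 0) u =ᶠ[𝓝 t] u := by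
    intro t ht u
    filter_upwards [Ioi_mem_nhds ht] with s hs
    exact indicator_of_mem hs u
  have hev2 : ∀ {t : ℝ}, t < 0 → ∀ u : ℝ → ℝ, indicator (Ioi 0) u =ᶠ[𝓝 t] fun _ => 0 := by
    intro t ht u
    filter_upwards [Iio_mem_nhds ht] with s hs
    exact indicator_of_notMem (by simpa using le_of_lt hs) u
  induction n generalizing z with
  | zero =>
    rw [Nat.cast_zero, contDiffOn_zero] at hz ⊢
    intro t ht
    refine ContinuousAt.continuousWithinAt ?_
    rcases lt_trichotomy t 0 with h | rfl | h
    · exact (continuousAt_congr (hev2 h z)).2 continuousAt_const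
    · have h1 : Tendsto z (𝓝[>] 0) (𝓝 0) := by
        refine hS.base.trans_tendsto ?_
        have : Tendsto (fun t : ℝ => t ^ (0 + 1)) (𝓝 0) (𝓝 (0 ^ (0 + 1))) := (continuous_pow _).tendsto _
        simpa using this.mono_left nhdsWithin_le_nhds
      rw [ContinuousAt, indicator_of_notMem (by simp)]
      have h2 : Tendsto (indicator (Ioi 0) z) (𝓝[≤] 0 ⊔ 𝓝[>] 0) (𝓝 0) := ?_
      · rwa [nhdsLE_sup_nhdsGT] at h2
      refine Tendsto.sup ?_ ?_
      · refine tendsto_const_nhds.congr' ?_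
        filter_upwards [self_mem_nhdsWithin] with s hs
        exact (indicator_of_notMem (by simpa using hs) z).symm
      · refine h1.congr' ?_
        filter_upwards [self_mem_nhdsWithin] with s hs
        exact (indicator_of_mem hs z).symm
    · exact (continuousAt_congr (hev1 h z)).2 (hz.continuousAt (Ioo_mem_nhds h ht.2))
  | succ n ih =>
    rw [show ((n + 1 : ℕ) : WithTop ℕ∞) = (n : WithTop ℕ∞) + 1 by norm_cast,
      contDiffOn_succ_iff_deriv_of_isOpen isOpen_Ioo] at hz ⊢
    have hder : ∀ t ∈ Ioo (-δ) δ, HasDerivAt (indicator (Ioi 0) z) (indicator (Ioi 0) (deriv z) t) t := by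
      intro t ht
      rcases lt_trichotomy t 0 with h | rfl | h
      · rw [indicator_of_notMem (by simpa using h.le)]
        exact (hasDerivAt_const t (0:ℝ)).congr_of_eventuallyEq (hev2 h z)
      · rw [indicator_of_notMem (by simp)]
        have hb := hS.base
        rw [hasDerivAt_iff_isLittleO]
        simp only [sub_zero, smul_zero]
        rw [indicator_of_notMem (by simp)]
        simp only [sub_zero]
        rw [← nhdsLE_sup_nhdsGT]
        refine Asymptotics.IsLittleO.sup ?_ ?_
        · refine (Asymptotics.isLittleO_zero _ _).congr' ?_ EventuallyEq.rfl
          filter_upwards [self_mem_nhdsWithin] with s hs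
          exact (indicator_of_notMem (by simpa using hs) z).symm
        · have h1 : (fun t : ℝ => t ^ (n + 1 + 1)) =o[𝓝[>] 0] fun t : ℝ => t := by
            have := (Asymptotics.isLittleO_pow_id (𝕜 := ℝ) (n := n + 1 + 1) (by omega)).mono (nhdsWithin_le_nhds (s := Ioi (0:ℝ)))
            exact this
          refine (hb.trans_isLittleO h1).congr' ?_ EventuallyEq.rfl
          filter_upwards [self_mem_nhdsWithin] with s hs
          exact (indicator_of_mem hs z).symm
      · rw [indicator_of_mem (show t ∈ Ioi (0:ℝ) from h)]
        exact ((hz.1.differentiableAt (Ioo_mem_nhds h ht.2)).hasDerivAt).congr_of_eventuallyEq (hev1 h z)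
    refine ⟨fun t ht => (hder t ht).differentiableAt.differentiableWithinAt, by simp, ?_⟩
    refine (ih hz.2.2 hS.2.2).congr fun t ht => (hder t ht).deriv

lemma poly_cd (Y : Polynomial ℝ) {n : WithTop ℕ∞} : ContDiff ℝ n fun t => Y.eval t := by
  simp_rw [Polynomial.eval_eq_sum_range]
  fun_prop

lemma cd_deriv {n : ℕ} {u : ℝ → ℝ} {t : ℝ} (h : ContDiffAt ℝ ((n + 1 : ℕ) : WithTop ℕ∞) u t) : ContDiffAt ℝ n (deriv u) t := by
  have h1 : ContDiffAt ℝ n (fderiv ℝ u) t := h.fderiv_right (by norm_cast)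
  exact h1.clm_apply contDiffAt_const

lemma cd_diff {n j : ℕ} {u : ℝ → ℝ} {t : ℝ} (h : ContDiffAt ℝ n u t) (hj : j < n) :
    DifferentiableAt ℝ (iteratedDeriv j u) t := by
  induction j generalizing n u with
  | zero =>
    rw [iteratedDeriv_zero]
    refine h.differentiableAt ?_
    exact_mod_cast hj.ne'
  | succ j ih =>
    rw [iteratedDeriv_succ']
    obtain ⟨k, rfl⟩ : ∃ k, n = k + 1 := ⟨n - 1, by omega⟩
    exact ih (cd_deriv h) (by omega)

lemma SC.of_iter {m n : ℕ} {u : ℝ → ℝ} (h : ∀ j ≤ n, iteratedDeriv j u =O[𝓝[>] (0:ℝ)] fun t => t ^ (m - j))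
    (hd : ∀ j < n, ∀ᶠ t in 𝓝[>] (0:ℝ), DifferentiableAt ℝ (iteratedDeriv j u) t) : SC m n u := by
  induction n generalizing m u with
  | zero =>
    have := h 0 le_rfl
    rw [iteratedDeriv_zero] at this
    exact this
  | succ n ih =>
    refine ⟨by simpa using h 0 (by omega), by simpa using hd 0 (by omega), ih ?_ ?_⟩
    · intro j hj
      have := h (j + 1) (by omega)
      rw [iteratedDeriv_succ'] at this
      rwa [show m - 1 - j = m - (j + 1) by omega]
    · intro j hj
      have := hd (j + 1) (by omega)
      rwa [iteratedDeriv_succ'] at this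

lemma SC.iter {m n j : ℕ} {u : ℝ → ℝ} (h : SC m n u) (hj : j ≤ n) : SC (m - j) (n - j) (iteratedDeriv j u) := by
  induction j generalizing m n u with
  | zero => simpa using h
  | succ j ih =>
    rw [iteratedDeriv_succ']
    have := ih (h.deriv' (by omega)) (by omega)
    rwa [show m - 1 - j = m - (j + 1) by omega, show n - 1 - j = n - (j + 1) by omega] at this

structure Side (r k : ℕ) (f g X : ℝ → ℝ) (P Y : Polynomial ℝ) (y c : ℝ) : Prop where
  hr : 2 ≤ r
  hk : 1 ≤ k
  hkr : k ≤ r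
  fP : SC r r (fun t => f t - P.eval t)
  Pk : Polynomial.X ^ k ∣ P - Polynomial.X
  fd : ∃ c0 > 0, ∀ᶠ t in 𝓝[>] (0:ℝ), c0 ≤ deriv f t
  Yk : Polynomial.X ^ k ∣ Y
  Yc : Y.coeff k = y
  y0 : y ≠ 0
  YP : Polynomial.X ^ (r + k - 1) ∣ Y.comp P - Polynomial.derivative P * Y
  XC : ∀ᶠ t in 𝓝[>] (0:ℝ), ContDiffAt ℝ ((r - 1 : ℕ) : WithTop ℕ∞) X t
  eq : ∀ᶠ t in 𝓝[>] (0:ℝ), X (f t) = deriv f t * X t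
  lim0 : Tendsto (fun t => X t / t ^ k) (𝓝[>] (0:ℝ)) (𝓝 y)
  lim1 : Tendsto (deriv X) (𝓝[>] (0:ℝ)) (𝓝 c)
  limj : ∀ j, j + 2 ≤ r - 1 → Tendsto (fun t => X t ^ (j + 1) * iteratedDeriv (j + 2) X t) (𝓝[>] (0:ℝ)) (𝓝 0)
  fmap : Tendsto f (𝓝[>] (0:ℝ)) (𝓝[>] (0:ℝ))
  hg : ∃ c1 > 0, ∀ᶠ t in 𝓝[>] (0:ℝ), 0 < g t ∧ g t < t ∧ c1 * t ^ k ≤ t - g t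
  hgc : ∀ᶠ t in 𝓝[>] (0:ℝ), ContinuousAt g t
  alt : (∀ᶠ t in 𝓝[>] (0:ℝ), g t = f t) ∨ (∀ᶠ t in 𝓝[>] (0:ℝ), f (g t) = t)

namespace Side
variable {r k : ℕ} {f g X : ℝ → ℝ} {P Y : Polynomial ℝ} {y c : ℝ}

/-- the remainder -/
def Z (X : ℝ → ℝ) (Y : Polynomial ℝ) : ℝ → ℝ := fun t => X t - Y.eval t

def R (f X : ℝ → ℝ) (Y : Polynomial ℝ) : ℕ → ℝ → ℝ
  | 0 => fun t => Y.eval t - Y.eval (f t) * (deriv f t)⁻¹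
  | j + 1 => fun t => deriv (R f X Y j) t - ((j:ℝ) - 1) *
      (deriv (deriv f) t * (deriv f t)⁻¹ * (iteratedDeriv j (Z X Y) t + R f X Y j t))


lemma g0 (S : Side r k f g X P Y y c) : Tendsto g (𝓝[>] (0:ℝ)) (𝓝[>] (0:ℝ)) := by
  obtain ⟨c1, _, h⟩ := S.hg
  refine tendsto_nhdsWithin_iff.2 ⟨?_, h.mono fun t ht => ht.1⟩
  refine tendsto_of_tendsto_of_tendsto_of_le_of_le' tendsto_const_nhds
    (tendsto_id.mono_left nhdsWithin_le_nhds) (h.mono fun t ht => ht.1.le) (h.mono fun t ht => ht.2.1.le)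

lemma X_theta (S : Side r k f g X P Y y c) : X =Θ[𝓝[>] (0:ℝ)] fun t => t ^ k :=
  (Asymptotics.isTheta_of_div_tendsto_nhds_ne_zero S.lim0 S.y0).symm

lemma X_ne (S : Side r k f g X P Y y c) : ∀ᶠ t in 𝓝[>] (0:ℝ), X t ≠ 0 := by
  filter_upwards [S.lim0.eventually_ne S.y0] with t ht h
  exact ht (by rw [h, zero_div])

lemma X_zero (S : Side r k f g X P Y y c) : Tendsto X (𝓝[>] (0:ℝ)) (𝓝 0) := by
  refine S.X_theta.1.trans_tendsto ?_
  have : Tendsto (fun t : ℝ => t ^ k) (𝓝 0) (𝓝 (0 ^ k)) := (continuous_pow _).tendsto _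
  rw [zero_pow (by have := S.hk; omega)] at this
  exact this.mono_left nhdsWithin_le_nhds

lemma f_id (S : Side r k f g X P Y y c) : SC k r fun t => f t - t := by
  refine ((S.fP.mono S.hkr).add (SC.poly r S.Pk)).congr (Eventually.of_forall fun t => ?_)
  simp

lemma f_sc (S : Side r k f g X P Y y c) : SC 1 r f :=
  ((S.f_id.mono S.hk).add (SC.id r)).congr (Eventually.of_forall fun t => by simp)

lemma f_diff (S : Side r k f g X P Y y c) : ∀ᶠ t in 𝓝[>] (0:ℝ), DifferentiableAt ℝ f t := S.f_sc.diff (by have := S.hr; omega)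

lemma f1_sc (S : Side r k f g X P Y y c) : SC 0 (r - 1) (deriv f) := S.f_sc.deriv' (by have := S.hr; omega)

lemma f1_diff (S : Side r k f g X P Y y c) : ∀ᶠ t in 𝓝[>] (0:ℝ), DifferentiableAt ℝ (deriv f) t := S.f1_sc.diff (by have := S.hr; omega)

lemma f1_inv (S : Side r k f g X P Y y c) : SC 0 (r - 1) (fun t => (deriv f t)⁻¹) := by
  obtain ⟨c0, h0, h⟩ := S.fd
  exact S.f1_sc.inv h0 h

lemma f1_ne (S : Side r k f g X P Y y c) : ∀ᶠ t in 𝓝[>] (0:ℝ), deriv f t ≠ 0 := by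
  obtain ⟨c0, h0, h⟩ := S.fd
  filter_upwards [h] with t ht using (h0.trans_le ht).ne'

lemma f2_sc (S : Side r k f g X P Y y c) : SC (k - 2) (r - 2) (deriv (deriv f)) := by
  have hr := S.hr
  have h1 : SC (k - 1) (r - 1) (fun t => deriv f t - 1) := by
    refine (S.f_id.deriv' (by omega)).congr ?_
    filter_upwards [S.f_diff] with t ht
    rw [deriv_fun_sub ht differentiableAt_fun_id, deriv_id'']
  have h2 := h1.deriv' (by omega)
  rw [show k - 1 - 1 = k - 2 by omega, show r - 1 - 1 = r - 2 by omega] at h2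
  refine h2.congr (Eventually.of_forall fun t => ?_)
  simp [deriv_sub_const]

lemma P1 (S : Side r k f g X P Y y c) : Polynomial.X ^ 1 ∣ P := by
  have h := (pow_dvd_pow Polynomial.X S.hk).trans S.Pk
  have h2 := dvd_add h (show (Polynomial.X : Polynomial ℝ) ^ 1 ∣ Polynomial.X by simp)
  simpa using h2

lemma R0 (S : Side r k f g X P Y y c) : SC (r + k - 1) (r - 1) (R f X Y 0) := by
  have hr := S.hr
  have hk := S.hk
  have hd : SC (r - 1) (r - 1) fun t => deriv f t - (Polynomial.derivative P).eval t := by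
    refine (S.fP.deriv' (by omega)).congr ?_
    filter_upwards [S.f_diff] with t ht
    rw [deriv_fun_sub ht P.differentiableAt, Polynomial.deriv]
  have h1 : SC (r + k - 1) (r - 1) fun t => Y.eval t * (deriv f t - (Polynomial.derivative P).eval t) :=
    ((SC.poly (r - 1) S.Yk).mul hd).mono (by omega)
  have h2 : SC (r + k - 1) (r - 1) fun t => Y.eval (f t) - Y.eval (P.eval t) :=
    (SC.comp_sub S.f_sc (SC.poly r S.P1) S.fP S.Yk).mono' (by omega)
  have h3 := SC.poly (r - 1) S.YP
  refine (((h1.sub h2).sub h3).mul S.f1_inv).congr ?_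
  filter_upwards [S.f1_ne] with t ht
  simp only [R, Polynomial.eval_sub, Polynomial.eval_comp, Polynomial.eval_mul]
  field_simp
  ring

lemma ZC (S : Side r k f g X P Y y c) : ∀ᶠ t in 𝓝[>] (0:ℝ), ContDiffAt ℝ ((r - 1 : ℕ) : WithTop ℕ∞) (Z X Y) t := by
  filter_upwards [S.XC] with t ht
  exact ht.sub (poly_cd Y).contDiffAt

lemma Rsc (S : Side r k f g X P Y y c) {J : ℕ} (hJ : J ≤ r - 1) (hZ : J = 0 ∨ SC r (J - 1) (Z X Y)) :
    ∀ j ≤ J, SC (r + k - 1 - j) (J - j) (R f X Y j) := by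
  have hr := S.hr
  have hk := S.hk
  intro j hj
  induction j with
  | zero => simpa using S.R0.mono' hJ
  | succ j ih =>
    have hZ' : SC r (J - 1) (Z X Y) := hZ.resolve_left (by omega)
    have h0 := ih (by omega)
    have h1 := h0.deriv' (by omega)
    have h2 := hZ'.iter (j := j) (by omega)
    have h3 : SC (r - j) (J - (j + 1)) (fun t => iteratedDeriv j (Z X Y) t + R f X Y j t) :=
      (h2.mono' (by omega)).add ((h0.mono' (by omega)).mono (by omega))
    have h4 := ((S.f2_sc.mono' (n' := J - (j + 1)) (by omega)).mul (S.f1_inv.mono' (by omega))).mul h3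
    exact ((h1.mono' (by omega)).mono (by omega)).sub (SC.cmul ((j:ℝ) - 1) (h4.mono (by omega)))

lemma ident (S : Side r k f g X P Y y c) {J : ℕ} (hJ : J ≤ r - 1) (hZ : J = 0 ∨ SC r (J - 1) (Z X Y)) :
    ∀ j ≤ J, ∀ᶠ t in 𝓝[>] (0:ℝ), deriv f t ^ j * iteratedDeriv j (Z X Y) (f t)
      = deriv f t * (iteratedDeriv j (Z X Y) t + R f X Y j t) := by
  intro j hj
  induction j with
  | zero =>
    filter_upwards [S.f1_ne, S.eq] with t h1 h2
    simp only [iteratedDeriv_zero, Z, R, h2, pow_zero]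
    field_simp
    ring
  | succ j ih =>
    have h0 := ih (by omega)
    have hR := (S.Rsc hJ hZ j (by omega)).diff (by omega)
    filter_upwards [S.f1_ne, ev_nhds h0, h0, hR, S.f_diff, S.f1_diff, S.ZC, S.fmap.eventually S.ZC] with t hne h1 h1' hR hf hf1 hz hzf
    have dz := (cd_diff hz (j := j) (by omega)).hasDerivAt
    have dzf := (cd_diff hzf (j := j) (by omega)).hasDerivAt
    have e1 := (hf1.hasDerivAt.pow j).mul (dzf.comp t hf.hasDerivAt)
    have e2 := hf1.hasDerivAt.mul (dz.add hR.hasDerivAt)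
    have e3 := (e1.congr_of_eventuallyEq (h1.mono fun t ht => ht.symm)).unique e2
    simp only [Pi.pow_apply, Function.comp_apply, Pi.add_apply, ← iteratedDeriv_succ] at e3
    have hN : (j:ℝ) * deriv f t ^ (j - 1) * deriv f t = j * deriv f t ^ j := by
      cases j with
      | zero => simp
      | succ i => simp [pow_succ, mul_assoc]
    simp only [R]
    have key : (j:ℝ) * deriv f t ^ (j - 1) * deriv (deriv f) t * iteratedDeriv j (Z X Y) (f t)
        = j * deriv (deriv f) t * (iteratedDeriv j (Z X Y) t + R f X Y j t) := by
      have : deriv f t * ((j:ℝ) * deriv f t ^ (j - 1) * deriv (deriv f) t * iteratedDeriv j (Z X Y) (f t))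
        = deriv f t * (j * deriv (deriv f) t * (iteratedDeriv j (Z X Y) t + R f X Y j t)) := by
        linear_combination deriv (deriv f) t * iteratedDeriv j (Z X Y) (f t) * hN + j * deriv (deriv f) t * h1'
      exact mul_left_cancel₀ hne this
    rw [key] at e3
    rw [pow_succ]
    field_simp
    linear_combination e3

lemma Y_lim (S : Side r k f g X P Y y c) : Tendsto (fun t => Y.eval t / t ^ k) (𝓝[>] (0:ℝ)) (𝓝 y) := by
  obtain ⟨B, hB⟩ := S.Yk
  have h1 : B.eval 0 = y := by
    rw [← S.Yc, hB, Polynomial.coeff_X_pow_mul', if_pos le_rfl, Nat.sub_self, Polynomial.coeff_zero_eq_eval_zero]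
  have h2 : Tendsto (fun t => B.eval t) (𝓝[>] (0:ℝ)) (𝓝 y) := by
    rw [← h1]; exact B.continuous.continuousWithinAt
  refine h2.congr' ?_
  filter_upwards [self_mem_nhdsWithin] with t ht
  have : t ^ k ≠ 0 := pow_ne_zero _ (ne_of_gt ht)
  rw [hB]; simp; field_simp

lemma lhop (S : Side r k f g X P Y y c) {u : ℝ → ℝ} {c : ℝ} (hd : ∀ᶠ t in 𝓝[>] (0:ℝ), DifferentiableAt ℝ u t)
    (h0 : Tendsto u (𝓝[>] (0:ℝ)) (𝓝 0)) (h1 : Tendsto (deriv u) (𝓝[>] (0:ℝ)) (𝓝 c)) :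
    Tendsto (fun t => u t / t) (𝓝[>] (0:ℝ)) (𝓝 c) := by
  refine HasDerivAt.lhopital_zero_nhdsGT (hd.mono fun t ht => ht.hasDerivAt) (g' := fun _ => 1)
    (Eventually.of_forall fun t => hasDerivAt_id t) (by simp) h0 (tendsto_id.mono_left nhdsWithin_le_nhds) (by simpa using h1)

lemma c_eq (S : Side r k f g X P Y y c) : c = (Polynomial.derivative Y).eval 0 := by
  have hr := S.hr
  have h1 : Tendsto (fun t => X t / t) (𝓝[>] (0:ℝ)) (𝓝 c) := S.lhop
    (S.XC.mono fun t ht => ht.differentiableAt (by exact_mod_cast (by omega : r - 1 ≠ 0))) S.X_zero S.lim1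
  have hY0 : Y.eval 0 = 0 := by
    obtain ⟨B, hB⟩ := S.Yk
    have hk := S.hk
    rw [hB]; simp; left; omega
  have h2 : Tendsto (fun t => Y.eval t / t) (𝓝[>] (0:ℝ)) (𝓝 ((Polynomial.derivative Y).eval 0)) := by
    refine S.lhop (Eventually.of_forall fun t => Y.differentiableAt) ?_ ?_
    · have := Y.continuous.tendsto 0
      rw [hY0] at this
      exact this.mono_left nhdsWithin_le_nhds
    · have := (Polynomial.derivative Y).continuous.tendsto 0
      refine (this.mono_left nhdsWithin_le_nhds).congr fun t => ?_
      rw [Polynomial.deriv]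
  -- `X / Y → 1`
  have h3 : Tendsto (fun t => (X t / t ^ k - Y.eval t / t ^ k) * t ^ (k - 1)) (𝓝[>] (0:ℝ)) (𝓝 ((y - y) * 0 ^ (k - 1))) :=
    (S.lim0.sub S.Y_lim).mul (((continuous_pow (k - 1)).tendsto (0:ℝ)).mono_left nhdsWithin_le_nhds)
  rw [sub_self, zero_mul] at h3
  have h4 : Tendsto (fun t => X t / t - Y.eval t / t) (𝓝[>] (0:ℝ)) (𝓝 0) := by
    refine h3.congr' ?_
    filter_upwards [self_mem_nhdsWithin] with t ht
    have ht0 : t ≠ 0 := ne_of_gt ht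
    obtain ⟨j, rfl⟩ : ∃ j, k = j + 1 := ⟨k - 1, by have := S.hk; omega⟩
    simp only [Nat.add_sub_cancel, pow_succ]
    field_simp
  have := tendsto_nhds_unique (h1.sub h2) h4
  linarith

lemma V_zero (S : Side r k f g X P Y y c) {J : ℕ} (hJ : J ≤ r - 1) :
    Tendsto (fun t => X t ^ J * iteratedDeriv J (Z X Y) t / X t) (𝓝[>] (0:ℝ)) (𝓝 0) := by
  have hr := S.hr
  have hYc : ∀ j, Tendsto (iteratedDeriv j fun t => Y.eval t) (𝓝[>] (0:ℝ)) (𝓝 (iteratedDeriv j (fun t => Y.eval t) 0)) := by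
    intro j
    have h := ((poly_cd Y (n := (j : WithTop ℕ∞))).continuous_iteratedDeriv j le_rfl).tendsto (0:ℝ)
    exact h.mono_left nhdsWithin_le_nhds
  have hsub : ∀ j ≤ r - 1, ∀ᶠ t in 𝓝[>] (0:ℝ), iteratedDeriv j (Z X Y) t = iteratedDeriv j X t - iteratedDeriv j (fun t => Y.eval t) t := by
    intro j hj
    filter_upwards [S.XC] with t ht
    exact iteratedDeriv_fun_sub (ht.of_le (by exact_mod_cast hj)) (poly_cd Y).contDiffAt
  rcases J with _ | _ | j
  · have h1 := (S.Y_lim.div S.lim0 S.y0).const_sub 1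
    rw [div_self S.y0, sub_self] at h1
    refine h1.congr' ?_
    filter_upwards [self_mem_nhdsWithin, S.X_ne] with t ht hX
    have : t ^ k ≠ 0 := pow_ne_zero _ (ne_of_gt ht)
    simp only [iteratedDeriv_zero, Z, Pi.div_apply]
    field_simp
  · have h1 := S.lim1.sub (hYc 1)
    rw [iteratedDeriv_one, Polynomial.deriv, ← S.c_eq, sub_self] at h1
    refine h1.congr' ?_
    filter_upwards [hsub 1 hJ, S.X_ne] with t ht hX
    rw [zero_add, ht, iteratedDeriv_one, iteratedDeriv_one]
    field_simp
  · have h1 := (S.limj j hJ).sub ((S.X_zero.pow (j + 1)).mul (hYc (j + 2)))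
    rw [zero_pow (by omega), zero_mul, sub_zero] at h1
    refine h1.congr' ?_
    filter_upwards [hsub (j + 2) hJ, S.X_ne] with t ht hX
    rw [show j + 1 + 1 = j + 2 by omega, ht, pow_succ _ (j + 1)]
    field_simp

theorem main (S : Side r k f g X P Y y c) : ∀ J ≤ r - 1, SC r J (Z X Y) := by
  have hr := S.hr
  have hk := S.hk
  have hkr := S.hkr
  intro J hJ
  induction J using Nat.strong_induction_on with
  | _ J IH =>
  have hZ : J = 0 ∨ SC r (J - 1) (Z X Y) := by
    rcases Nat.eq_zero_or_pos J with h | h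
    · exact Or.inl h
    · exact Or.inr (IH (J - 1) (by omega) (by omega))
  suffices hmain : iteratedDeriv J (Z X Y) =O[𝓝[>] (0:ℝ)] fun t => t ^ (r - J) by
    refine SC.of_iter ?_ ?_
    · intro j hj
      rcases hj.lt_or_eq with h | rfl
      · have := ((IH j h (by omega)).iter le_rfl).base
        exact this
      · exact hmain
    · intro j hj
      filter_upwards [S.ZC] with t ht using cd_diff ht (by omega)
  have hRJ := (S.Rsc hJ hZ J le_rfl).base
  have hid := S.ident hJ hZ J le_rfl
  obtain ⟨M, hM⟩ : ∃ M, M + k + J = k * J + r := by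
    refine ⟨k * J + r - k - J, ?_⟩
    rcases Nat.eq_zero_or_pos J with rfl | h
    · simp; omega
    · have : k ≤ k * J := Nat.le_mul_of_pos_right k h
      omega
  set V : ℝ → ℝ := fun t => X t ^ J * iteratedDeriv J (Z X Y) t / X t with hVdef
  have hdiff : ∀ᶠ t in 𝓝[>] (0:ℝ), V (f t) - V t = X t ^ J * R f X Y J t / X t := by
    filter_upwards [hid, S.eq, S.f1_ne, S.X_ne] with t h1 h2 h3 h4
    simp only [hVdef, h2, mul_pow]
    field_simp
    linear_combination h1
  have hO : (fun t => V (f t) - V t) =O[𝓝[>] (0:ℝ)] fun t => t ^ (M + k - 1) := by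
    have h1 := ((S.X_theta.1.pow J).mul hRJ).mul S.X_theta.inv.1
    refine h1.congr' ?_ ?_
    · filter_upwards [hdiff] with t ht
      rw [ht, div_eq_mul_inv]
    · filter_upwards [self_mem_nhdsWithin] with t ht
      have ht0 : t ≠ 0 := ne_of_gt ht
      have : t ^ k ≠ 0 := pow_ne_zero _ ht0
      field_simp
      rw [← pow_mul, ← pow_add, ← pow_add]
      congr 1
      omega
  obtain ⟨C, hC0, hC⟩ := hO.exists_pos
  rw [Asymptotics.IsBigOWith] at hC
  obtain ⟨c1, hc1, hg⟩ := S.hg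
  have hVO : V =O[𝓝[>] (0:ℝ)] fun t => t ^ M := by
    refine sum_lemma (C := C) hk hc1 hg S.hgc ?_ (S.V_zero hJ)
    rcases S.alt with ha | ha
    · filter_upwards [hC, ha, self_mem_nhdsWithin] with t h1 h2 h3
      rw [h2]
      rw [Real.norm_eq_abs, Real.norm_eq_abs, abs_of_pos (pow_pos (show 0 < t from h3) (M + k - 1))] at h1
      exact h1
    · filter_upwards [S.g0.eventually hC, ha, hg] with t h1 h2 h3
      rw [h2, Real.norm_eq_abs, Real.norm_eq_abs, abs_of_pos (pow_pos h3.1 (M + k - 1))] at h1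
      rw [abs_sub_comm]
      refine h1.trans (mul_le_mul_of_nonneg_left ?_ hC0.le)
      exact pow_le_pow_left₀ h3.1.le h3.2.1.le _
  have h1 := (hVO.mul S.X_theta.1).mul (S.X_theta.pow J).inv.1
  refine h1.congr' ?_ ?_
  · filter_upwards [S.X_ne] with t ht
    have := pow_ne_zero J ht
    simp only [hVdef]
    field_simp
  · filter_upwards [self_mem_nhdsWithin] with t ht
    have ht0 : t ≠ 0 := ne_of_gt ht
    have : (t ^ k) ^ J ≠ 0 := pow_ne_zero _ (pow_ne_zero _ ht0)
    field_simp
    rw [← pow_mul, ← pow_add, ← pow_add]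
    congr 1
    omega

end Side

lemma side_interior {p σ : ℝ} (hσ : σ = 1 ∨ σ = -1) (hσI : ∀ᶠ s in 𝓝[>] (0:ℝ), p + σ * s ∈ Icc (0:ℝ) 1)
    (hpI : p ∈ Icc (0:ℝ) 1) : ∀ᶠ s in 𝓝[>] (0:ℝ), p + σ * s ∈ Ioo (0:ℝ) 1 := by
  obtain ⟨δ, hδ, h⟩ := mem_nhdsGT_iff_exists_Ioo_subset.1 hσI
  have hδ : 0 < δ := hδ
  filter_upwards [Ioo_mem_nhdsGT hδ] with s hs
  have h1 : p + σ * ((s + δ) / 2) ∈ Icc (0:ℝ) 1 := h ⟨by linarith [hs.1], by linarith [hs.2]⟩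
  obtain ⟨hs1, hs2⟩ := hs
  obtain ⟨a1, a2⟩ := h1
  obtain ⟨b1, b2⟩ := hpI
  rcases hσ with rfl | rfl <;> constructor <;> linarith

lemma side_tendsto {p σ : ℝ} (hσI : ∀ᶠ s in 𝓝[>] (0:ℝ), p + σ * s ∈ Icc (0:ℝ) 1) :
    Tendsto (fun s => p + σ * s) (𝓝[>] (0:ℝ)) (𝓝[Icc (0:ℝ) 1] p) := by
  refine tendsto_nhdsWithin_iff.2 ⟨?_, hσI⟩
  have : Tendsto (fun s : ℝ => p + σ * s) (𝓝 0) (𝓝 (p + σ * 0)) := by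
    apply Continuous.tendsto; fun_prop
  rw [mul_zero, add_zero] at this
  exact this.mono_left nhdsWithin_le_nhds

lemma tay_side {p σ : ℝ} (hσ : σ = 1 ∨ σ = -1) (hpI : p ∈ Icc (0:ℝ) 1)
    (hσI : ∀ᶠ s in 𝓝[>] (0:ℝ), p + σ * s ∈ Icc (0:ℝ) 1) {n : ℕ} {u : ℝ → ℝ}
    (hu : ContDiffOn ℝ n u (Icc (0:ℝ) 1)) :
    SC n n fun t => u (p + σ * t) - (ZdActionCr.Tay n u p).eval (σ * t) := by
  have hs := side_interior hσ hσI hpI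
  have hbO : ∀ {n : ℕ} {u : ℝ → ℝ}, ContDiffOn ℝ n u (Icc (0:ℝ) 1) →
      (fun t => u (p + σ * t) - (ZdActionCr.Tay n u p).eval (σ * t)) =O[𝓝[>] (0:ℝ)] fun t => t ^ n := by
    intro n u hu
    have h1 := ((ZdActionCr.Tay_isLittleO hpI hu).comp_tendsto (side_tendsto hσI)).isBigO
    have h2 : (fun t : ℝ => (σ * t) ^ n) =O[𝓝[>] (0:ℝ)] fun t => t ^ n := by
      simp_rw [mul_pow]
      exact Asymptotics.isBigO_const_mul_self _ _ _
    refine Asymptotics.IsBigO.trans ?_ h2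
    simpa [Function.comp_def] using h1
  induction n generalizing u with
  | zero => exact hbO hu
  | succ n ih =>
    have hder : ∀ᶠ t in 𝓝[>] (0:ℝ), HasDerivAt (fun t => u (p + σ * t) - (ZdActionCr.Tay (n + 1) u p).eval (σ * t))
        (σ * (derivWithin u (Icc (0:ℝ) 1) (p + σ * t) - (ZdActionCr.Tay n (derivWithin u (Icc (0:ℝ) 1)) p).eval (σ * t))) t := by
      filter_upwards [hs] with t ht
      have hn : Icc (0:ℝ) 1 ∈ 𝓝 (p + σ * t) := Icc_mem_nhds ht.1 ht.2
      have h1 : HasDerivAt u (derivWithin u (Icc (0:ℝ) 1) (p + σ * t)) (p + σ * t) :=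
        ((hu.differentiableOn (by norm_cast)) _ (Ioo_subset_Icc_self ht)).hasDerivWithinAt.hasDerivAt hn
      have ha : HasDerivAt (fun t : ℝ => σ * t) σ t := by simpa using (hasDerivAt_id t).const_mul σ
      have h2 := h1.comp t (ha.const_add p)
      have h3 := ((ZdActionCr.Tay (n + 1) u p).hasDerivAt (σ * t)).comp t ha
      rw [ZdActionCr.Tay_deriv] at h3
      refine (h2.sub h3).congr_deriv ?_
      ring
    refine ⟨hbO hu, hder.mono fun t ht => ht.differentiableAt, ?_⟩
    have hu' : ContDiffOn ℝ n (derivWithin u (Icc (0:ℝ) 1)) (Icc (0:ℝ) 1) :=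
      hu.derivWithin (uniqueDiffOn_Icc zero_lt_one) (by norm_cast)
    refine ((ih hu').cmul σ).congr ?_
    filter_upwards [hder] with t ht
    exact ht.deriv.symm

/-- transfer of limits along an orbit -/
lemma transfer {φ h : ℝ → ℝ} {l : Filter ℝ} (hc : Continuous φ) (h0 : Tendsto φ atTop (𝓝 0)) (hp : ∀ s, 0 < φ s)
    (hh : Tendsto (fun s => h (φ s)) atTop l) : Tendsto h (𝓝[>] (0:ℝ)) l := by
  intro U hU
  obtain ⟨S, hS⟩ := eventually_atTop.1 (hh hU)
  have : Ioo 0 (φ S) ∈ 𝓝[>] (0:ℝ) := Ioo_mem_nhdsGT (hp S)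
  refine mem_map.2 (mem_of_superset this fun t ht => ?_)
  obtain ⟨T, hT1, hT2⟩ := ((h0.eventually (gt_mem_nhds ht.1)).and (eventually_ge_atTop S)).exists
  obtain ⟨s, hs, rfl⟩ := intermediate_value_Icc' hT2 hc.continuousOn (show t ∈ Icc (φ T) (φ S) from ⟨hT1.le, ht.2.le⟩)
  exact hS s hs.1

namespace FlowD
variable {Φ L : ℝ → ℝ → ℝ}

lemma FX_rev (H : FlowD Φ L) {x : ℝ} (hx : x ∈ Icc (0:ℝ) 1) :
    FX (fun t => Φ (-t)) (fun t => L (-t)) x = - FX Φ L x := by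
  have h1 := H.rev.hasDeriv0 hx
  have h2 : HasDerivAt (fun t => Φ t x) (FX Φ L x) (-0) := by simpa using H.hasDeriv0 hx
  have h3 := h2.comp (0:ℝ) (hasDerivAt_neg (0:ℝ))
  have := h1.unique h3
  linarith

lemma orbit_sign (H : FlowD Φ L) {x : ℝ} (hx : x ∈ Icc (0:ℝ) 1) {σ : ℝ} (h : σ * FX Φ L x < 0) :
    Antitone fun s => σ * Φ s x := by
  refine antitone_of_hasDerivAt_nonpos (f' := fun s => σ * FX Φ L (Φ s x)) (fun s => (H.hasDeriv hx s).const_mul σ) fun s => ?_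
  show σ * FX Φ L (Φ s x) ≤ 0
  rw [H.X_push hx s]
  have := mul_neg_of_pos_of_neg (Real.exp_pos (L s x)) h
  linarith

lemma orb_exists (H : FlowD Φ L) {m : ℕ} (hm : 1 ≤ m) (hl : ContDiffOn ℝ m (L 1) (Icc (0:ℝ) 1)) {x : ℝ}
    (hx : x ∈ Ioo (0:ℝ) 1) (hX : FX Φ L x ≠ 0) : ∃ e, Orb Φ L m x e := by
  have hxI := Ioo_subset_Icc_self hx
  rcases lt_or_gt_of_ne hX with h | h
  · have h1 := H.orbit_sign hxI (σ := 1) (by linarith)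
    simp only [one_mul] at h1
    exact ⟨_, H, hm, hl, hx, hX, tendsto_atTop_ciInf h1 ⟨0, by rintro _ ⟨s, rfl⟩; exact (H.mem s x hxI).1⟩⟩
  · have h1 := H.orbit_sign hxI (σ := -1) (by linarith)
    have h2 : Monotone fun s => Φ s x := by
      intro s t hst
      have := h1 hst
      simp only at this ⊢
      linarith
    exact ⟨_, H, hm, hl, hx, hX, tendsto_atTop_ciSup h2 ⟨1, by rintro _ ⟨s, rfl⟩; exact (H.mem s x hxI).2⟩⟩

lemma X_contDiffAt (H : FlowD Φ L) {m : ℕ} (hm : 1 ≤ m) (hl : ContDiffOn ℝ m (L 1) (Icc (0:ℝ) 1)) {x : ℝ}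
    (hx : x ∈ Ioo (0:ℝ) 1) (hX : FX Φ L x ≠ 0) : ContDiffAt ℝ m (FX Φ L) x := by
  obtain ⟨e, O⟩ := H.orb_exists hm hl hx hX
  exact O.X_contDiffAt

lemma side_lims_aux (H : FlowD Φ L) {m : ℕ} (hm : 1 ≤ m) (hl : ContDiffOn ℝ m (L 1) (Icc (0:ℝ) 1)) {p σ δ : ℝ}
    (hσ : σ = 1 ∨ σ = -1) (hδ : 0 < δ) (hpI : p ∈ Icc (0:ℝ) 1) (hp : ∀ t, Φ t p = p)
    (hS : ∀ s ∈ Ioo 0 δ, p + σ * s ∈ Ioo (0:ℝ) 1 ∧ FX Φ L (p + σ * s) ≠ 0)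
    (hneg : σ * FX Φ L (p + σ * (δ / 2)) < 0) :
    (∃ c, Tendsto (fun t => _root_.deriv (FX Φ L) (p + σ * t)) (𝓝[>] (0:ℝ)) (𝓝 c)) ∧
    ∀ j, j + 2 ≤ m → Tendsto (fun t => FX Φ L (p + σ * t) ^ (j + 1) * iteratedDeriv (j + 2) (FX Φ L) (p + σ * t))
      (𝓝[>] (0:ℝ)) (𝓝 0) := by
  have hd2 : δ / 2 ∈ Ioo 0 δ := ⟨by linarith, by linarith⟩
  obtain ⟨hx, hX⟩ := hS _ hd2
  set x := p + σ * (δ / 2) with hxdef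
  have hxI := Ioo_subset_Icc_self hx
  have hss : σ * σ = 1 := by rcases hσ with h | h <;> simp [h]
  set φ : ℝ → ℝ := fun s => σ * (Φ s x - p) with hφ
  have hφx : ∀ s, p + σ * φ s = Φ s x := by
    intro s
    simp only [hφ]
    linear_combination (Φ s x - p) * hss
  have hpos : ∀ s, 0 < φ s := by
    intro s
    rcases hσ with h | h
    · have h1 : p < x := by rw [hxdef, h]; linarith
      have h2 := H.strictMonoOn s hpI hxI h1
      rw [hp] at h2
      simp only [hφ, h]; linarith
    · have h1 : x < p := by rw [hxdef, h]; linarith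
      have h2 := H.strictMonoOn s hxI hpI h1
      rw [hp] at h2
      simp only [hφ, h]; linarith
  have hφc : Continuous φ := ((H.c1 x).sub continuous_const).const_mul σ |> fun h => h
  have hanti : Antitone φ := by
    intro s t hst
    have := H.orbit_sign hxI hneg hst
    simp only [hφ] at this ⊢
    linarith
  have hφ0 : φ 0 = δ / 2 := by
    simp only [hφ, H.zero, hxdef]
    linear_combination (δ / 2) * hss
  have hbb : BddBelow (range φ) := ⟨0, by rintro _ ⟨s, rfl⟩; exact (hpos s).le⟩
  have hlim := tendsto_atTop_ciInf hanti hbb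
  set e := ⨅ s, φ s with he
  have he0 : 0 ≤ e := le_ciInf fun s => (hpos s).le
  have he1 : e ≤ δ / 2 := by rw [← hφ0]; exact ciInf_le hbb 0
  have hlim2 : Tendsto (fun s => Φ s x) atTop (𝓝 (p + σ * e)) := by
    refine ((hlim.const_mul σ).const_add p).congr fun s => hφx s
  have hfix : Φ 1 (p + σ * e) = p + σ * e := by
    have h1 := ((H.c2 1).tendsto _).comp hlim2
    have h2 := hlim2.comp (tendsto_atTop_add_const_left atTop (1:ℝ) tendsto_id)
    refine tendsto_nhds_unique h1 (h2.congr fun s => ?_)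
    simp only [Function.comp_apply, id]
    rw [H.add]
  have hez : e = 0 := by
    by_contra hne
    have h1 := (hS e ⟨lt_of_le_of_ne he0 (Ne.symm hne), by linarith⟩).2
    exact h1 (H.X_eq_zero.2 hfix)
  rw [hez] at hlim
  have O : Orb Φ L m x (p + σ * e) := ⟨H, hm, hl, hx, hX, hlim2⟩
  refine ⟨⟨_, transfer hφc hlim hpos (O.X1_lim.congr fun s => by rw [hφx])⟩, fun j hj => ?_⟩
  refine transfer hφc hlim hpos ((O.Xj_lim hj).congr fun s => by rw [hφx])

lemma side_lims (H : FlowD Φ L) {m : ℕ} (hm : 1 ≤ m) (hl : ContDiffOn ℝ m (L 1) (Icc (0:ℝ) 1))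
    (hl' : ContDiffOn ℝ m (L (-1)) (Icc (0:ℝ) 1)) {p σ δ : ℝ}
    (hσ : σ = 1 ∨ σ = -1) (hδ : 0 < δ) (hpI : p ∈ Icc (0:ℝ) 1) (hp : ∀ t, Φ t p = p)
    (hS : ∀ s ∈ Ioo 0 δ, p + σ * s ∈ Ioo (0:ℝ) 1 ∧ FX Φ L (p + σ * s) ≠ 0) :
    (∃ c, Tendsto (fun t => _root_.deriv (FX Φ L) (p + σ * t)) (𝓝[>] (0:ℝ)) (𝓝 c)) ∧
    ∀ j, j + 2 ≤ m → Tendsto (fun t => FX Φ L (p + σ * t) ^ (j + 1) * iteratedDeriv (j + 2) (FX Φ L) (p + σ * t))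
      (𝓝[>] (0:ℝ)) (𝓝 0) := by
  have hσ0 : σ ≠ 0 := by rcases hσ with h | h <;> simp [h]
  have hd2 : δ / 2 ∈ Ioo 0 δ := ⟨by linarith, by linarith⟩
  rcases lt_or_gt_of_ne (mul_ne_zero hσ0 (hS _ hd2).2) with h | h
  · exact H.side_lims_aux hm hl hσ hδ hpI hp hS h
  · obtain ⟨⟨c, h1⟩, h2⟩ := H.rev.side_lims_aux hm hl' hσ hδ hpI (fun t => hp _) (fun s hs => ⟨(hS s hs).1, by
      rw [H.FX_rev (Ioo_subset_Icc_self (hS s hs).1)]; exact neg_ne_zero.2 (hS s hs).2⟩)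
      (by rw [H.FX_rev (Ioo_subset_Icc_self (hS _ hd2).1)]; linarith)
    have hev : ∀ s ∈ Ioo 0 δ, FX (fun t => Φ (-t)) (fun t => L (-t)) =ᶠ[𝓝 (p + σ * s)] fun x => - FX Φ L x := by
      intro s hs
      filter_upwards [Ioo_mem_nhds (hS s hs).1.1 (hS s hs).1.2] with x hx
      exact H.FX_rev (Ioo_subset_Icc_self hx)
    refine ⟨⟨-c, ?_⟩, fun j hj => ?_⟩
    · refine h1.neg.congr' ?_
      filter_upwards [Ioo_mem_nhdsGT hδ] with s hs
      rw [(hev s hs).deriv_eq, _root_.deriv.fun_neg, neg_neg]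
    · have h3 := (h2 j hj).const_mul ((-1) ^ (j + 2))
      rw [mul_zero] at h3
      refine h3.congr' ?_
      filter_upwards [Ioo_mem_nhdsGT hδ] with s hs
      rw [(hev s hs).iteratedDeriv_eq, (hev s hs).eq_of_nhds, iteratedDeriv_fun_neg, neg_pow (FX Φ L (p + σ * s))]
      have : ((-1:ℝ) ^ (j + 1)) * (-1) ^ (j + 1) = 1 := by rw [← mul_pow]; simp
      rw [pow_succ _ (j + 1)]
      linear_combination (FX Φ L (p + σ * s) ^ (j + 1) * iteratedDeriv (j + 2) (FX Φ L) (p + σ * s)) * this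

end FlowD

/-- conjugation of a polynomial by the map `t ↦ σ t`, with `σ = ±1` -/
def flipP (σ : ℝ) (A : Polynomial ℝ) : Polynomial ℝ :=
  Polynomial.C σ * A.comp (Polynomial.C σ * Polynomial.X)

lemma flipP_eval (σ t : ℝ) (A : Polynomial ℝ) : (flipP σ A).eval t = σ * A.eval (σ * t) := by
  simp [flipP, Polynomial.eval_comp]

lemma flipP_coeff (σ : ℝ) (A : Polynomial ℝ) (n : ℕ) : (flipP σ A).coeff n = σ * (A.coeff n * σ ^ n) := by
  simp only [flipP, Polynomial.coeff_C_mul, Polynomial.comp_C_mul_X_coeff]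

lemma flipP_dvd (σ : ℝ) {A : Polynomial ℝ} {n : ℕ} (h : Polynomial.X ^ n ∣ A) : Polynomial.X ^ n ∣ flipP σ A := by
  rw [Polynomial.X_pow_dvd_iff] at h ⊢
  intro m hm
  rw [flipP_coeff, h m hm]
  simp

lemma flipP_sub (σ : ℝ) (A B : Polynomial ℝ) : flipP σ (A - B) = flipP σ A - flipP σ B := by
  simp [flipP, mul_sub]

lemma flipP_X {σ : ℝ} (h : σ * σ = 1) : flipP σ Polynomial.X = Polynomial.X := by
  simp only [flipP, Polynomial.X_comp]
  rw [← mul_assoc, ← Polynomial.C_mul, h]; simp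

lemma flipP_E {σ : ℝ} (h : σ * σ = 1) (P Y : Polynomial ℝ) :
    (flipP σ Y).comp (flipP σ P) - Polynomial.derivative (flipP σ P) * flipP σ Y =
    flipP σ (Y.comp P - Polynomial.derivative P * Y) := by
  have hC : Polynomial.C σ * Polynomial.C σ = 1 := by rw [← Polynomial.C_mul, h]; simp
  have h1 : (flipP σ Y).comp (flipP σ P) = flipP σ (Y.comp P) := by
    simp only [flipP, Polynomial.mul_comp, Polynomial.C_comp, Polynomial.comp_assoc, Polynomial.X_comp]
    rw [← mul_assoc (Polynomial.C σ) (Polynomial.C σ), hC, one_mul]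
  have h2 : Polynomial.derivative (flipP σ P) = (Polynomial.derivative P).comp (Polynomial.C σ * Polynomial.X) := by
    simp only [flipP, Polynomial.derivative_mul, Polynomial.derivative_C, Polynomial.derivative_comp, Polynomial.derivative_X]
    linear_combination ((Polynomial.derivative P).comp (Polynomial.C σ * Polynomial.X)) * hC
  rw [flipP_sub, h1, h2]
  simp only [flipP, Polynomial.mul_comp]
  ring

lemma iter_flip (σ p : ℝ) (X : ℝ → ℝ) (n : ℕ) :
    iteratedDeriv n (fun t => σ * X (p + σ * t)) = fun t => σ ^ (n + 1) * iteratedDeriv n X (p + σ * t) := by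
  induction n with
  | zero => simp
  | succ n ih =>
    rw [iteratedDeriv_succ, ih]
    funext t
    rw [deriv_const_mul_field, deriv_comp_mul_left σ (fun s => iteratedDeriv n X (p + s)), deriv_comp_const_add,
      iteratedDeriv_succ, smul_eq_mul]
    ring

namespace ZdActionCr
variable {d r : ℕ} {ρ : ZdActionCr d r} {τ : (Fin d → ℤ) →+ ℝ} {a0 : Fin d → ℤ} {Φ L : ℝ → ℝ → ℝ}

lemma Hol.moves (H : ρ.Hol τ a0) {x : ℝ} (hx : x ∉ ρ.Fx) : a0 ∈ ρ.P x ∨ -a0 ∈ ρ.P x := by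
  rcases H.sgn x hx with h | h
  · left; rw [h, H.one]; exact one_pos
  · right; rw [h, map_neg, H.one]; norm_num

lemma Hol.moves_ne (H : ρ.Hol τ a0) {x : ℝ} (hx : x ∉ ρ.Fx) : ρ.F a0 x ≠ x := by
  rw [Ne, F_eq_iff]
  have := H.moves hx
  tauto

lemma Hol.fixed (H : ρ.Hol τ a0) (FD : FlowD Φ L) (hF : ∀ g x, Φ (τ g) x = ρ.F g x) {p : ℝ} (hp : p ∈ ρ.Fx) (t : ℝ) :
    Φ t p = p := by
  have : (fun t => Φ t p) = fun _ => p :=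
    H.dense.equalizer (FD.c1 p) continuous_const (by funext g; exact (hF g p).trans (hp g))
  exact congrFun this t

lemma Hol.X_ne (H : ρ.Hol τ a0) (FD : FlowD Φ L) (hF : ∀ g x, Φ (τ g) x = ρ.F g x) {x : ℝ} (hx : x ∉ ρ.Fx) :
    FX Φ L x ≠ 0 := by
  rw [Ne, FD.X_eq_zero, ← H.one, hF]
  exact H.moves_ne hx

lemma Hol.hl (H : ρ.Hol τ a0) (hL : ∀ g, ∀ x ∈ Icc (0:ℝ) 1, L (τ g) x = ρ.l g x) :
    ContDiffOn ℝ ((r - 1 : ℕ) : WithTop ℕ∞) (L 1) (Icc (0:ℝ) 1) := by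
  have h := (ρ.l_contDiffOn H.r2 a0).congr (hL a0)
  rwa [H.one] at h

lemma Hol.hl' (H : ρ.Hol τ a0) (hL : ∀ g, ∀ x ∈ Icc (0:ℝ) 1, L (τ g) x = ρ.l g x) :
    ContDiffOn ℝ ((r - 1 : ℕ) : WithTop ℕ∞) (L (-1)) (Icc (0:ℝ) 1) := by
  have h := (ρ.l_contDiffOn H.r2 (-a0)).congr (hL (-a0))
  rwa [map_neg, H.one] at h

lemma Hol.nonflat0 (H : ρ.Hol τ a0) {p σ : ℝ} (hp : p ∈ ρ.Fx) (hpI : p ∈ Icc (0:ℝ) 1)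
    {h0 : Fin d → ℤ} (hQ : ρ.Q h0 p ≠ 0) (hσ : σ = 1 ∨ σ = -1)
    (hσI : ∀ᶠ s in 𝓝[>] (0:ℝ), p + σ * s ∈ Icc (0:ℝ) 1) :
    ρ.Q a0 p ≠ 0 := by
  have hσ0 : σ ≠ 0 := by rcases hσ with h | h <;> simp [h]
  obtain ⟨S, -, hS⟩ := ρ.side_const H.r2 hp hpI hQ hσ hσI
  have h1 := ρ.isolated H.r2 hp hpI hQ hσ0 hσI
  obtain ⟨s, hs, hs'⟩ := (hS.and h1).exists
  have := H.moves hs'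
  rw [hs] at this
  exact (ρ.nonflat_of_ne H.r2 hp hpI hQ hσ0 hσI hS this).1

lemma F_side_pos {p σ : ℝ} (hσ : σ = 1 ∨ σ = -1) (hp : p ∈ ρ.Fx) (b : Fin d → ℤ) {t : ℝ} (ht : 0 < t) :
    0 < σ * (ρ.F b (p + σ * t) - p) := by
  have h := ρ.F_strictMono b
  rcases hσ with rfl | rfl
  · have := h (show p < p + 1 * t by linarith)
    rw [hp b] at this
    linarith
  · have := h (show p + -1 * t < p by linarith)
    rw [hp b] at this
    linarith

lemma side_main (H : ρ.Hol τ a0) (FD : FlowD Φ L) (hF : ∀ g x, Φ (τ g) x = ρ.F g x)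
    (hL : ∀ g, ∀ x ∈ Icc (0:ℝ) 1, L (τ g) x = ρ.l g x) {p σ : ℝ} (hp : p ∈ ρ.Fx) (hpI : p ∈ Icc (0:ℝ) 1)
    (hQ : ρ.Q a0 p ≠ 0) (hσ : σ = 1 ∨ σ = -1) (hσI : ∀ᶠ s in 𝓝[>] (0:ℝ), p + σ * s ∈ Icc (0:ℝ) 1)
    {k : ℕ} (hk : (ρ.Q a0 p).natTrailingDegree = k) {Y : Polynomial ℝ} (hYk : Polynomial.X ^ k ∣ Y)
    (hYc : Y.coeff k = (ρ.Q a0 p).trailingCoeff / FJ L p)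
    (hY : Polynomial.X ^ (r + k - 1) ∣ Y.comp (Polynomial.X + ρ.Q a0 p) -
      Polynomial.derivative (Polynomial.X + ρ.Q a0 p) * Y) :
    SC r (r - 1) (fun t => σ * FX Φ L (p + σ * t) - (flipP σ Y).eval t) ∧
    ∀ᶠ t in 𝓝[>] (0:ℝ), ContDiffAt ℝ ((r - 1 : ℕ) : WithTop ℕ∞) (fun t => σ * FX Φ L (p + σ * t)) t := by
  have hr := H.r2
  have hσ0 : σ ≠ 0 := by rcases hσ with h | h <;> simp [h]
  have hss : σ * σ = 1 := by rcases hσ with h | h <;> simp [h]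
  have hinr := side_interior hσ hσI hpI
  have hiso := ρ.isolated hr hp hpI hQ hσ0 hσI
  have hten := side_tendsto hσI
  have hten' : Tendsto (fun s => p + σ * s) (𝓝[>] (0:ℝ)) (𝓝 p) := hten.mono_right nhdsWithin_le_nhds
  obtain ⟨hk1, hkr⟩ := ρ.Q_order hr hp hQ
  rw [hk] at hk1 hkr
  have hJ := FD.J_pos p
  -- the orbit data
  obtain ⟨δ, hδ, hδS⟩ := mem_nhdsGT_iff_exists_Ioo_subset.1 (hinr.and hiso)
  have hlims := FD.side_lims (m := r - 1) (by omega) (H.hl hL) (H.hl' hL) hσ hδ hpI (H.fixed FD hF hp)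
    (fun s hs => ⟨(hδS hs).1, H.X_ne FD hF (hδS hs).2⟩)
  obtain ⟨⟨c, hc⟩, hj⟩ := hlims
  -- the contraction
  obtain ⟨S, -, hS⟩ := ρ.side_const hr hp hpI hQ hσ hσI
  have hSa : a0 ∈ S ∨ -a0 ∈ S := by
    obtain ⟨s, hs, hs'⟩ := (hS.and hiso).exists
    rw [← hs]; exact H.moves hs'
  obtain ⟨b, hb, hbS⟩ : ∃ b, (b = a0 ∨ b = -a0) ∧ ∀ᶠ s in 𝓝[>] (0:ℝ), σ * (ρ.F b (p + σ * s) - (p + σ * s)) < 0 := by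
    have key : ∀ b, b ∈ S → ∀ᶠ s in 𝓝[>] (0:ℝ), p + σ * s < ρ.F b (p + σ * s) := by
      intro b hb
      filter_upwards [hS] with s hs
      rw [← hs] at hb
      exact hb
    have key' : ∀ b, -b ∈ S → ∀ᶠ s in 𝓝[>] (0:ℝ), ρ.F b (p + σ * s) < p + σ * s := by
      intro b hb
      filter_upwards [hS] with s hs
      rw [← hs] at hb
      exact ρ.neg_mem_P.1 hb
    rcases hσ with h | h <;> rcases hSa with h2 | h2
    · refine ⟨-a0, Or.inr rfl, (key' (-a0) (by rwa [neg_neg])).mono fun s hs => ?_⟩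
      rw [h] at hs ⊢; linarith
    · refine ⟨a0, Or.inl rfl, (key' a0 h2).mono fun s hs => ?_⟩
      rw [h] at hs ⊢; linarith
    · refine ⟨a0, Or.inl rfl, (key a0 h2).mono fun s hs => ?_⟩
      rw [h] at hs ⊢; linarith
    · refine ⟨-a0, Or.inr rfl, (key (-a0) h2).mono fun s hs => ?_⟩
      rw [h] at hs ⊢; linarith
  have hbQ : ρ.Q b p ≠ 0 ∧ (ρ.Q b p).natTrailingDegree = k := by
    rw [← hk]
    refine ρ.nonflat_of_ne hr hp hpI hQ hσ0 hσI hS ?_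
    rcases hb with rfl | rfl
    · exact hSa
    · rw [neg_neg]; exact hSa.symm
  -- limit for b
  have hblim := (ρ.lead_tendsto (h := b) hpI hσI).1 (by rw [hbQ.2]; exact hkr)
  rw [hbQ.2] at hblim
  have halim := (ρ.lead_tendsto (h := a0) hpI hσI).1 (by rw [hk]; exact hkr)
  rw [hk] at halim
  have hdf : ∀ᶠ t in 𝓝[>] (0:ℝ), HasDerivAt (fun t => σ * (ρ.F a0 (p + σ * t) - p)) (Real.exp (ρ.l a0 (p + σ * t))) t := by
    filter_upwards [hinr] with t ht
    have h1 := (ρ.F_hasDeriv hr a0 (Ioo_subset_Icc_self ht)).hasDerivAt (Icc_mem_nhds ht.1 ht.2)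
    have ha : HasDerivAt (fun t : ℝ => σ * t) σ t := by simpa using (hasDerivAt_id t).const_mul σ
    refine (((h1.comp t (ha.const_add p)).sub_const p).const_mul σ).congr_deriv ?_
    linear_combination (Real.exp (ρ.l a0 (p + σ * t))) * hss
  have hcd : ∀ᶠ t in 𝓝[>] (0:ℝ), ContDiffAt ℝ ((r - 1 : ℕ) : WithTop ℕ∞) (fun t => σ * FX Φ L (p + σ * t)) t := by
    filter_upwards [hinr, hiso] with t ht ht'
    have h1 := FD.X_contDiffAt (m := r - 1) (by omega) (H.hl hL) ht (H.X_ne FD hF ht')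
    have h2 : ContDiffAt ℝ ((r - 1 : ℕ) : WithTop ℕ∞) (fun t : ℝ => p + σ * t) t := by fun_prop
    exact contDiffAt_const.mul (ContDiffAt.comp (f := fun t : ℝ => p + σ * t) t h1 h2)
  have hside : Side r k (fun t => σ * (ρ.F a0 (p + σ * t) - p)) (fun t => σ * (ρ.F b (p + σ * t) - p))
      (fun t => σ * FX Φ L (p + σ * t)) (flipP σ (Polynomial.X + ρ.Q a0 p)) (flipP σ Y)
      (σ * (Y.coeff k * σ ^ k)) c := by
    refine ⟨hr, hk1, hkr, ?_, ?_, ?_, flipP_dvd σ hYk, flipP_coeff _ _ _, ?_, ?_, hcd, ?_, ?_, ?_, ?_, ?_, ?_, ?_, ?_⟩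
    · -- fP
      refine ((tay_side hσ hpI hσI (ρ.F_contDiffOn a0)).cmul σ).congr (Eventually.of_forall fun t => ?_)
      simp only [flipP_eval, Q, Polynomial.eval_add, Polynomial.eval_sub, Polynomial.eval_X, Polynomial.eval_C]
      ring
    · -- Pk
      rw [← flipP_X hss, ← flipP_sub, flipP_X hss]
      refine flipP_dvd σ ?_
      obtain ⟨B, hB, -⟩ := poly_order (ρ.Q a0 p)
      rw [hk] at hB
      exact ⟨B, by rw [add_sub_cancel_left]; exact hB⟩
    · -- fd
      have h1 : Tendsto (fun t => Real.exp (ρ.l a0 (p + σ * t))) (𝓝[>] (0:ℝ)) (𝓝 (Real.exp (ρ.l a0 p))) :=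
        ((Real.continuous_exp.tendsto _).comp ((ρ.l_continuousOn hr a0 p hpI).tendsto.comp hten))
      have hpos := Real.exp_pos (ρ.l a0 p)
      refine ⟨Real.exp (ρ.l a0 p) / 2, by positivity, ?_⟩
      filter_upwards [hdf, h1.eventually (lt_mem_nhds (half_lt_self hpos))] with t ht1 ht2
      rw [ht1.deriv]; exact ht2.le
    · -- y0
      rw [hYc]
      exact mul_ne_zero hσ0 (mul_ne_zero (div_ne_zero (ρ.Q_tc_ne hQ) hJ.ne') (pow_ne_zero _ hσ0))
    · rw [flipP_E hss]; exact flipP_dvd σ hY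
    · -- eq
      filter_upwards [hdf, hinr] with t ht ht'
      have h1 : p + σ * (σ * (ρ.F a0 (p + σ * t) - p)) = Φ 1 (p + σ * t) := by
        rw [← H.one, hF]; linear_combination (ρ.F a0 (p + σ * t) - p) * hss
      have h2 : L 1 (p + σ * t) = ρ.l a0 (p + σ * t) := by rw [← H.one, hL _ _ (Ioo_subset_Icc_self ht')]
      rw [ht.deriv, h1, FD.X_push (Ioo_subset_Icc_self ht'), h2]
      ring
    · -- lim0
      have h1 : Tendsto (fun t => FJ L (p + σ * t)) (𝓝[>] (0:ℝ)) (𝓝 (FJ L p)) := (FD.J_cont.tendsto p).comp hten'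
      have h2 := (halim.div h1 hJ.ne').const_mul σ
      rw [hYc]
      have e : σ * ((ρ.Q a0 p).trailingCoeff * σ ^ k / FJ L p) = σ * ((ρ.Q a0 p).trailingCoeff / FJ L p * σ ^ k) := by ring
      rw [e] at h2
      refine h2.congr fun t => ?_
      have : Φ 1 (p + σ * t) = ρ.F a0 (p + σ * t) := by rw [← H.one, hF]
      simp only [Pi.div_apply, FX, this]
      ring
    · -- lim1
      refine hc.congr fun t => ?_
      have := congrFun (iter_flip σ p (FX Φ L) 1) t
      rw [iteratedDeriv_one] at this
      rw [this, iteratedDeriv_one]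
      linear_combination (-deriv (FX Φ L) (p + σ * t)) * hss
    · intro j hjr
      have h := (hj j hjr).const_mul (σ ^ (j + 1) * σ ^ (j + 2 + 1))
      rw [mul_zero] at h
      refine h.congr fun t => ?_
      rw [iter_flip]
      ring
    · -- fmap
      refine tendsto_nhdsWithin_iff.2 ⟨?_, ?_⟩
      · have h1 := (((ρ.F_cont a0).tendsto p).comp hten').sub_const p |>.const_mul σ
        rw [hp a0, sub_self, mul_zero] at h1
        exact h1
      · filter_upwards [self_mem_nhdsWithin] with t ht
        exact F_side_pos hσ hp a0 ht
    · -- hg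
      set β := (ρ.Q b p).trailingCoeff * σ ^ k with hβ
      have hβ0 : σ * β ≠ 0 := mul_ne_zero hσ0 (mul_ne_zero (ρ.Q_tc_ne hbQ.1) (pow_ne_zero _ hσ0))
      have h1 := hblim.const_mul σ
      have hle : σ * β ≤ 0 := by
        refine le_of_tendsto h1 ?_
        filter_upwards [hbS, self_mem_nhdsWithin] with t ht ht0
        rw [← mul_div_assoc]
        exact div_nonpos_of_nonpos_of_nonneg ht.le (pow_nonneg (le_of_lt ht0) _)
      have hlt := lt_of_le_of_ne hle hβ0
      refine ⟨-(σ * β) / 2, by linarith, ?_⟩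
      filter_upwards [hbS, self_mem_nhdsWithin, h1.eventually (gt_mem_nhds (show σ * β < σ * β / 2 by linarith))] with t ht ht0 ht1
      have ht0 : 0 < t := ht0
      have e : t - σ * (ρ.F b (p + σ * t) - p) = - (σ * (ρ.F b (p + σ * t) - (p + σ * t))) := by
        linear_combination (-t) * hss
      refine ⟨F_side_pos hσ hp b ht0, by linarith, ?_⟩
      rw [e]
      rw [← mul_div_assoc, div_lt_iff₀ (pow_pos ht0 k)] at ht1
      linarith
    · refine Eventually.of_forall fun t => Continuous.continuousAt ?_
      have := ρ.F_cont b
      fun_prop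
    · rcases hb with rfl | rfl
      · exact Or.inl (Eventually.of_forall fun t => rfl)
      · refine Or.inr (Eventually.of_forall fun t => ?_)
        have h1 : p + σ * (σ * (ρ.F (-a0) (p + σ * t) - p)) = ρ.F (-a0) (p + σ * t) := by
          linear_combination (ρ.F (-a0) (p + σ * t) - p) * hss
        show σ * (ρ.F a0 (p + σ * (σ * (ρ.F (-a0) (p + σ * t) - p))) - p) = t
        rw [h1, F_F_neg]
        linear_combination t * hss
  exact ⟨hside.main (r - 1) le_rfl, hcd⟩

/-- one-sided remainder function -/
lemma side_w (H : ρ.Hol τ a0) (FD : FlowD Φ L) (hF : ∀ g x, Φ (τ g) x = ρ.F g x)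
    (hL : ∀ g, ∀ x ∈ Icc (0:ℝ) 1, L (τ g) x = ρ.l g x) {p σ : ℝ} (hp : p ∈ ρ.Fx) (hpI : p ∈ Icc (0:ℝ) 1)
    (hQ : ρ.Q a0 p ≠ 0) (hσ : σ = 1 ∨ σ = -1)
    {k : ℕ} (hk : (ρ.Q a0 p).natTrailingDegree = k) {Y : Polynomial ℝ} (hYk : Polynomial.X ^ k ∣ Y)
    (hYc : Y.coeff k = (ρ.Q a0 p).trailingCoeff / FJ L p)
    (hY : Polynomial.X ^ (r + k - 1) ∣ Y.comp (Polynomial.X + ρ.Q a0 p) -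
      Polynomial.derivative (Polynomial.X + ρ.Q a0 p) * Y) :
    ∃ δ > 0, ∃ w : ℝ → ℝ, ContDiffOn ℝ ((r - 1 : ℕ) : WithTop ℕ∞) w (Ioo (-δ) δ) ∧ (∀ t ≤ 0, w t = 0) ∧
      ∀ t ∈ Ioo 0 δ, p + σ * t ∈ Icc (0:ℝ) 1 → FX Φ L (p + σ * t) = Y.eval (σ * t) + w t := by
  have hr := H.r2
  have hss : σ * σ = 1 := by rcases hσ with h | h <;> simp [h]
  by_cases hσI : ∀ᶠ s in 𝓝[>] (0:ℝ), p + σ * s ∈ Icc (0:ℝ) 1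
  · obtain ⟨h1, h2⟩ := side_main H FD hF hL hp hpI hQ hσ hσI hk hYk hYc hY
    obtain ⟨δ, hδ, hδS⟩ := mem_nhdsGT_iff_exists_Ioo_subset.1 h2
    have hz : ContDiffOn ℝ ((r - 1 : ℕ) : WithTop ℕ∞) (fun t => σ * FX Φ L (p + σ * t) - (flipP σ Y).eval t) (Ioo 0 δ) :=
      fun t ht => ContDiffAt.contDiffWithinAt (ContDiffAt.sub (show ContDiffAt ℝ ((r - 1 : ℕ) : WithTop ℕ∞)
        (fun t => σ * FX Φ L (p + σ * t)) t from hδS ht) (poly_cd (flipP σ Y)).contDiffAt)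
    have h3 := ind_lemma (n := r - 1) hδ hz (by rwa [Nat.sub_add_cancel (by omega)])
    refine ⟨δ, hδ, fun t => σ * _, contDiffOn_const.mul h3, ?_, ?_⟩
    · intro t ht
      simp only
      rw [indicator_of_notMem (by simpa using ht), mul_zero]
    · intro t ht _
      simp only
      rw [indicator_of_mem (show t ∈ Ioi (0:ℝ) from ht.1), flipP_eval]
      linear_combination (Y.eval (σ * t) - FX Φ L (p + σ * t)) * hss
  · refine ⟨1, one_pos, fun _ => 0, contDiffOn_const, fun _ _ => rfl, fun t ht htI => ?_⟩
    exfalso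
    apply hσI
    filter_upwards [Ioo_mem_nhdsGT ht.1] with s hs
    obtain ⟨a1, a2⟩ := htI
    obtain ⟨b1, b2⟩ := hpI
    obtain ⟨c1, c2⟩ := hs
    rcases hσ with rfl | rfl <;> constructor <;> linarith

lemma Hol.X_fixed (H : ρ.Hol τ a0) (FD : FlowD Φ L) (hF : ∀ g x, Φ (τ g) x = ρ.F g x)
    (hL : ∀ g, ∀ x ∈ Icc (0:ℝ) 1, L (τ g) x = ρ.l g x) {p : ℝ} (hp : p ∈ ρ.Fx) (hpI : p ∈ Icc (0:ℝ) 1)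
    (hnp : ¬ IsRParabolicPt ρ p) :
    ContDiffWithinAt ℝ ((r - 1 : ℕ) : WithTop ℕ∞) (FX Φ L) (Icc (0:ℝ) 1) p := by
  have hr := H.r2
  obtain ⟨h0, hh0⟩ := H.nonflat p hpI hp hnp
  have hQ : ρ.Q a0 p ≠ 0 := by
    by_cases h1 : p < 1
    · refine H.nonflat0 (σ := 1) hp hpI hh0 (Or.inl rfl) ?_
      filter_upwards [Ioo_mem_nhdsGT (sub_pos.2 h1)] with s hs
      exact ⟨by linarith [hs.1, hpI.1], by linarith [hs.2]⟩
    · refine H.nonflat0 (σ := -1) hp hpI hh0 (Or.inr rfl) ?_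
      filter_upwards [Ioo_mem_nhdsGT (zero_lt_one (α := ℝ))] with s hs
      exact ⟨by linarith [hs.2], by linarith [hs.1, hpI.2]⟩
  obtain ⟨hk1, hkr⟩ := ρ.Q_order hr hp hQ
  obtain ⟨B, hB, hB0⟩ := poly_order (ρ.Q a0 p)
  obtain ⟨k, hk⟩ : ∃ k, (ρ.Q a0 p).natTrailingDegree = k := ⟨_, rfl⟩
  rw [hk] at hB hk1 hkr
  have hBc : B.coeff 0 = (ρ.Q a0 p).trailingCoeff := by rw [Polynomial.coeff_zero_eq_eval_zero, hB0]
  obtain ⟨Y, hYk, hYc, hY⟩ := PolL.exists_Y hk1 (B := B) (P := Polynomial.X + ρ.Q a0 p) (by rw [← hB])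
    (by rw [hBc]; exact ρ.Q_tc_ne hQ) (by
      intro hk1
      rw [hBc, Polynomial.trailingCoeff, hk, hk1, Q_coeff _ _ hp, if_pos (by omega)]
      have := ρ.D_pos a0 hpI
      simp only [if_true, Nat.factorial_one, Nat.cast_one, div_one, iteratedDerivWithin_one]
      simp only [D] at this
      linarith) ((ρ.Q a0 p).trailingCoeff / FJ L p) r
  have hY' := (pow_dvd_pow Polynomial.X (show r + k - 1 ≤ 2 * k + r by omega)).trans hY
  obtain ⟨δ₁, hδ₁, w₁, hw₁, hz₁, he₁⟩ := side_w H FD hF hL hp hpI hQ (Or.inl rfl) hk hYk hYc hY'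
  obtain ⟨δ₂, hδ₂, w₂, hw₂, hz₂, he₂⟩ := side_w H FD hF hL hp hpI hQ (Or.inr rfl) hk hYk hYc hY'
  have hFX : FX Φ L p = 0 := by rw [FD.X_eq_zero]; exact H.fixed FD hF hp 1
  have hY0 : Y.eval 0 = 0 := by
    rw [← Polynomial.coeff_zero_eq_eval_zero]
    exact Polynomial.X_pow_dvd_iff.1 hYk 0 (by omega)
  have hcd : ContDiffAt ℝ ((r - 1 : ℕ) : WithTop ℕ∞) (fun x => Y.eval (x - p) + w₁ (x - p) + w₂ (p - x)) p := by
    have c1 : ContDiffAt ℝ ((r - 1 : ℕ) : WithTop ℕ∞) w₁ (p - p) :=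
      hw₁.contDiffAt (Ioo_mem_nhds (by linarith) (by linarith))
    have c2 : ContDiffAt ℝ ((r - 1 : ℕ) : WithTop ℕ∞) w₂ (p - p) :=
      hw₂.contDiffAt (Ioo_mem_nhds (by linarith) (by linarith))
    refine (ContDiffAt.add ?_ ?_).add ?_
    · exact ((poly_cd Y).comp (contDiff_id.sub contDiff_const)).contDiffAt
    · exact ContDiffAt.comp (f := fun x : ℝ => x - p) p c1 (contDiff_id.sub contDiff_const).contDiffAt
    · exact ContDiffAt.comp (f := fun x : ℝ => p - x) p c2 (contDiff_const.sub contDiff_id).contDiffAt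
  have heq : ∀ x ∈ Icc (0:ℝ) 1, x ∈ Ioo (p - δ₂) (p + δ₁) → FX Φ L x = Y.eval (x - p) + w₁ (x - p) + w₂ (p - x) := by
    intro x hxI hx
    obtain ⟨hx1, hx2⟩ := hx
    rcases lt_trichotomy x p with h | h | h
    · have := he₂ (p - x) ⟨by linarith, by linarith⟩ (by
        rw [show p + -1 * (p - x) = x by ring]; exact hxI)
      rw [show p + -1 * (p - x) = x by ring, show -1 * (p - x) = x - p by ring] at this
      rw [this, hz₁ (x - p) (by linarith), add_zero]
    · subst h
      rw [hFX, sub_self, hY0, hz₁ 0 le_rfl, hz₂ 0 le_rfl]; ring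
    · have := he₁ (x - p) ⟨by linarith, by linarith⟩ (by
        rw [show p + 1 * (x - p) = x by ring]; exact hxI)
      rw [show p + 1 * (x - p) = x by ring, one_mul] at this
      rw [this, hz₂ (p - x) (by linarith), add_zero]
  refine hcd.contDiffWithinAt.congr_of_eventuallyEq ?_ (heq p hpI ⟨by linarith, by linarith⟩)
  filter_upwards [self_mem_nhdsWithin, mem_nhdsWithin_of_mem_nhds (Ioo_mem_nhds (show p - δ₂ < p by linarith)
    (show p < p + δ₁ by linarith))] with x hx1 hx2
  exact heq x hx1 hx2

end ZdActionCr

lemma FlowD.isC1FlowOn {Φ L : ℝ → ℝ → ℝ} (H : FlowD Φ L) :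
    IsC1FlowOn (Icc (0:ℝ) 1) Φ fun t x => Real.exp (L t x) := by
  refine ⟨fun x => H.zero x, fun t u x => H.add t u x, fun t x hx => H.out t x hx, fun t => ?_, fun t x hx => H.deriv t x hx,
    fun t => (Real.continuous_exp.comp (H.cL2 t)).continuousOn, fun t x _ => Real.exp_pos _, ?_⟩
  · refine BijOn.mk (fun x hx => H.mem t x hx) (fun x _ y _ h => ?_) fun y hy => ⟨Φ (-t) y, H.mem _ y hy, H.neg_right t y⟩
    have := congrArg (Φ (-t)) h
    rwa [H.neg_left, H.neg_left] at this
  · intro t₀ K hK _ ε hε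
    have h1 := hK.eventually_forall_of_forall_eventually (x₀ := t₀)
      (P := fun t x => |Φ t x - Φ t₀ x| + |L t x - L t₀ x| < ε) (by
        intro x _
        have hc : Continuous fun z : ℝ × ℝ => |Φ z.1 z.2 - Φ t₀ z.2| + |L z.1 z.2 - L t₀ z.2| := by
          have c1 : Continuous fun z : ℝ × ℝ => Φ z.1 z.2 := H.cF
          have c2 : Continuous fun z : ℝ × ℝ => L z.1 z.2 := H.cL
          have c3 := (H.c2 t₀).comp (continuous_snd (X := ℝ) (Y := ℝ))
          have c4 := (H.cL2 t₀).comp (continuous_snd (X := ℝ) (Y := ℝ))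
          exact ((c1.sub c3).abs).add ((c2.sub c4).abs)
        have := hc.tendsto (t₀, x)
        refine this.eventually (gt_mem_nhds ?_)
        simpa using hε)
    obtain ⟨δ, hδ, h2⟩ := Metric.eventually_nhds_iff.1 h1
    refine ⟨δ, hδ, fun t ht x hx => ?_⟩
    simp only [Real.log_exp]
    exact h2 (by rwa [Real.dist_eq]) x hx

/-- Let `r ≥ 2`. If a `Cʳ` action of `ℤᵈ` on `[0,1]` has a noncyclic image group and no
`r`-parabolic global fixed point in `(0,1)`, then it embeds into a `C¹` flow which, away from
the possible `r`-parabolic fixed points at the endpoints, is generated by a `C^{r-1}` vector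
field. -/
theorem noncyclic_Cr_action_embeds_in_flow (d r : ℕ) (hr : 2 ≤ r) (ρ : ZdActionCr d r)
    (hnc : ¬ ∃ c : Fin d → ℤ, ∀ a : Fin d → ℤ, ∃ n : ℤ, ∀ x : ℝ,
      (ρ.elt a).toFun x = (ρ.elt (n • c)).toFun x)
    (hnp : ∀ p ∈ Ioo (0:ℝ) 1, ¬ IsRParabolicPt ρ p) :
    ∃ Φ Φ' : ℝ → ℝ → ℝ, IsC1FlowOn (Icc (0:ℝ) 1) Φ Φ' ∧
      (∀ a : Fin d → ℤ, ∃ t : ℝ, ∀ x : ℝ, (ρ.elt a).toFun x = Φ t x) ∧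
      ∃ X : ℝ → ℝ,
        ContDiffOn ℝ (r - 1)
          X (Icc (0:ℝ) 1 \ {p | (p = 0 ∨ p = 1) ∧ IsRParabolicPt ρ p}) ∧
        ∀ x ∈ Icc (0:ℝ) 1 \ {p | (p = 0 ∨ p = 1) ∧ IsRParabolicPt ρ p}, ∀ t : ℝ,
          HasDerivAt (fun τ => Φ τ x) (X (Φ t x)) t := by
  obtain ⟨τ, a0, H⟩ := ρ.holder hr hnc hnp
  obtain ⟨Φ, L, FD, hF, hL⟩ := H.flow
  refine ⟨Φ, _, FD.isC1FlowOn, fun a => ⟨τ a, fun x => (hF a x).symm⟩, FX Φ L, ?_, fun x hx t => FD.hasDeriv hx.1 t⟩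
  have hcast : ((r : WithTop ℕ∞) - 1) = ((r - 1 : ℕ) : WithTop ℕ∞) := by norm_cast
  rw [hcast]
  intro p hp
  obtain ⟨hpI, hp2⟩ := hp
  by_cases hpF : p ∈ ρ.Fx
  · have hn : ¬ IsRParabolicPt ρ p := by
      intro h
      by_cases h2 : p = 0 ∨ p = 1
      · exact hp2 ⟨h2, h⟩
      · push Not at h2
        exact hnp p ⟨lt_of_le_of_ne hpI.1 (Ne.symm h2.1), lt_of_le_of_ne hpI.2 h2.2⟩ h
    exact (H.X_fixed FD hF hL hpF hpI hn).mono sdiff_subset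
  · exact (FD.X_contDiffAt (m := r - 1) (by omega) (H.hl hL) (ρ.mem_Ioo_of_not_Fx hpF) (H.X_ne FD hF hpF)).contDiffWithinAt
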